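/- Let (ΛV,d) be a pure coformal elliptic minimal Sullivan model. Then for every integer r ≥ 2, cat(ΛV) + MTC_r(ΛV) ≤ MTC_{r+1}(ΛV). -/

import Mathlib

noncomputable section

namespace RHT

/-- A graded-commutative differential graded algebra over `ℚ`, graded by `ℕ`,
with a degree `+1` differential satisfying the graded Leibniz rule. -/
class GCDGA (A : Type) extends Ring A, Algebra ℚ A where
  grading : ℕ → Submodule ℚ A
  gradedAlgebra : GradedAlgebra grading
  grading_comm : ∀ (i j : ℕ) (a b : A), a ∈ grading i → b ∈ grading j →
    a * b = ((-1 : ℚ) ^ (i * j)) • (b * a)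
  d : A →ₗ[ℚ] A
  d_sq : ∀ a : A, d (d a) = 0
  d_grading : ∀ (i : ℕ) (a : A), a ∈ grading i → d a ∈ grading (i + 1)
  d_leibniz : ∀ (i : ℕ) (a b : A), a ∈ grading i →
    d (a * b) = d a * b + ((-1 : ℚ) ^ i) • (a * d b)

/-- The grading of a gcdga, with the algebra explicit. -/
def Gr (A : Type) [GCDGA A] : ℕ → Submodule ℚ A := GCDGA.grading

/-- The differential of a gcdga, with the algebra explicit. -/
def Dd (A : Type) [GCDGA A] : A →ₗ[ℚ] A := GCDGA.d

/-- Morphisms of cdga's: `ℚ`-algebra morphisms preserving the grading and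
commuting with the differentials. -/
def IsDGAHom {A B : Type} [GCDGA A] [GCDGA B] (f : A →ₐ[ℚ] B) : Prop :=
  (∀ a : A, f (Dd A a) = Dd B (f a)) ∧
    ∀ (i : ℕ) (a : A), a ∈ Gr A i → f a ∈ Gr B i

theorem isDGAHom_id (A : Type) [GCDGA A] : IsDGAHom (AlgHom.id ℚ A) :=
  ⟨fun _ => rfl, fun _ _ h => h⟩

/-- A quasi-isomorphism: a morphism inducing an isomorphism in cohomology
(stated elementwise: surjectivity and injectivity on cohomology classes). -/
def QuasiIso {A B : Type} [GCDGA A] [GCDGA B] (f : A →ₐ[ℚ] B) : Prop :=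
  (∀ b : B, Dd B b = 0 → ∃ a : A, Dd A a = 0 ∧ ∃ c : B, f a - b = Dd B c) ∧
    ∀ a : A, Dd A a = 0 → (∃ c : B, f a = Dd B c) → ∃ e : A, a = Dd A e

/-- Injectivity in cohomology, stated elementwise. -/
def CohomologyInjective {A B : Type} [GCDGA A] [GCDGA B] (f : A →ₐ[ℚ] B) : Prop :=
  ∀ a : A, Dd A a = 0 → (∃ c : B, f a = Dd B c) → ∃ e : A, a = Dd A e

/-- A homotopy retraction for a morphism `ρ` of cdga's: a factorization of `ρ`
through a surjective quasi-isomorphism `q : C → Q` (playing the role of the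
relative Sullivan model of `ρ`) together with a cdga retraction `τ`. -/
structure HtpyRetraction {T Q : Type} [GCDGA T] [GCDGA Q] (ρ : T →ₐ[ℚ] Q) where
  C : Type
  [instC : GCDGA C]
  j : T →ₐ[ℚ] C
  q : C →ₐ[ℚ] Q
  τ : C →ₐ[ℚ] T
  j_dga : IsDGAHom j
  q_dga : IsDGAHom q
  τ_dga : IsDGAHom τ
  q_surj : Function.Surjective q
  q_quasi : QuasiIso q
  hqj : q.comp j = ρ
  hτj : τ.comp j = AlgHom.id ℚ T

attribute [instance] HtpyRetraction.instC

/-- A homotopy retraction of `T`-modules for a morphism `ρ : T → Q` of cdga's: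
as above, but the retraction `τ` is only required to be a morphism of
differential `T`-modules. -/
structure ModHtpyRetraction {T Q : Type} [GCDGA T] [GCDGA Q] (ρ : T →ₐ[ℚ] Q) where
  C : Type
  [instC : GCDGA C]
  j : T →ₐ[ℚ] C
  q : C →ₐ[ℚ] Q
  τ : C →ₗ[ℚ] T
  j_dga : IsDGAHom j
  q_dga : IsDGAHom q
  q_surj : Function.Surjective q
  q_quasi : QuasiIso q
  hqj : q.comp j = ρ
  τ_chain : ∀ c : C, τ (Dd C c) = Dd T (τ c)
  τ_mod : ∀ (t : T) (c : C), τ (j t * c) = t * τ c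
  hτj : ∀ t : T, τ (j t) = t

attribute [instance] ModHtpyRetraction.instC

/-- `T`, together with the morphisms `ι j : A → T`, is the `r`-fold (graded)
tensor power of `A`, characterized as the `r`-fold coproduct of copies of `A`
in the category of cdga's. -/
structure TensorPower (A : Type) [GCDGA A] (r : ℕ) (T : Type) [GCDGA T] where
  ι : Fin r → (A →ₐ[ℚ] T)
  ι_dga : ∀ j, IsDGAHom (ι j)
  coprod : ∀ (B : Type) [GCDGA B] (f : Fin r → (A →ₐ[ℚ] B)), (∀ j, IsDGAHom (f j)) →
    ∃! g : T →ₐ[ℚ] B, IsDGAHom g ∧ ∀ j, g.comp (ι j) = f j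

/-- The `r`-fold multiplication morphism `μ : A^{⊗ r} → A`, i.e. the fold map
of the coproduct. -/
noncomputable def TensorPower.mu {A : Type} [GCDGA A] {r : ℕ} {T : Type} [GCDGA T]
    (TP : TensorPower A r T) : T →ₐ[ℚ] A :=
  (TP.coprod A (fun _ => AlgHom.id ℚ A) (fun _ => isDGAHom_id A)).choose

/-- The kernel of the `r`-fold multiplication, as a `ℚ`-submodule (ideal). -/
noncomputable def TensorPower.kerMu {A : Type} [GCDGA A] {r : ℕ} {T : Type} [GCDGA T]
    (TP : TensorPower A r T) : Submodule ℚ T :=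
  LinearMap.ker TP.mu.toLinearMap

/-- A witness that `TC_r(ΛV) ≤ n`: the projection
`ρ^r_n : (ΛV)^{⊗ r} → (ΛV)^{⊗ r}/(ker μ^r)^{n+1}` admits a homotopy retraction
of cdga's.  The quotient is encoded as a surjective cdga morphism with kernel
`(ker μ^r)^{n+1}`. -/
structure TCWitness (A : Type) [GCDGA A] (r n : ℕ) where
  T : Type
  [instT : GCDGA T]
  TP : TensorPower A r T
  Q : Type
  [instQ : GCDGA Q]
  ρ : T →ₐ[ℚ] Q
  ρ_dga : IsDGAHom ρ
  ρ_surj : Function.Surjective ρ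
  ρ_ker : LinearMap.ker ρ.toLinearMap = TP.kerMu ^ (n + 1)
  retr : Nonempty (HtpyRetraction ρ)

/-- The higher rational topological complexity `TC_r`. -/
noncomputable def TC (A : Type) [GCDGA A] (r : ℕ) : ℕ :=
  sInf {n | Nonempty (TCWitness A r n)}

/-- A witness that `MTC_r(ΛV) ≤ n`: `ρ^r_n` admits a homotopy retraction of
`(ΛV)^{⊗ r}`-modules. -/
structure MTCWitness (A : Type) [GCDGA A] (r n : ℕ) where
  T : Type
  [instT : GCDGA T]
  TP : TensorPower A r T
  Q : Type
  [instQ : GCDGA Q]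
  ρ : T →ₐ[ℚ] Q
  ρ_dga : IsDGAHom ρ
  ρ_surj : Function.Surjective ρ
  ρ_ker : LinearMap.ker ρ.toLinearMap = TP.kerMu ^ (n + 1)
  retr : Nonempty (ModHtpyRetraction ρ)

/-- The higher module rational topological complexity `MTC_r`. -/
noncomputable def MTC (A : Type) [GCDGA A] (r : ℕ) : ℕ :=
  sInf {n | Nonempty (MTCWitness A r n)}

/-- A witness that `HTC_r(ΛV) ≤ n`: `ρ^r_n` is injective in cohomology. -/
structure HTCWitness (A : Type) [GCDGA A] (r n : ℕ) where
  T : Type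
  [instT : GCDGA T]
  TP : TensorPower A r T
  Q : Type
  [instQ : GCDGA Q]
  ρ : T →ₐ[ℚ] Q
  ρ_dga : IsDGAHom ρ
  ρ_surj : Function.Surjective ρ
  ρ_ker : LinearMap.ker ρ.toLinearMap = TP.kerMu ^ (n + 1)
  inj : CohomologyInjective ρ

/-- The invariant `HTC_r`. -/
noncomputable def HTC (A : Type) [GCDGA A] (r : ℕ) : ℕ :=
  sInf {n | Nonempty (HTCWitness A r n)}

/-- A minimal Sullivan model structure on a gcdga `A`: a simply-connected
graded space of generators `V` of finite type, the word-length grading `lam`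
(`lam k` is `Λ^k V`), freeness of `A` over `V` as a graded-commutative
algebra (expressed by the universal property), and minimality `d V ⊆ Λ^{≥2}V`. -/
structure MinimalSullivan (A : Type) [GCDGA A] where
  V : ℕ → Submodule ℚ A
  lam : ℕ → Submodule ℚ A
  V_le : ∀ n, V n ≤ Gr A n
  V0 : V 0 = ⊥
  V1 : V 1 = ⊥
  V_fin : ∀ n, FiniteDimensional ℚ (V n)
  lam_zero : lam 0 = 1
  lam_one : lam 1 = ⨆ n, V n
  lam_mul : ∀ p q, lam p * lam q ≤ lam (p + q)
  lam_internal : DirectSum.IsInternal lam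
  minimal : ∀ (n : ℕ), ∀ v ∈ V n, Dd A v ∈ ⨆ k, ⨆ (_ : 2 ≤ k), lam k
  free : ∀ (B : Type) [GCDGA B] (f : ∀ n, V n →ₗ[ℚ] B),
    (∀ (n : ℕ) (v : V n), f n v ∈ Gr B n) →
    ∃! g : A →ₐ[ℚ] B, (∀ (i : ℕ) (a : A), a ∈ Gr A i → g a ∈ Gr B i) ∧
      ∀ (n : ℕ) (v : V n), g (v : A) = f n v

namespace MinimalSullivan

variable {A : Type} [GCDGA A] (S : MinimalSullivan A)

/-- The even part of the space of generators. -/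
def Veven : Submodule ℚ A := ⨆ n, S.V (2 * n)

/-- The odd part of the space of generators. -/
def Vodd : Submodule ℚ A := ⨆ n, S.V (2 * n + 1)

/-- The homotopy characteristic `χ_π = dim V^even - dim V^odd`. -/
noncomputable def chiPi : ℤ :=
  (Module.finrank ℚ S.Veven : ℤ) - (Module.finrank ℚ S.Vodd : ℤ)

/-- Purity: `d V^even = 0` and `d V^odd ⊆ Λ V^even`. -/
def Pure : Prop :=
  (∀ a ∈ S.Veven, Dd A a = 0) ∧
    ∀ a ∈ S.Vodd, Dd A a ∈ Algebra.adjoin ℚ (S.Veven : Set A)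

/-- Coformality: the differential is quadratic, `d V ⊆ Λ² V`. -/
def Coformal : Prop := ∀ (n : ℕ), ∀ v ∈ S.V n, Dd A v ∈ S.lam 2

/-- Constant length `l` of the differential: `d V ⊆ Λ^l V`. -/
def ConstantLength (l : ℕ) : Prop := ∀ (n : ℕ), ∀ v ∈ S.V n, Dd A v ∈ S.lam l

end MinimalSullivan

/-- The cohomology of a gcdga, as a `ℚ`-module. -/
def CohClasses (A : Type) [GCDGA A] :=
  LinearMap.ker (Dd A) ⧸ ((LinearMap.range (Dd A)).comap (LinearMap.ker (Dd A)).subtype)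

instance (A : Type) [GCDGA A] : AddCommGroup (CohClasses A) := by
  unfold CohClasses; infer_instance

instance (A : Type) [GCDGA A] : Module ℚ (CohClasses A) := by
  unfold CohClasses; infer_instance

/-- Ellipticity: both the generating space `V` and the cohomology are
finite-dimensional. -/
def Elliptic (A : Type) [GCDGA A] (S : MinimalSullivan A) : Prop :=
  FiniteDimensional ℚ (⨆ n, S.V n : Submodule ℚ A) ∧ FiniteDimensional ℚ (CohClasses A)

/-- A witness of formality: a quasi-isomorphism to a gcdga with zero
differential. -/
structure FormalityWitness (A : Type) [GCDGA A] where
  B : Type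
  [instB : GCDGA B]
  hd : Dd B = 0
  ψ : A →ₐ[ℚ] B
  ψ_dga : IsDGAHom ψ
  ψ_quasi : QuasiIso ψ

/-- Formality of a (Sullivan) cdga. -/
def Formal (A : Type) [GCDGA A] : Prop := Nonempty (FormalityWitness A)

/-- A witness that `cat(ΛV) ≤ n`: the projection `ΛV → ΛV/Λ^{>n}V` admits a
homotopy retraction.  The quotient is encoded as a surjective cdga morphism
whose kernel is `Λ^{>n}V`. -/
structure CatWitness (A : Type) [GCDGA A] (S : MinimalSullivan A) (n : ℕ) where
  Q : Type
  [instQ : GCDGA Q]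
  π : A →ₐ[ℚ] Q
  π_dga : IsDGAHom π
  π_surj : Function.Surjective π
  π_ker : LinearMap.ker π.toLinearMap = ⨆ k, ⨆ (_ : n < k), S.lam k
  retr : Nonempty (HtpyRetraction π)

/-- The rational LS-category. -/
noncomputable def cat (A : Type) [GCDGA A] (S : MinimalSullivan A) : ℕ :=
  sInf {n | Nonempty (CatWitness A S n)}

/-- A witness that `zcl_r(ΛV) ≥ p`: `p` cocycles in `(ΛV)^{⊗ r}` whose classes
are zero-divisors (killed by `H(μ^r)`) and whose product is not exact. -/
structure ZclWitness (A : Type) [GCDGA A] (r p : ℕ) where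
  T : Type
  [instT : GCDGA T]
  TP : TensorPower A r T
  a : Fin p → T
  closed : ∀ i, Dd T (a i) = 0
  zero_div : ∀ i, ∃ b : A, TP.mu (a i) = Dd A b
  prod_ne : ∀ b : T, (List.ofFn a).prod ≠ Dd T b

/-- The `r`-zero-divisor-cuplength `zcl_r`. -/
noncomputable def zcl (A : Type) [GCDGA A] (r : ℕ) : ℕ :=
  sSup {p | Nonempty (ZclWitness A r p)}

/-- A witness that `cl_ℚ(ΛV) ≥ p`: `p` cocycles of positive degree with
non-exact product. -/
structure ClWitness (A : Type) [GCDGA A] (p : ℕ) where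
  a : Fin p → A
  pos : ∀ i, a i ∈ ⨆ k, ⨆ (_ : 0 < k), Gr A k
  closed : ∀ i, Dd A (a i) = 0
  prod_ne : ∀ b : A, (List.ofFn a).prod ≠ Dd A b

/-- The rational cuplength `cl_ℚ`. -/
noncomputable def clQ (A : Type) [GCDGA A] : ℕ :=
  sSup {p | Nonempty (ClWitness A p)}


open scoped TensorProduct

section Basic

variable {A : Type} [GCDGA A]

instance : GradedAlgebra (Gr A) := GCDGA.gradedAlgebra

theorem Gr_comm {i j : ℕ} {a b : A} (ha : a ∈ Gr A i) (hb : b ∈ Gr A j) :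
    a * b = ((-1 : ℚ) ^ (i * j)) • (b * a) := GCDGA.grading_comm i j a b ha hb

@[simp] theorem Dd_Dd (a : A) : Dd A (Dd A a) = 0 := GCDGA.d_sq a

theorem Dd_mem {i : ℕ} {a : A} (ha : a ∈ Gr A i) : Dd A a ∈ Gr A (i + 1) :=
  GCDGA.d_grading i a ha

theorem one_mem_Gr : (1 : A) ∈ Gr A 0 := SetLike.GradedOne.one_mem

theorem mul_mem_Gr {i j : ℕ} {a b : A} (ha : a ∈ Gr A i) (hb : b ∈ Gr A j) :
    a * b ∈ Gr A (i + j) := SetLike.GradedMul.mul_mem ha hb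

/-- Induction on the decomposition into homogeneous components. -/
theorem hom_induction {P : A → Prop} (hadd : ∀ a b, P a → P b → P (a + b))
    (hhom : ∀ i, ∀ a ∈ Gr A i, P a) (a : A) : P a :=
  DirectSum.Decomposition.inductionOn (Gr A) (hhom 0 0 (zero_mem _))
    (fun m => hhom _ _ m.2) hadd a

variable (A) in
/-- The projection onto the homogeneous component of degree `i`. -/
def pr (i : ℕ) : A →ₗ[ℚ] A := GradedAlgebra.proj (Gr A) i

theorem pr_mem (i : ℕ) (a : A) : pr A i a ∈ Gr A i := by
  rw [pr, GradedAlgebra.proj_apply]; exact SetLike.coe_mem _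

theorem pr_same {i : ℕ} {a : A} (ha : a ∈ Gr A i) : pr A i a = a := by
  rw [pr, GradedAlgebra.proj_apply]; exact DirectSum.decompose_of_mem_same _ ha

theorem pr_ne {i j : ℕ} {a : A} (ha : a ∈ Gr A i) (h : i ≠ j) : pr A j a = 0 := by
  rw [pr, GradedAlgebra.proj_apply]; exact DirectSum.decompose_of_mem_ne _ ha h

theorem pr_of_mem {i : ℕ} (j : ℕ) {a : A} (ha : a ∈ Gr A i) :
    pr A j a = if i = j then a else 0 := by
  split_ifs with h
  · subst h; exact pr_same ha
  · exact pr_ne ha h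

theorem mem_of_pr {M : Submodule ℚ A} {a : A} (h : ∀ i, pr A i a ∈ M) : a ∈ M := by
  classical
  rw [← DirectSum.sum_support_decompose (Gr A) a]
  exact M.sum_mem fun i _ => by simpa [pr, GradedAlgebra.proj_apply] using h i

theorem eq_zero_of_pr {a : A} (h : ∀ i, pr A i a = 0) : a = 0 := by
  simpa using mem_of_pr (M := ⊥) (a := a) (by simpa using h)

variable (A) in
/-- The linear endomorphism scaling degree `i` by `σ ^ i`. -/
def scLin (σ : ℚ) : A →ₗ[ℚ] A :=
  (DirectSum.toModule ℚ ℕ A fun i => (σ ^ i) • (Gr A i).subtype) ∘ₗ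
      (DirectSum.decomposeLinearEquiv (Gr A)).toLinearMap

theorem scLin_apply (σ : ℚ) {i : ℕ} {a : A} (ha : a ∈ Gr A i) : scLin A σ a = σ ^ i • a := by
  have : (DirectSum.decomposeLinearEquiv (Gr A)) a = DirectSum.lof ℚ ℕ (fun i => Gr A i) i ⟨a, ha⟩ :=
    DirectSum.decompose_of_mem _ ha
  rw [scLin, LinearMap.comp_apply, LinearEquiv.coe_coe, this, DirectSum.toModule_lof]
  rfl

variable (A) in
/-- The algebra endomorphism scaling degree `i` by `σ ^ i`. -/
def sc (σ : ℚ) : A →ₐ[ℚ] A :=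
  AlgHom.ofLinearMap (scLin A σ) (by simp [scLin_apply σ one_mem_Gr])
    (by
      intro a b
      induction a using hom_induction with
      | hadd a a' ha ha' => rw [add_mul, map_add, ha, ha', map_add, add_mul]
      | hhom i a ha =>
      induction b using hom_induction with
      | hadd a a' ha ha' => rw [mul_add, map_add, ha, ha', map_add, mul_add]
      | hhom j b hb =>
      simp [scLin_apply _ ha, scLin_apply _ hb, scLin_apply _ (mul_mem_Gr ha hb), pow_add,
        smul_smul, mul_comm])

theorem sc_apply (σ : ℚ) {i : ℕ} {a : A} (ha : a ∈ Gr A i) : sc A σ a = σ ^ i • a :=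
  scLin_apply σ ha

theorem sc_mem (σ : ℚ) {i : ℕ} {a : A} (ha : a ∈ Gr A i) : sc A σ a ∈ Gr A i := by
  rw [sc_apply σ ha]; exact Submodule.smul_mem _ _ ha

theorem sc_one (a : A) : sc A 1 a = a := by
  induction a using hom_induction with
  | hadd a a' ha ha' => rw [map_add, ha, ha']
  | hhom i a ha => simp [sc_apply _ ha]

theorem sc_sc (σ τ : ℚ) (a : A) : sc A σ (sc A τ a) = sc A (σ * τ) a := by
  induction a using hom_induction with
  | hadd a a' ha ha' => simp only [map_add, ha, ha']
  | hhom i a ha => simp [sc_apply _ ha, smul_smul, mul_pow, mul_comm]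

theorem sc_Dd (σ : ℚ) (a : A) : sc A σ (Dd A a) = σ • Dd A (sc A σ a) := by
  induction a using hom_induction with
  | hadd a a' ha ha' => simp only [map_add, ha, ha', smul_add]
  | hhom i a ha => simp [sc_apply _ ha, sc_apply _ (Dd_mem ha), smul_smul, pow_succ, mul_comm]

theorem pr_sc (σ : ℚ) (i : ℕ) (a : A) : pr A i (sc A σ a) = σ ^ i • pr A i a := by
  induction a using hom_induction with
  | hadd a a' ha ha' => simp only [map_add, ha, ha', smul_add]
  | hhom j a ha =>
    rw [sc_apply _ ha, map_smul]
    by_cases h : j = i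
    · subst h; rfl
    · simp [pr_ne ha h]

variable (A) in
/-- The degree involution. -/
abbrev eps : A →ₐ[ℚ] A := sc A (-1)

theorem eps_eps (a : A) : eps A (eps A a) = a := by
  rw [sc_sc]; norm_num [sc_one]

theorem eps_Dd (a : A) : eps A (Dd A a) = - Dd A (eps A a) := by
  rw [sc_Dd]; simp

theorem leibniz (a b : A) : Dd A (a * b) = Dd A a * b + eps A a * Dd A b := by
  induction a using hom_induction with
  | hadd a a' ha ha' => simp only [map_add, add_mul, ha, ha']; abel
  | hhom i a ha =>
    rw [sc_apply _ ha, smul_mul_assoc]; exact GCDGA.d_leibniz i a b ha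

@[simp] theorem Dd_one : Dd A 1 = 0 := by
  have := leibniz (1 : A) 1
  simp only [mul_one, map_one, one_mul] at this
  simpa using this

theorem pr_Dd (i : ℕ) (a : A) : pr A (i + 1) (Dd A a) = Dd A (pr A i a) := by
  induction a using hom_induction with
  | hadd a a' ha ha' => simp only [map_add, ha, ha']
  | hhom j a ha =>
    rw [pr_of_mem _ ha, pr_of_mem _ (Dd_mem ha)]
    by_cases h : j = i <;> simp [h]

theorem pr_zero_Dd (a : A) : pr A 0 (Dd A a) = 0 := by
  induction a using hom_induction with
  | hadd a a' ha ha' => simp only [map_add, ha, ha', add_zero]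
  | hhom j a ha => exact pr_ne (Dd_mem ha) (by omega)

theorem mul_comm_hom {i : ℕ} {a : A} (ha : a ∈ Gr A i) (b : A) :
    a * b = sc A ((-1) ^ i) b * a := by
  induction b using hom_induction with
  | hadd b b' h h' => simp only [map_add, add_mul, mul_add, h, h']
  | hhom j b hb => rw [sc_apply _ hb, Gr_comm ha hb, smul_mul_assoc, pow_mul]

theorem mul_comm_hom' {i : ℕ} {a : A} (ha : a ∈ Gr A i) (b : A) :
    b * a = a * sc A ((-1) ^ i) b := by
  rw [mul_comm_hom ha, sc_sc, ← mul_pow]; norm_num [sc_one]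

theorem mul_comm_even {i : ℕ} (hi : Even i) {a : A} (ha : a ∈ Gr A i) (b : A) :
    a * b = b * a := by
  rw [mul_comm_hom ha, hi.neg_one_pow, sc_one]

variable {B : Type} [GCDGA B]

theorem map_pr {f : A →ₗ[ℚ] B} (hf : ∀ i, ∀ a ∈ Gr A i, f a ∈ Gr B i) (i : ℕ) (a : A) :
    f (pr A i a) = pr B i (f a) := by
  induction a using hom_induction with
  | hadd a a' ha ha' => simp only [map_add, ha, ha']
  | hhom j a ha =>
    rw [pr_of_mem _ ha, pr_of_mem _ (hf _ _ ha)]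
    split_ifs <;> simp

theorem map_sc {f : A →ₐ[ℚ] B} (hf : ∀ i, ∀ a ∈ Gr A i, f a ∈ Gr B i) (σ : ℚ) (a : A) :
    f (sc A σ a) = sc B σ (f a) := by
  induction a using hom_induction with
  | hadd a a' ha ha' => simp only [map_add, ha, ha']
  | hhom j a ha => rw [sc_apply _ ha, sc_apply _ (hf _ _ ha), map_smul]

variable {C : Type} [GCDGA C]

theorem IsDGAHom.comp {g : B →ₐ[ℚ] C} {f : A →ₐ[ℚ] B} (hg : IsDGAHom g) (hf : IsDGAHom f) :
    IsDGAHom (g.comp f) :=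
  ⟨fun a => by simp [hf.1, hg.1], fun i a ha => hg.2 _ _ (hf.2 _ _ ha)⟩

/-- A graded subspace. -/
def Homog (M : Submodule ℚ A) : Prop := ∀ i, ∀ a ∈ M, pr A i a ∈ M

theorem Homog.sc {M : Submodule ℚ A} (h : Homog M) (σ : ℚ) {a : A} (ha : a ∈ M) :
    sc A σ a ∈ M :=
  mem_of_pr fun i => by rw [pr_sc]; exact M.smul_mem _ (h i a ha)

/-- A decomposition criterion: `G` is a grading as soon as there are compatible projections. -/
theorem isInternal_of_pr {M : Type} [AddCommGroup M] [Module ℚ M] (G : ℕ → Submodule ℚ M)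
    (p : ℕ → M →ₗ[ℚ] M) (h1 : ∀ i, ∀ m ∈ G i, p i m = m)
    (h2 : ∀ i j, i ≠ j → ∀ m ∈ G i, p j m = 0) (h3 : ∀ m, m ∈ ⨆ i, G i) :
    DirectSum.IsInternal G := by
  rw [DirectSum.isInternal_submodule_iff_iSupIndep_and_iSup_eq_top]
  refine ⟨?_, eq_top_iff.2 fun m _ => h3 m⟩
  intro i
  rw [Submodule.disjoint_def]
  intro m hm hm'
  rw [← h1 i m hm]
  have : (⨆ j, ⨆ (_ : j ≠ i), G j) ≤ LinearMap.ker (p i) :=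
    iSup₂_le fun j hj m hm => h2 j i hj m hm
  exact this hm'

end Basic

section MkGCDGA

/-- Build a gcdga from a family of compatible projections. -/
@[reducible] def GCDGA.ofPr (A : Type) [Ring A] [Algebra ℚ A] (G : ℕ → Submodule ℚ A)
    (hint : DirectSum.IsInternal G) (h1 : (1 : A) ∈ G 0)
    (hmul : ∀ i j a b, a ∈ G i → b ∈ G j → a * b ∈ G (i + j))
    (hcomm : ∀ (i j : ℕ) (a b : A), a ∈ G i → b ∈ G j → a * b = ((-1 : ℚ) ^ (i * j)) • (b * a))
    (d : A →ₗ[ℚ] A) (hd2 : ∀ a, d (d a) = 0) (hdg : ∀ (i : ℕ) (a : A), a ∈ G i → d a ∈ G (i + 1))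
    (hleib : ∀ (i : ℕ) (a b : A), a ∈ G i → d (a * b) = d a * b + ((-1 : ℚ) ^ i) • (a * d b)) :
    GCDGA A where
  grading := G
  gradedAlgebra :=
    letI : SetLike.GradedMonoid G := { one_mem := h1, mul_mem := fun i j a b ha hb => hmul i j a b ha hb }
    { hint.chooseDecomposition with }
  grading_comm := hcomm
  d := d
  d_sq := hd2
  d_grading := hdg
  d_leibniz := hleib

end MkGCDGA

section Tens

variable (A B : Type) [GCDGA A] [GCDGA B]

/-- The graded tensor product of two gcdgas. -/
def Tens : Type := GradedTensorProduct ℚ (Gr A) (Gr B)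

instance : Ring (Tens A B) := inferInstanceAs (Ring (GradedTensorProduct ℚ (Gr A) (Gr B)))
instance : Algebra ℚ (Tens A B) :=
  inferInstanceAs (Algebra ℚ (GradedTensorProduct ℚ (Gr A) (Gr B)))

variable {A B}

/-- Pure tensors, as a bilinear map. -/
def tmL : A →ₗ[ℚ] B →ₗ[ℚ] Tens A B :=
  (TensorProduct.mk ℚ A B).compr₂ (GradedTensorProduct.of ℚ (Gr A) (Gr B)).toLinearMap

/-- Pure tensors. -/
def tm (a : A) (b : B) : Tens A B := tmL a b

theorem tm_add (a : A) (b b' : B) : tm a (b + b') = tm a b + tm a b' := map_add _ _ _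
theorem tm_sub (a : A) (b b' : B) : tm a (b - b') = tm a b - tm a b' := map_sub _ _ _
theorem tm_neg (a : A) (b : B) : tm a (-b) = -tm a b := map_neg _ _
theorem tm_smul (c : ℚ) (a : A) (b : B) : tm a (c • b) = c • tm a b := map_smul _ _ _
@[simp] theorem tm_zero (a : A) : tm a (0 : B) = 0 := map_zero _
theorem add_tm (a a' : A) (b : B) : tm (a + a') b = tm a b + tm a' b := LinearMap.map_add₂ _ _ _ _
theorem sub_tm (a a' : A) (b : B) : tm (a - a') b = tm a b - tm a' b := LinearMap.map_sub₂ _ _ _ _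
theorem neg_tm (a : A) (b : B) : tm (-a) b = -tm a b := LinearMap.map_neg₂ _ _ _
theorem smul_tm (c : ℚ) (a : A) (b : B) : tm (c • a) b = c • tm a b := LinearMap.map_smul₂ _ _ _ _
@[simp] theorem zero_tm (b : B) : tm (0 : A) b = 0 := LinearMap.map_zero₂ _ _

theorem one_tens : (1 : Tens A B) = tm 1 1 := rfl

variable {M : Type*} [AddCommGroup M] [Module ℚ M]

/-- Linear maps out of the tensor product. -/
def tLift (f : A →ₗ[ℚ] B →ₗ[ℚ] M) : Tens A B →ₗ[ℚ] M :=
  TensorProduct.lift f ∘ₗ (GradedTensorProduct.of ℚ (Gr A) (Gr B)).symm.toLinearMap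

@[simp] theorem tLift_tm (f : A →ₗ[ℚ] B →ₗ[ℚ] M) (a : A) (b : B) : tLift f (tm a b) = f a b :=
  TensorProduct.lift.tmul _ _

theorem tens_induction {P : Tens A B → Prop} (h0 : P 0) (hadd : ∀ a b, P a → P b → P (a + b))
    (htm : ∀ i j a b, a ∈ Gr A i → b ∈ Gr B j → P (tm a b)) (z : Tens A B) : P z := by
  have key : ∀ z : A ⊗[ℚ] B, P (GradedTensorProduct.of ℚ (Gr A) (Gr B) z) := by
    intro z
    induction z using TensorProduct.induction_on with
    | zero => rw [map_zero]; exact h0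
    | add a b ha hb => rw [map_add]; exact hadd _ _ ha hb
    | tmul a b =>
      change P (tm a b)
      induction a using hom_induction with
      | hadd a a' ha ha' => rw [add_tm]; exact hadd _ _ ha ha'
      | hhom i a ha =>
      induction b using hom_induction with
      | hadd a a' ha ha' => rw [tm_add]; exact hadd _ _ ha ha'
      | hhom j b hb => exact htm i j a b ha hb
  exact key ((GradedTensorProduct.of ℚ (Gr A) (Gr B)).symm z)

theorem tens_ext {f g : Tens A B →ₗ[ℚ] M}
    (h : ∀ i j a b, a ∈ Gr A i → b ∈ Gr B j → f (tm a b) = g (tm a b)) : f = g :=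
  LinearMap.ext fun z => tens_induction (P := fun z => f z = g z) (by simp) (fun a b ha hb => by simp [ha, hb]) h z

theorem tm_mul_hom {i j : ℕ} (a : A) {b : B} (hb : b ∈ Gr B j) {a' : A} (ha' : a' ∈ Gr A i)
    (b' : B) : tm a b * tm a' b' = (-1 : ℚ) ^ (j * i) • tm (a * a') (b * b') := by
  have := GradedTensorProduct.tmul_coe_mul_coe_tmul (R := ℚ) (Gr A) (Gr B) a ⟨b, hb⟩ ⟨a', ha'⟩ b'
  refine this.trans ?_
  rw [Units.smul_def, ← Int.cast_smul_eq_zsmul ℚ]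
  congr 1
  push_cast
  norm_num

theorem tm_mul {j : ℕ} (a : A) {b : B} (hb : b ∈ Gr B j) (a' : A) (b' : B) :
    tm a b * tm a' b' = tm (a * sc A ((-1) ^ j) a') (b * b') := by
  induction a' using hom_induction with
  | hadd x y hx hy => simp only [add_tm, mul_add, map_add, hx, hy]
  | hhom i a' ha' =>
    rw [tm_mul_hom a hb ha', sc_apply _ ha', mul_smul_comm, smul_tm, pow_mul]

theorem tm_mul_one_left (a a' : A) (b' : B) : tm a (1 : B) * tm a' b' = tm (a * a') b' := by
  rw [tm_mul a one_mem_Gr]; simp [sc_one]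

theorem tm_mul_one_right (a : A) (b b' : B) : tm a b * tm 1 b' = tm a (b * b') := by
  induction b using hom_induction with
  | hadd x y hx hy => simp only [tm_add, add_mul, hx, hy]
  | hhom j b hb => rw [tm_mul a hb]; simp

/-- The tensor product of linear maps. -/
def tMap {A' B' : Type} [GCDGA A'] [GCDGA B'] (f : A →ₗ[ℚ] A') (g : B →ₗ[ℚ] B') :
    Tens A B →ₗ[ℚ] Tens A' B' :=
  tLift ((tmL.compl₂ g).comp f)

@[simp] theorem tMap_tm {A' B' : Type} [GCDGA A'] [GCDGA B'] (f : A →ₗ[ℚ] A') (g : B →ₗ[ℚ] B')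
    (a : A) (b : B) : tMap f g (tm a b) = tm (f a) (g b) :=
  (tLift_tm _ _ _).trans rfl

variable (A B)

/-- The grading of the tensor product. -/
def tGr (n : ℕ) : Submodule ℚ (Tens A B) :=
  Submodule.span ℚ {z | ∃ i j a b, i + j = n ∧ a ∈ Gr A i ∧ b ∈ Gr B j ∧ z = tm a b}

/-- The differential of the tensor product. -/
def tD : Tens A B →ₗ[ℚ] Tens A B :=
  tMap (Dd A) LinearMap.id + tMap (eps A).toLinearMap (Dd B)

variable {A B}

theorem tD_tm (a : A) (b : B) : tD A B (tm a b) = tm (Dd A a) b + tm (eps A a) (Dd B b) := by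
  simp [tD]

theorem tm_mem_tGr {i j : ℕ} {a : A} {b : B} (ha : a ∈ Gr A i) (hb : b ∈ Gr B j) :
    tm a b ∈ tGr A B (i + j) := Submodule.subset_span ⟨i, j, a, b, rfl, ha, hb, rfl⟩

theorem tGr_induction_aux {n : ℕ} {P : Tens A B → Prop} (h0 : P 0)
    (hadd : ∀ a b, P a → P b → P (a + b))
    (htm : ∀ i j a b, i + j = n → a ∈ Gr A i → b ∈ Gr B j → P (tm a b))
    {z : Tens A B} (hz : z ∈ tGr A B n) : P z := by
  have : ∀ c : ℚ, P (c • z) := by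
    induction hz using Submodule.span_induction with
    | mem x hx =>
      obtain ⟨i, j, a, b, h, ha, hb, rfl⟩ := hx
      intro c
      rw [← tm_smul]
      exact htm i j a _ h ha (Submodule.smul_mem _ _ hb)
    | zero => simpa using h0
    | add x y _ _ hx hy => intro c; rw [smul_add]; exact hadd _ _ (hx c) (hy c)
    | smul a x _ hx => intro c; rw [smul_smul]; exact hx _
  simpa using this 1

theorem tGr_induction {n : ℕ} {P : (z : Tens A B) → z ∈ tGr A B n → Prop} (h0 : P 0 (zero_mem _))
    (hadd : ∀ a b ha hb, P a ha → P b hb → P (a + b) (add_mem ha hb))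
    (htm : ∀ i j a b (h : i + j = n) (ha : a ∈ Gr A i) (hb : b ∈ Gr B j),
      P (tm a b) (h ▸ tm_mem_tGr ha hb))
    {z : Tens A B} (hz : z ∈ tGr A B n) : P z hz := by
  obtain ⟨_, h⟩ := tGr_induction_aux (P := fun z => ∃ h, P z h) ⟨_, h0⟩
    (fun a b ⟨_, ha⟩ ⟨_, hb⟩ => ⟨_, hadd _ _ _ _ ha hb⟩)
    (fun i j a b h ha hb => ⟨_, htm i j a b h ha hb⟩) hz
  exact h

theorem tGr_internal : DirectSum.IsInternal (tGr A B) := by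
  have key : ∀ n m : ℕ, ∀ z ∈ tGr A B n,
      (∑ p ∈ Finset.HasAntidiagonal.antidiagonal m, tMap (pr A p.1) (pr B p.2)) z = if n = m then z else 0 := by
    intro n m z hz
    induction hz using tGr_induction with
    | h0 => simp
    | hadd a b _ _ ha hb => rw [map_add, ha, hb]; split_ifs <;> simp
    | htm i j a b h ha hb =>
      subst h
      simp only [LinearMap.sum_apply, tMap_tm, pr_of_mem _ ha, pr_of_mem _ hb]
      split_ifs with h
      · rw [Finset.sum_eq_single (i, j)]
        · simp
        · rintro ⟨p, q⟩ - hne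
          by_cases h1 : i = p
          · by_cases h2 : j = q
            · subst h1 h2; exact absurd rfl hne
            · simp [h2]
          · simp [h1]
        · simp [h]
      · refine Finset.sum_eq_zero ?_
        rintro ⟨p, q⟩ hpq
        rw [Finset.HasAntidiagonal.mem_antidiagonal] at hpq
        by_cases h1 : i = p
        · have : j ≠ q := by rintro rfl; subst h1; exact h hpq
          simp [this]
        · simp [h1]
  refine isInternal_of_pr _ (fun m => ∑ p ∈ Finset.HasAntidiagonal.antidiagonal m, tMap (pr A p.1) (pr B p.2))
    (fun i z hz => by simpa using key i i z hz) (fun i j h z hz => by simpa [h] using key i j z hz) ?_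
  intro z
  induction z using tens_induction with
  | h0 => exact zero_mem _
  | hadd a b ha hb => exact add_mem ha hb
  | htm i j a b ha hb => exact Submodule.mem_iSup_of_mem _ (tm_mem_tGr ha hb)

theorem tGr_mul (n m : ℕ) (z w : Tens A B) (hz : z ∈ tGr A B n) (hw : w ∈ tGr A B m) :
    z * w ∈ tGr A B (n + m) := by
  induction hz using tGr_induction with
  | h0 => simp
  | hadd a b _ _ ha hb => rw [add_mul]; exact add_mem ha hb
  | htm i j a b h ha hb =>
  induction hw using tGr_induction with
  | h0 => simp
  | hadd a b _ _ ha hb => rw [mul_add]; exact add_mem ha hb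
  | htm i' j' a' b' h' ha' hb' =>
  rw [tm_mul_hom a hb ha' b']
  refine Submodule.smul_mem _ _ ?_
  have := tm_mem_tGr (mul_mem_Gr ha ha') (mul_mem_Gr hb hb')
  rwa [show i + i' + (j + j') = n + m by omega] at this

theorem tGr_comm (n m : ℕ) (z w : Tens A B) (hz : z ∈ tGr A B n) (hw : w ∈ tGr A B m) :
    z * w = ((-1 : ℚ) ^ (n * m)) • (w * z) := by
  induction hz using tGr_induction with
  | h0 => simp
  | hadd a b _ _ ha hb => rw [add_mul, mul_add, smul_add, ha, hb]
  | htm i j a b h ha hb =>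
  induction hw using tGr_induction with
  | h0 => simp
  | hadd a b _ _ ha hb => rw [add_mul, mul_add, smul_add, ha, hb]
  | htm i' j' a' b' h' ha' hb' =>
  rw [tm_mul_hom a hb ha' b', tm_mul_hom a' hb' ha b, Gr_comm ha ha', Gr_comm hb hb']
  simp only [smul_tm, tm_smul, smul_smul, ← pow_add]
  congr 1
  subst h h'
  have h2 : ∀ k l : ℕ, Even (k + l) → (-1 : ℚ) ^ k = (-1) ^ l := by
    intro k l h
    rcases Nat.even_or_odd l with hl | hl
    · rw [hl.neg_one_pow, Even.neg_one_pow]; exact (Nat.even_add.1 h).2 hl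
    · rw [hl.neg_one_pow, Odd.neg_one_pow]
      rw [← Nat.not_even_iff_odd] at hl ⊢
      exact fun h' => hl ((Nat.even_add.1 h).1 h')
  apply h2
  exact ⟨j * i' + i * i' + j * j' + j' * i, by ring⟩

theorem tD_sq (z : Tens A B) : tD A B (tD A B z) = 0 := by
  induction z using tens_induction with
  | h0 => simp
  | hadd a b ha hb => simp only [map_add, ha, hb, add_zero]
  | htm i j a b ha hb =>
    simp only [tD_tm, map_add, Dd_Dd, zero_tm, tm_zero, eps_Dd, neg_tm]; abel

theorem tD_mem (n : ℕ) (z : Tens A B) (hz : z ∈ tGr A B n) : tD A B z ∈ tGr A B (n + 1) := by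
  induction hz using tGr_induction with
  | h0 => simp
  | hadd a b _ _ ha hb => rw [map_add]; exact add_mem ha hb
  | htm i j a b h ha hb =>
    subst h
    rw [tD_tm]
    refine add_mem ?_ ?_
    · have := tm_mem_tGr (Dd_mem ha) hb
      rwa [show i + 1 + j = i + j + 1 by omega] at this
    · have := tm_mem_tGr (sc_mem (-1) ha) (Dd_mem hb)
      rwa [← add_assoc] at this

theorem tD_leibniz (n : ℕ) (z w : Tens A B) (hz : z ∈ tGr A B n) :
    tD A B (z * w) = tD A B z * w + ((-1 : ℚ) ^ n) • (z * tD A B w) := by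
  induction hz using tGr_induction with
  | h0 => simp
  | hadd a b _ _ ha hb => simp only [add_mul, map_add, smul_add, ha, hb]; abel
  | htm i j a b h ha hb =>
  induction w using tens_induction with
  | h0 => simp
  | hadd a b ha hb => simp only [mul_add, map_add, smul_add, ha, hb]; abel
  | htm i' j' a' b' ha' hb' =>
  subst h
  simp only [tD_tm, tm_mul_hom a hb ha', map_smul, mul_add, add_mul, leibniz, map_mul,
    sc_apply _ ha, sc_apply _ hb, sc_apply _ ha', tm_mul_hom _ hb (Dd_mem ha'),
    tm_mul_hom _ (Dd_mem hb) ha', smul_tm, tm_smul, smul_mul_assoc, mul_smul_comm, smul_smul,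
    add_tm, tm_add, smul_add, tm_mul_hom _ hb ha', pow_add, add_mul, mul_add, one_mul, mul_one]
  match_scalars <;> ring_nf <;> simp [mul_comm j 2, pow_mul]

theorem one_mem_tGr : (1 : Tens A B) ∈ tGr A B 0 := by
  exact Submodule.subset_span ⟨0, 0, 1, 1, rfl, one_mem_Gr, one_mem_Gr, one_tens⟩

instance : GCDGA (Tens A B) :=
  GCDGA.ofPr (Tens A B) (tGr A B) tGr_internal one_mem_tGr tGr_mul tGr_comm (tD A B) tD_sq tD_mem
    tD_leibniz

end Tens

section TensAPI

variable {A B C : Type} [GCDGA A] [GCDGA B] [GCDGA C]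

theorem tm_mem {i j : ℕ} {a : A} {b : B} (ha : a ∈ Gr A i) (hb : b ∈ Gr B j) :
    tm a b ∈ Gr (Tens A B) (i + j) := tm_mem_tGr ha hb

theorem Dd_tm (a : A) (b : B) :
    Dd (Tens A B) (tm a b) = tm (Dd A a) b + tm (eps A a) (Dd B b) := tD_tm a b

theorem sc_tm (σ : ℚ) (a : A) (b : B) : sc (Tens A B) σ (tm a b) = tm (sc A σ a) (sc B σ b) := by
  induction a using hom_induction with
  | hadd a a' ha ha' => simp only [add_tm, map_add, ha, ha']
  | hhom i a ha =>
  induction b using hom_induction with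
  | hadd a a' ha ha' => simp only [tm_add, map_add, ha, ha']
  | hhom j b hb =>
  rw [sc_apply _ ha, sc_apply _ hb, sc_apply _ (tm_mem ha hb), smul_tm, tm_smul, smul_smul, pow_add]

variable (A B) in
/-- The left inclusion. -/
def tInl : A →ₐ[ℚ] Tens A B :=
  AlgHom.ofLinearMap (tmL.flip 1) rfl fun a a' => (tm_mul_one_left a a' (1 : B)).symm

variable (A B) in
/-- The right inclusion. -/
def tInr : B →ₐ[ℚ] Tens A B :=
  AlgHom.ofLinearMap (tmL 1) rfl fun b b' => (tm_mul_one_right (1 : A) b b').symm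

theorem tInl_apply (a : A) : tInl A B a = tm a 1 := rfl
theorem tInr_apply (b : B) : tInr A B b = tm 1 b := rfl

theorem tInl_mul_tInr (a : A) (b : B) : tInl A B a * tInr A B b = tm a b := by
  rw [tInl_apply, tInr_apply, tm_mul_one_right, one_mul]

theorem tInl_dga : IsDGAHom (tInl A B) :=
  ⟨fun a => by rw [tInl_apply, tInl_apply, Dd_tm]; simp,
    fun i a ha => by rw [tInl_apply]; simpa using tm_mem ha (one_mem_Gr (A := B))⟩

theorem tInr_dga : IsDGAHom (tInr A B) :=
  ⟨fun a => by rw [tInr_apply, tInr_apply, Dd_tm]; simp,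
    fun i a ha => by rw [tInr_apply]; simpa using tm_mem (one_mem_Gr (A := A)) ha⟩

/-- Degree preservation of an algebra morphism. -/
def IsGrHom (f : A →ₐ[ℚ] B) : Prop := ∀ (i : ℕ) (a : A), a ∈ Gr A i → f a ∈ Gr B i

theorem IsDGAHom.gr {f : A →ₐ[ℚ] B} (hf : IsDGAHom f) : IsGrHom f := fun i a ha => hf.2 i a ha

/-- The universal property of the graded tensor product. -/
def tHom (f : A →ₐ[ℚ] C) (g : B →ₐ[ℚ] C) (hf : IsGrHom f) (hg : IsGrHom g) :
    Tens A B →ₐ[ℚ] C :=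
  AlgHom.ofLinearMap (tLift ((LinearMap.mul ℚ C).compl₁₂ f.toLinearMap g.toLinearMap))
    (by rw [one_tens, tLift_tm]; simp)
    (by
      intro z w
      induction z using tens_induction with
      | h0 => simp only [zero_mul, map_zero]
      | hadd z z' hz hz' => simp only [add_mul, map_add, hz, hz']
      | htm i j a b ha hb =>
      induction w using tens_induction with
      | h0 => simp only [mul_zero, map_zero]
      | hadd z z' hz hz' => simp only [mul_add, map_add, hz, hz']
      | htm i' j' a' b' ha' hb' =>
      rw [tm_mul_hom a hb ha' b', map_smul, tLift_tm, tLift_tm, tLift_tm]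
      simp only [LinearMap.compl₁₂_apply, LinearMap.mul_apply', AlgHom.toLinearMap_apply, map_mul]
      rw [mul_assoc (f a) (g b), ← mul_assoc (g b), Gr_comm (hg _ _ hb) (hf _ _ ha')]
      simp only [mul_smul_comm, smul_mul_assoc, mul_assoc])

theorem tHom_tm (f : A →ₐ[ℚ] C) (g : B →ₐ[ℚ] C) (hf : IsGrHom f) (hg : IsGrHom g) (a : A) (b : B) :
    tHom f g hf hg (tm a b) = f a * g b := tLift_tm _ _ _

theorem tHom_inl (f : A →ₐ[ℚ] C) (g : B →ₐ[ℚ] C) (hf : IsGrHom f) (hg : IsGrHom g) (a : A) :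
    tHom f g hf hg (tInl A B a) = f a := by rw [tInl_apply, tHom_tm]; simp

theorem tHom_inr (f : A →ₐ[ℚ] C) (g : B →ₐ[ℚ] C) (hf : IsGrHom f) (hg : IsGrHom g) (b : B) :
    tHom f g hf hg (tInr A B b) = g b := by rw [tInr_apply, tHom_tm]; simp

theorem tHom_gr (f : A →ₐ[ℚ] C) (g : B →ₐ[ℚ] C) (hf : IsGrHom f) (hg : IsGrHom g) :
    IsGrHom (tHom f g hf hg) := by
  intro n z hz
  induction hz using tGr_induction with
  | h0 => rw [map_zero]; exact zero_mem _
  | hadd z z' _ _ hz hz' => rw [map_add]; exact add_mem hz hz'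
  | htm i j a b h ha hb =>
    subst h; rw [tHom_tm]; exact mul_mem_Gr (hf _ _ ha) (hg _ _ hb)

theorem tHom_dga (f : A →ₐ[ℚ] C) (g : B →ₐ[ℚ] C) (hf : IsDGAHom f) (hg : IsDGAHom g) :
    IsDGAHom (tHom f g hf.gr hg.gr) := by
  refine ⟨fun z => ?_, tHom_gr f g hf.gr hg.gr⟩
  induction z using tens_induction with
  | h0 => simp only [map_zero]
  | hadd z z' hz hz' => simp only [map_add, hz, hz']
  | htm i j a b ha hb =>
    rw [Dd_tm, map_add, tHom_tm, tHom_tm, tHom_tm, leibniz, hf.1, hg.1, map_sc hf.2]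

theorem tens_algHom_ext {R : Type*} [Ring R] [Algebra ℚ R] {f g : Tens A B →ₐ[ℚ] R}
    (h1 : ∀ a, f (tInl A B a) = g (tInl A B a)) (h2 : ∀ b, f (tInr A B b) = g (tInr A B b)) :
    f = g := by
  have : f.toLinearMap = g.toLinearMap := tens_ext fun i j a b _ _ => by
    rw [← tInl_mul_tInr]; simp [h1, h2]
  exact AlgHom.toLinearMap_injective this

/-- The algebra is connected. -/
def Conn (A : Type) [GCDGA A] : Prop := ∀ a ∈ Gr A 0, ∃ c : ℚ, a = c • 1

theorem Conn.tens (hA : Conn A) (hB : Conn B) : Conn (Tens A B) := by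
  intro z hz
  have key : ∀ n, ∀ z ∈ tGr A B n, n = 0 → ∃ c : ℚ, z = c • 1 := by
    intro n z hz h0
    induction hz using tGr_induction with
    | h0 => exact ⟨0, by simp⟩
    | hadd z z' _ _ hz hz' =>
      obtain ⟨c, rfl⟩ := hz
      obtain ⟨c', rfl⟩ := hz'
      exact ⟨c + c', (add_smul _ _ _).symm⟩
    | htm i j a b h ha hb =>
      obtain ⟨rfl, rfl⟩ : i = 0 ∧ j = 0 := by omega
      obtain ⟨c, rfl⟩ := hA a ha
      obtain ⟨c', rfl⟩ := hB b hb
      exact ⟨c * c', by rw [smul_tm, tm_smul, smul_smul, one_tens]⟩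
  exact key 0 z hz rfl

theorem adjoin_tens {s : Set A} {t : Set B} (hs : Algebra.adjoin ℚ s = ⊤)
    (ht : Algebra.adjoin ℚ t = ⊤) :
    Algebra.adjoin ℚ (tInl A B '' s ∪ tInr A B '' t) = ⊤ := by
  rw [eq_top_iff]
  intro z _
  induction z using tens_induction with
  | h0 => exact zero_mem _
  | hadd z z' hz hz' => exact add_mem (hz trivial) (hz' trivial)
  | htm i j a b ha hb =>
    rw [← tInl_mul_tInr]
    refine mul_mem ?_ ?_
    · have : tInl A B a ∈ (Algebra.adjoin ℚ s).map (tInl A B) := ⟨a, by rw [hs]; trivial, rfl⟩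
      rw [AlgHom.map_adjoin] at this
      exact Algebra.adjoin_mono Set.subset_union_left this
    · have : tInr A B b ∈ (Algebra.adjoin ℚ t).map (tInr A B) := ⟨b, by rw [ht]; trivial, rfl⟩
      rw [AlgHom.map_adjoin] at this
      exact Algebra.adjoin_mono Set.subset_union_right this

end TensAPI

section Dalg

open Polynomial

/-- The algebra `ℚ[e] ⊗ Λ(o)`. -/
abbrev EO : Type := TrivSqZeroExt ℚ[X] ℚ[X]

namespace EO

/-- The element `e ^ k`. -/
def ev (k : ℕ) : EO := TrivSqZeroExt.inl (X ^ k)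
/-- The element `e ^ k * o`. -/
def od (k : ℕ) : EO := TrivSqZeroExt.inr (X ^ k)

theorem ev_mul_ev (k l : ℕ) : ev k * ev l = ev (k + l) := by
  simp [ev, pow_add, TrivSqZeroExt.inl_mul]
theorem ev_mul_od (k l : ℕ) : ev k * od l = od (k + l) := by
  rw [ev, od, TrivSqZeroExt.inl_mul_inr, smul_eq_mul, ← pow_add]; rfl
theorem od_mul_ev (k l : ℕ) : od k * ev l = od (k + l) := by
  rw [mul_comm, ev_mul_od, add_comm]
theorem od_mul_od (k l : ℕ) : od k * od l = 0 := by
  simp [od]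
theorem ev_zero : ev 0 = 1 := by simp [ev]

theorem induction {P : EO → Prop} (hadd : ∀ a b, P a → P b → P (a + b))
    (hsmul : ∀ (c : ℚ) a, P a → P (c • a)) (hev : ∀ k, P (ev k)) (hod : ∀ k, P (od k))
    (z : EO) : P z := by
  have h1 : ∀ f : ℚ[X], P (TrivSqZeroExt.inl f) := by
    intro f
    induction f using Polynomial.induction_on' with
    | add p q hp hq => rw [TrivSqZeroExt.inl_add]; exact hadd _ _ hp hq
    | monomial n a =>
      rw [← smul_X_eq_monomial, TrivSqZeroExt.inl_smul]; exact hsmul _ _ (hev n)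
  have h2 : ∀ f : ℚ[X], P (TrivSqZeroExt.inr f) := by
    intro f
    induction f using Polynomial.induction_on' with
    | add p q hp hq => rw [TrivSqZeroExt.inr_add]; exact hadd _ _ hp hq
    | monomial n a =>
      rw [← smul_X_eq_monomial, TrivSqZeroExt.inr_smul]; exact hsmul _ _ (hod n)
  rw [← TrivSqZeroExt.inl_fst_add_inr_snd_eq z]
  exact hadd _ _ (h1 _) (h2 _)

variable {M : Type*} [AddCommGroup M] [Module ℚ M]

/-- The linear map with prescribed values on the monomials. -/
def lin (f g : ℕ → M) : EO →ₗ[ℚ] M :=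
  (Polynomial.basisMonomials ℚ).constr ℚ f ∘ₗ (TrivSqZeroExt.fstHom ℚ ℚ[X] ℚ[X]).toLinearMap +
    (Polynomial.basisMonomials ℚ).constr ℚ g ∘ₗ TrivSqZeroExt.sndHom ℚ[X] ℚ[X]

theorem constr_X (f : ℕ → M) (k : ℕ) :
    (Polynomial.basisMonomials ℚ).constr ℚ f (X ^ k) = f k := by
  have : (X : ℚ[X]) ^ k = Polynomial.basisMonomials ℚ k := by simp [X_pow_eq_monomial]
  rw [this, Module.Basis.constr_basis]

@[simp] theorem lin_ev (f g : ℕ → M) (k : ℕ) : lin f g (ev k) = f k := by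
  simp [lin, ev, constr_X]

@[simp] theorem lin_od (f g : ℕ → M) (k : ℕ) : lin f g (od k) = g k := by
  simp [lin, od, constr_X]

theorem lin_ext {f g : EO →ₗ[ℚ] M} (h1 : ∀ k, f (ev k) = g (ev k)) (h2 : ∀ k, f (od k) = g (od k)) :
    f = g :=
  LinearMap.ext fun z => induction (P := fun z => f z = g z) (fun a b ha hb => by simp [ha, hb])
    (fun c a ha => by simp [ha]) h1 h2 z

/-- The augmentation. -/
def aug : EO →ₐ[ℚ] ℚ := (Polynomial.aeval (0 : ℚ)).comp (TrivSqZeroExt.fstHom ℚ ℚ[X] ℚ[X])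

theorem aug_ev (k : ℕ) : aug (ev k) = if k = 0 then 1 else 0 := by
  simp [aug, ev, zero_pow_eq]
theorem aug_od (k : ℕ) : aug (od k) = 0 := by
  simp [aug, od]

/-- The grading with `|e| = a`, `|o| = b`. -/
def gr (a b : ℕ) (n : ℕ) : Submodule ℚ EO :=
  Submodule.span ℚ ({z | ∃ k, k * a = n ∧ z = ev k} ∪ {z | ∃ k, k * a + b = n ∧ z = od k})

theorem ev_mem (a b k : ℕ) : ev k ∈ gr a b (k * a) :=
  Submodule.subset_span (Or.inl ⟨k, rfl, rfl⟩)
theorem od_mem (a b k : ℕ) : od k ∈ gr a b (k * a + b) :=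
  Submodule.subset_span (Or.inr ⟨k, rfl, rfl⟩)

theorem gr_induction {a b n : ℕ} {P : (z : EO) → z ∈ gr a b n → Prop}
    (h0 : P 0 (zero_mem _))
    (hadd : ∀ x y hx hy, P x hx → P y hy → P (x + y) (add_mem hx hy))
    (hsmul : ∀ (c : ℚ) x hx, P x hx → P (c • x) (Submodule.smul_mem _ c hx))
    (hev : ∀ k (h : k * a = n), P (ev k) (h ▸ ev_mem a b k))
    (hod : ∀ k (h : k * a + b = n), P (od k) (h ▸ od_mem a b k))
    {z : EO} (hz : z ∈ gr a b n) : P z hz := by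
  induction hz using Submodule.span_induction with
  | mem x hx =>
    rcases hx with ⟨k, h, rfl⟩ | ⟨k, h, rfl⟩
    · exact hev k h
    · exact hod k h
  | zero => exact h0
  | add x y hx hy h1 h2 => exact hadd _ _ _ _ h1 h2
  | smul c x hx h => exact hsmul _ _ _ h

theorem gr_internal (a b : ℕ) : DirectSum.IsInternal (gr a b) := by
  have key : ∀ n m : ℕ, ∀ z ∈ gr a b n,
      lin (fun k => if k * a = m then ev k else 0) (fun k => if k * a + b = m then od k else 0) z
        = if n = m then z else 0 := by
    intro n m z hz
    induction hz using gr_induction with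
    | h0 => simp
    | hadd x y _ _ hx hy => rw [map_add, hx, hy]; split_ifs <;> simp
    | hsmul c x _ hx => rw [map_smul, hx]; split_ifs <;> simp
    | hev k h => subst h; simp
    | hod k h => subst h; simp
  refine isInternal_of_pr _ (fun m => lin (fun k => if k * a = m then ev k else 0)
    (fun k => if k * a + b = m then od k else 0))
    (fun i z hz => by simpa using key i i z hz) (fun i j h z hz => by simpa [h] using key i j z hz) ?_
  intro z
  induction z using EO.induction with
  | hadd a b ha hb => exact add_mem ha hb
  | hsmul c a ha => exact Submodule.smul_mem _ _ ha
  | hev k => exact Submodule.mem_iSup_of_mem _ (ev_mem a b k)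
  | hod k => exact Submodule.mem_iSup_of_mem _ (od_mem a b k)

/-- The gcdga structure on `ℚ[e] ⊗ Λ(o)` determined by a differential on the basis. -/
@[reducible] def gcdga {a b : ℕ} (ha : Even a) (hb : Odd b) (d : EO →ₗ[ℚ] EO)
    (hd2 : ∀ z, d (d z) = 0) (hdg : ∀ (i : ℕ) z, z ∈ gr a b i → d z ∈ gr a b (i + 1))
    (hee : ∀ k l, d (ev k * ev l) = d (ev k) * ev l + ev k * d (ev l))
    (heo : ∀ k l, d (ev k * od l) = d (ev k) * od l + ev k * d (od l))
    (hoe : ∀ k l, d (od k * ev l) = d (od k) * ev l - od k * d (ev l))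
    (hoo : ∀ k l, d (od k * od l) = d (od k) * od l - od k * d (od l)) : GCDGA EO :=
  have hE : ∀ k, Even (k * a) := fun k => ha.mul_left k
  have hO : ∀ k, Odd (k * a + b) := fun k => (hE k).add_odd hb
  GCDGA.ofPr EO (gr a b) (gr_internal a b)
    (by rw [← ev_zero]; simpa using ev_mem a b 0)
    (by
      intro n m z w hz hw
      induction hz using gr_induction with
      | h0 => simp
      | hadd x y _ _ hx hy => rw [add_mul]; exact add_mem hx hy
      | hsmul c x _ hx => rw [smul_mul_assoc]; exact Submodule.smul_mem _ _ hx
      | hev k h =>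
        induction hw using gr_induction with
        | h0 => simp
        | hadd x y _ _ hx hy => rw [mul_add]; exact add_mem hx hy
        | hsmul c x _ hx => rw [mul_smul_comm]; exact Submodule.smul_mem _ _ hx
        | hev l h' => subst h h'; rw [ev_mul_ev, ← add_mul]; exact ev_mem a b _
        | hod l h' => subst h h'; rw [ev_mul_od, ← add_assoc, ← add_mul]; exact od_mem a b _
      | hod k h =>
        induction hw using gr_induction with
        | h0 => simp
        | hadd x y _ _ hx hy => rw [mul_add]; exact add_mem hx hy
        | hsmul c x _ hx => rw [mul_smul_comm]; exact Submodule.smul_mem _ _ hx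
        | hev l h' =>
          subst h h'; rw [od_mul_ev, add_right_comm, ← add_mul]; exact od_mem a b _
        | hod l h' => rw [od_mul_od]; exact zero_mem _)
    (by
      intro n m z w hz hw
      induction hz using gr_induction with
      | h0 => simp
      | hadd x y _ _ hx hy => rw [add_mul, hx, hy, mul_add, smul_add]
      | hsmul c x _ hx => rw [smul_mul_assoc, hx, mul_smul_comm, smul_comm]
      | hev k h => subst h; rw [mul_comm, ((hE k).mul_right m).neg_one_pow, one_smul]
      | hod k h =>
        induction hw using gr_induction with
        | h0 => simp
        | hadd x y _ _ hx hy => rw [mul_add, hx, hy, add_mul, smul_add]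
        | hsmul c x _ hx => rw [smul_mul_assoc, mul_smul_comm, hx, smul_comm]
        | hev l h' => subst h'; rw [mul_comm, ((hE l).mul_left n).neg_one_pow, one_smul]
        | hod l h' => rw [od_mul_od, od_mul_od, smul_zero])
    d hd2 hdg
    (by
      intro n z w hz
      induction hz using gr_induction with
      | h0 => simp
      | hadd x y _ _ hx hy => simp only [add_mul, map_add, hx, hy, smul_add]; abel
      | hsmul c x _ hx =>
        simp only [smul_mul_assoc, map_smul, hx, smul_add]
        rw [smul_comm c]
      | hev k h =>
        subst h
        rw [(hE k).neg_one_pow, one_smul]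
        induction w using EO.induction with
        | hadd x y hx hy => simp only [mul_add, map_add, hx, hy]; abel
        | hsmul c x hx => simp only [mul_smul_comm, map_smul, hx, smul_add]
        | hev l => exact hee k l
        | hod l => exact heo k l
      | hod k h =>
        subst h
        rw [(hO k).neg_one_pow, neg_one_smul, ← sub_eq_add_neg]
        induction w using EO.induction with
        | hadd x y hx hy => simp only [mul_add, map_add, hx, hy]; abel
        | hsmul c x hx => simp only [mul_smul_comm, map_smul, hx, smul_sub]
        | hev l => exact hoe k l
        | hod l => exact hoo k l)

end EO

/-- The differential of `D1`. -/
def d1 : EO →ₗ[ℚ] EO := EO.lin (fun _ => 0) (fun k => EO.ev (k + 1))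
/-- The differential of `D2`. -/
def d2 : EO →ₗ[ℚ] EO := EO.lin (fun k => (k : ℚ) • EO.od (k - 1)) (fun _ => 0)

theorem d1_sq : ∀ z, d1 (d1 z) = 0 := by
  intro z
  induction z using EO.induction with
  | hadd x y hx hy => simp only [map_add, hx, hy, add_zero]
  | hsmul c x hx => simp only [map_smul, hx, smul_zero]
  | hev l => simp [d1]
  | hod l => simp [d1]

theorem d1_mem (k : ℕ) : ∀ (n : ℕ) z, z ∈ EO.gr (2 * k + 2) (2 * k + 1) n →
    d1 z ∈ EO.gr (2 * k + 2) (2 * k + 1) (n + 1) := by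
  intro n z hz
  induction hz using EO.gr_induction with
  | h0 => simp
  | hadd x y _ _ hx hy => rw [map_add]; exact add_mem hx hy
  | hsmul c x _ hx => rw [map_smul]; exact Submodule.smul_mem _ _ hx
  | hev l h => simp [d1]
  | hod l h =>
    subst h
    have := EO.ev_mem (2 * k + 2) (2 * k + 1) (l + 1)
    rw [add_mul, one_mul] at this
    simpa [d1, add_assoc] using this

theorem d1_ee : ∀ k l, d1 (EO.ev k * EO.ev l) = d1 (EO.ev k) * EO.ev l + EO.ev k * d1 (EO.ev l) := by
  simp [d1, EO.ev_mul_ev]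

theorem d1_eo : ∀ k l, d1 (EO.ev k * EO.od l) = d1 (EO.ev k) * EO.od l + EO.ev k * d1 (EO.od l) := by
  intro k l; simp [d1, EO.ev_mul_od, EO.ev_mul_ev, add_assoc]

theorem d1_oe : ∀ k l, d1 (EO.od k * EO.ev l) = d1 (EO.od k) * EO.ev l - EO.od k * d1 (EO.ev l) := by
  intro k l; simp [d1, EO.od_mul_ev, EO.ev_mul_ev, add_right_comm]

theorem d1_oo : ∀ k l, d1 (EO.od k * EO.od l) = d1 (EO.od k) * EO.od l - EO.od k * d1 (EO.od l) := by
  intro k l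
  simp only [EO.od_mul_od, d1, map_zero, EO.lin_od, EO.ev_mul_od, EO.od_mul_ev]
  rw [← add_assoc, add_right_comm, sub_self]

theorem d2_sq : ∀ z, d2 (d2 z) = 0 := by
  intro z
  induction z using EO.induction with
  | hadd x y hx hy => simp only [map_add, hx, hy, add_zero]
  | hsmul c x hx => simp only [map_smul, hx, smul_zero]
  | hev l => simp [d2]
  | hod l => simp [d2]

theorem d2_mem (k : ℕ) : ∀ (n : ℕ) z, z ∈ EO.gr (2 * k + 2) (2 * k + 3) n →
    d2 z ∈ EO.gr (2 * k + 2) (2 * k + 3) (n + 1) := by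
  intro n z hz
  induction hz using EO.gr_induction with
  | h0 => simp
  | hadd x y _ _ hx hy => rw [map_add]; exact add_mem hx hy
  | hsmul c x _ hx => rw [map_smul]; exact Submodule.smul_mem _ _ hx
  | hev l h =>
    subst h
    rcases l with _ | l
    · simp [d2]
    · have := EO.od_mem (2 * k + 2) (2 * k + 3) l
      rw [show l * (2 * k + 2) + (2 * k + 3) = (l + 1) * (2 * k + 2) + 1 by ring] at this
      rw [d2, EO.lin_ev]; exact Submodule.smul_mem _ _ this
  | hod l h => simp [d2]

theorem d2_ee : ∀ k l, d2 (EO.ev k * EO.ev l) = d2 (EO.ev k) * EO.ev l + EO.ev k * d2 (EO.ev l) := by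
  intro k l
  rcases k with _ | k
  · simp [d2, EO.ev_mul_od, EO.ev_mul_ev]
  rcases l with _ | l
  · simp [d2, EO.od_mul_ev, EO.ev_mul_ev]
  simp only [d2, EO.ev_mul_ev, EO.lin_ev, smul_mul_assoc, mul_smul_comm, EO.od_mul_ev,
    EO.ev_mul_od, Nat.add_sub_cancel]
  rw [show k + 1 + (l + 1) - 1 = k + 1 + l by omega, show k + (l + 1) = k + 1 + l by omega,
    ← add_smul]
  push_cast; rfl

theorem d2_eo : ∀ k l, d2 (EO.ev k * EO.od l) = d2 (EO.ev k) * EO.od l + EO.ev k * d2 (EO.od l) := by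
  intro k l; simp [d2, EO.ev_mul_od, EO.od_mul_od]

theorem d2_oe : ∀ k l, d2 (EO.od k * EO.ev l) = d2 (EO.od k) * EO.ev l - EO.od k * d2 (EO.ev l) := by
  intro k l; simp [d2, EO.od_mul_ev, EO.od_mul_od]

theorem d2_oo : ∀ k l, d2 (EO.od k * EO.od l) = d2 (EO.od k) * EO.od l - EO.od k * d2 (EO.od l) := by
  intro k l; simp [d2, EO.od_mul_od]

/-- The contractible algebra on `e, o` with `d o = e` (`t = true`, `|o| = 2 k + 1`) or
`d e = o` (`t = false`, `|o| = 2 k + 3`), where `|e| = 2 k + 2`. -/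
def DA (_ : Bool) (_ : ℕ) : Type := EO

/-- The degree of `o`. -/
def dO (t : Bool) (k : ℕ) : ℕ := if t then 2 * k + 1 else 2 * k + 3

/-- The gcdga structure on `DA`. -/
def DA.gcdga (t : Bool) (k : ℕ) : GCDGA (DA t k) :=
  EO.gcdga (a := 2 * k + 2) (b := dO t k) ⟨k + 1, by ring⟩
    (by cases t; exacts [⟨k + 1, by simp [dO]; ring⟩, ⟨k, by simp [dO]⟩]) (if t then d1 else d2)
    (by cases t; exacts [d2_sq, d1_sq]) (by cases t; exacts [d2_mem k, d1_mem k])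
    (by cases t; exacts [d2_ee, d1_ee]) (by cases t; exacts [d2_eo, d1_eo])
    (by cases t; exacts [d2_oe, d1_oe]) (by cases t; exacts [d2_oo, d1_oo])

instance (t : Bool) (k : ℕ) : GCDGA (DA t k) := DA.gcdga t k

namespace DA

variable {t : Bool} {k : ℕ}

/-- The element `e ^ n`. -/
def ev (n : ℕ) : DA t k := EO.ev n
/-- The element `e ^ n * o`. -/
def od (n : ℕ) : DA t k := EO.od n

theorem ev_mul_ev (n m : ℕ) : (ev n * ev m : DA t k) = ev (n + m) := EO.ev_mul_ev n m
theorem ev_mul_od (n m : ℕ) : (ev n * od m : DA t k) = od (n + m) := EO.ev_mul_od n m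
theorem od_mul_ev (n m : ℕ) : (od n * ev m : DA t k) = od (n + m) := EO.od_mul_ev n m
theorem od_mul_od (n m : ℕ) : (od n * od m : DA t k) = 0 := EO.od_mul_od n m
theorem ev_zero : (ev 0 : DA t k) = 1 := EO.ev_zero

theorem ev_mem (n : ℕ) : (ev n : DA t k) ∈ Gr (DA t k) (n * (2 * k + 2)) :=
  EO.ev_mem _ _ n
theorem od_mem (n : ℕ) : (od n : DA t k) ∈ Gr (DA t k) (n * (2 * k + 2) + dO t k) :=
  EO.od_mem _ _ n

variable {M : Type*} [AddCommGroup M] [Module ℚ M]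

/-- The linear map with prescribed values on the monomials. -/
def lin (f g : ℕ → M) : DA t k →ₗ[ℚ] M := EO.lin f g

@[simp] theorem lin_ev (f g : ℕ → M) (n : ℕ) : lin f g (ev n : DA t k) = f n := EO.lin_ev f g n
@[simp] theorem lin_od (f g : ℕ → M) (n : ℕ) : lin f g (od n : DA t k) = g n := EO.lin_od f g n

theorem lin_ext {f g : DA t k →ₗ[ℚ] M} (h1 : ∀ n, f (ev n) = g (ev n))
    (h2 : ∀ n, f (od n) = g (od n)) : f = g := EO.lin_ext (f := f) (g := g) h1 h2

theorem Dd1_ev (n : ℕ) : Dd (DA true k) (ev n) = 0 := EO.lin_ev (M := EO) _ _ n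
theorem Dd1_od (n : ℕ) : Dd (DA true k) (od n) = ev (n + 1) := EO.lin_od (M := EO) _ _ n
theorem Dd2_ev (n : ℕ) : Dd (DA false k) (ev n) = (n : ℚ) • od (n - 1) := EO.lin_ev (M := EO) _ _ n
theorem Dd2_od (n : ℕ) : Dd (DA false k) (od n) = 0 := EO.lin_od (M := EO) _ _ n

theorem sc_ev (σ : ℚ) (hσ : σ * σ = 1) (n : ℕ) : sc (DA t k) σ (ev n) = ev n := by
  rw [sc_apply σ (ev_mem n), show n * (2 * k + 2) = 2 * (n * (k + 1)) by ring, pow_mul, pow_two, hσ,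
    one_pow, one_smul]

theorem sc_od (σ : ℚ) (hσ : σ * σ = 1) (n : ℕ) : sc (DA t k) σ (od n) = σ • od n := by
  have : ∃ l, n * (2 * k + 2) + dO t k = 2 * l + 1 := by
    cases t
    · exact ⟨n * (k + 1) + k + 1, by simp [dO]; ring⟩
    · exact ⟨n * (k + 1) + k, by simp [dO]; ring⟩
  obtain ⟨l, hl⟩ := this
  rw [sc_apply σ (od_mem n), hl, pow_succ, pow_mul, pow_two, hσ, one_pow, one_mul]

/-- The augmentation. -/
def aug : DA t k →ₐ[ℚ] ℚ := EO.aug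

theorem aug_ev (n : ℕ) : aug (ev n : DA t k) = if n = 0 then 1 else 0 := EO.aug_ev n
theorem aug_od (n : ℕ) : aug (od n : DA t k) = 0 := EO.aug_od n

theorem aug_gr {n : ℕ} (hn : n ≠ 0) {z : DA t k} (hz : z ∈ Gr (DA t k) n) : aug z = 0 := by
  have h : ∀ z ∈ EO.gr (2 * k + 2) (dO t k) n, EO.aug z = 0 := by
    intro z hz
    induction hz using EO.gr_induction with
    | h0 => simp
    | hadd x y _ _ hx hy => rw [map_add, hx, hy, add_zero]
    | hsmul c x _ hx => rw [map_smul, hx, smul_zero]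
    | hev l h => rw [EO.aug_ev, if_neg]; rintro rfl; simp at h; omega
    | hod l h => exact EO.aug_od l
  exact h z hz

/-- The contracting homotopy. -/
def contr : DA t k →ₗ[ℚ] DA t k :=
  if t then lin (fun n => if n = 0 then 0 else od (n - 1)) (fun _ => 0)
  else lin (fun _ => 0) (fun n => ((n : ℚ) + 1)⁻¹ • ev (n + 1))

theorem contr_spec (z : DA t k) :
    Dd (DA t k) (contr z) + contr (Dd (DA t k) z) = z - aug z • 1 := by
  have : Dd (DA t k) ∘ₗ contr + contr ∘ₗ Dd (DA t k) =
      LinearMap.id - (LinearMap.toSpanSingleton ℚ _ 1) ∘ₗ aug.toLinearMap := by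
    cases t
    · refine lin_ext (fun n => ?_) fun n => ?_
      · rcases n with _ | n
        · simp [contr, Dd2_ev, aug_ev, ← ev_zero]
        · have : (n : ℚ) + 1 ≠ 0 := by positivity
          simp [contr, Dd2_ev, aug_ev, smul_smul, this]
      · have : (n : ℚ) + 1 ≠ 0 := by positivity
        simp [contr, Dd2_od, Dd2_ev, aug_od, smul_smul, this]
    · refine lin_ext (fun n => ?_) fun n => ?_
      · rcases n with _ | n
        · simp [contr, Dd1_ev, aug_ev, ← ev_zero]
        · simp [contr, Dd1_ev, Dd1_od, aug_ev]
      · simp [contr, Dd1_od, aug_od]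
  exact LinearMap.congr_fun this z

end DA

end Dalg

section TensDA

variable {C : Type} [GCDGA C] {t : Bool} {k : ℕ}

/-- The augmentation with values in a gcdga. -/
def augTo (C : Type) [GCDGA C] (t : Bool) (k : ℕ) : DA t k →ₐ[ℚ] C := (Algebra.ofId ℚ C).comp DA.aug

theorem augTo_apply (z : DA t k) : augTo C t k z = DA.aug z • (1 : C) := by
  simp [augTo, Algebra.ofId_apply, Algebra.algebraMap_eq_smul_one]

theorem augTo_gr : IsGrHom (augTo C t k) := by
  intro n z hz
  rw [augTo_apply]
  by_cases hn : n = 0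
  · subst hn; exact Submodule.smul_mem _ _ one_mem_Gr
  · rw [DA.aug_gr hn hz, zero_smul]; exact zero_mem _

theorem augTo_dga : IsDGAHom (augTo C t k) := by
  refine ⟨fun z => ?_, augTo_gr⟩
  induction z using hom_induction with
  | hadd x y hx hy => simp only [map_add, hx, hy]
  | hhom n z hz =>
    rw [augTo_apply, DA.aug_gr n.succ_ne_zero (Dd_mem hz), augTo_apply, map_smul]; simp

variable (C t k) in
/-- The augmentation of the second factor. -/
def tAug : Tens C (DA t k) →ₐ[ℚ] C :=
  tHom (AlgHom.id ℚ C) (augTo C t k) (isDGAHom_id C).gr augTo_gr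

theorem tAug_tm (c : C) (z : DA t k) : tAug C t k (tm c z) = DA.aug z • c := by
  rw [tAug, tHom_tm, augTo_apply]; simp

theorem tAug_inl (c : C) : tAug C t k (tInl C _ c) = c := tHom_inl _ _ _ _ _

theorem tAug_dga : IsDGAHom (tAug C t k) := tHom_dga _ _ (isDGAHom_id C) augTo_dga

theorem tAug_surj : Function.Surjective (tAug C t k) := fun c => ⟨_, tAug_inl c⟩

theorem tAug_homotopy (z : Tens C (DA t k)) :
    Dd _ (tMap (eps C).toLinearMap DA.contr z) + tMap (eps C).toLinearMap DA.contr (Dd _ z) =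
      z - tInl C _ (tAug C t k z) := by
  have : Dd _ ∘ₗ tMap (eps C).toLinearMap DA.contr + tMap (eps C).toLinearMap DA.contr ∘ₗ Dd _ =
      LinearMap.id - (tInl C (DA t k)).toLinearMap ∘ₗ (tAug C t k).toLinearMap := by
    refine tens_ext fun i j c z _ _ => ?_
    have h := DA.contr_spec z
    simp only [LinearMap.add_apply, LinearMap.comp_apply, tMap_tm, AlgHom.toLinearMap_apply, Dd_tm,
      map_add, eps_eps, eps_Dd, neg_tm, LinearMap.sub_apply, LinearMap.id_apply, tAug_tm, map_smul,
      tInl_apply]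
    rw [← tm_smul, ← tm_sub, ← h, tm_add]
    abel
  exact LinearMap.congr_fun this z

theorem tAug_quasi : QuasiIso (tAug C t k) := by
  refine ⟨fun b hb => ⟨tInl C _ b, ?_, 0, ?_⟩, fun z hz ⟨c, hc⟩ => ?_⟩
  · rw [← tInl_dga.1, hb, map_zero]
  · rw [tAug_inl]; simp
  · have h := tAug_homotopy z
    rw [hz, map_zero, add_zero, hc, tInl_dga.1] at h
    exact ⟨tMap (eps C).toLinearMap DA.contr z + tInl C _ c, by rw [map_add, h]; abel⟩

end TensDA

section Quasi

variable {A B C : Type} [GCDGA A] [GCDGA B] [GCDGA C]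

theorem QuasiIso.comp {g : B →ₐ[ℚ] C} {f : A →ₐ[ℚ] B} (hg : QuasiIso g) (hf : QuasiIso f)
    (hgd : IsDGAHom g) (hfd : IsDGAHom f) : QuasiIso (g.comp f) := by
  refine ⟨fun c hc => ?_, fun a ha ⟨c, hc⟩ => ?_⟩
  · obtain ⟨b, hb, x, hx⟩ := hg.1 c hc
    obtain ⟨a, ha, y, hy⟩ := hf.1 b hb
    refine ⟨a, ha, g y + x, ?_⟩
    rw [map_add, ← hgd.1, ← hy, ← hx, map_sub]; simp
  · exact hf.2 a ha (hg.2 _ (by rw [← hfd.1, ha, map_zero]) ⟨c, hc⟩)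

/-- A subspace all of whose cocycles are boundaries of its own elements. -/
def Acyc (J : Submodule ℚ A) : Prop := ∀ a ∈ J, Dd A a = 0 → ∃ b ∈ J, a = Dd A b

theorem acyc_ker {f : A →ₐ[ℚ] B} (hfd : IsDGAHom f) (hs : Function.Surjective f)
    (hf : QuasiIso f) : Acyc (LinearMap.ker f.toLinearMap) := by
  intro a ha hda
  have ha' : f a = 0 := ha
  obtain ⟨e, rfl⟩ := hf.2 a hda ⟨0, by rw [ha', map_zero]⟩
  obtain ⟨x, hx, c, hc⟩ := hf.1 (f e) (by rw [← hfd.1, ha'])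
  obtain ⟨c', rfl⟩ := hs c
  refine ⟨e - x + Dd A c', ?_, by simp [hx]⟩
  change f (e - x + Dd A c') = 0
  rw [map_add, map_sub, hfd.1, ← hc]; abel

theorem quasi_of_acyc_ker {f : A →ₐ[ℚ] B} (hfd : IsDGAHom f) (hs : Function.Surjective f)
    (hf : Acyc (LinearMap.ker f.toLinearMap)) : QuasiIso f := by
  refine ⟨fun b hb => ?_, fun a ha ⟨c, hc⟩ => ?_⟩
  · obtain ⟨a, rfl⟩ := hs b
    obtain ⟨k, hk, hak⟩ := hf (Dd A a) (by change f _ = 0; rw [hfd.1, hb]) (Dd_Dd a)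
    have hk' : f k = 0 := hk
    exact ⟨a - k, by rw [map_sub, hak, sub_self], 0, by simp [hk']⟩
  · obtain ⟨c', rfl⟩ := hs c
    obtain ⟨k, -, hk⟩ := hf (a - Dd A c') (by change f _ = 0; rw [map_sub, hfd.1, hc, sub_self])
      (by simp [ha])
    exact ⟨k + c', by rw [map_add, ← hk]; abel⟩

end Quasi

section Quotient

variable {A : Type} [GCDGA A]

/-- Homogeneous differential ideals. -/
structure IsDId (I : Submodule ℚ A) : Prop where
  homog : Homog I
  left : ∀ (b : A), ∀ a ∈ I, b * a ∈ I
  dd : ∀ a ∈ I, Dd A a ∈ I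

theorem IsDId.right {I : Submodule ℚ A} (h : IsDId I) (b : A) {a : A} (ha : a ∈ I) :
    a * b ∈ I := by
  induction b using hom_induction with
  | hadd b b' hb hb' => rw [mul_add]; exact add_mem hb hb'
  | hhom j b hb => rw [mul_comm_hom' hb]; exact h.left _ _ (h.homog.sc _ ha)

section Descend

variable {B : Type} [Ring B] [Algebra ℚ B] {π : A →ₐ[ℚ] B}

/-- A linear section of a surjective algebra morphism. -/
def linSection (hs : Function.Surjective π) : B →ₗ[ℚ] A :=
  (π.toLinearMap.exists_rightInverse_of_surjective (LinearMap.range_eq_top.2 hs)).choose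

theorem linSection_spec (hs : Function.Surjective π) (b : B) : π (linSection hs b) = b :=
  LinearMap.congr_fun
    (π.toLinearMap.exists_rightInverse_of_surjective (LinearMap.range_eq_top.2 hs)).choose_spec b

/-- An endomorphism of the source, descended along a surjection. -/
def descend (hs : Function.Surjective π) (f : A →ₗ[ℚ] A) : B →ₗ[ℚ] B :=
  π.toLinearMap ∘ₗ f ∘ₗ linSection hs

theorem descend_apply (hs : Function.Surjective π) {f : A →ₗ[ℚ] A}
    (hf : ∀ a, π a = 0 → π (f a) = 0) (a : A) : descend hs f (π a) = π (f a) := by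
  change π (f (linSection hs (π a))) = π (f a)
  rw [← sub_eq_zero, ← map_sub, ← map_sub]
  exact hf _ (by rw [map_sub, linSection_spec, sub_self])

/-- The gcdga structure on the target of a surjection with differential homogeneous kernel. -/
@[reducible] def GCDGA.ofSurj (hs : Function.Surjective π)
    (hI : IsDId (LinearMap.ker π.toLinearMap)) : GCDGA B :=
  GCDGA.ofPr B (fun i => (Gr A i).map π.toLinearMap)
    (isInternal_of_pr _ (fun i => descend hs (pr A i))
      (by
        rintro i _ ⟨a, ha, rfl⟩
        exact (descend_apply hs (hI.homog i) a).trans (by rw [pr_same ha]; rfl))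
      (by
        rintro i j hij _ ⟨a, ha, rfl⟩
        exact (descend_apply hs (hI.homog j) a).trans (by rw [pr_ne ha hij, map_zero]))
      (by
        intro b
        obtain ⟨a, rfl⟩ := hs b
        induction a using hom_induction with
        | hadd a a' ha ha' => rw [map_add]; exact add_mem ha ha'
        | hhom i a ha => exact Submodule.mem_iSup_of_mem i ⟨a, ha, rfl⟩))
    ⟨1, one_mem_Gr, map_one π⟩
    (by
      rintro i j _ _ ⟨a, ha, rfl⟩ ⟨b, hb, rfl⟩
      exact ⟨a * b, mul_mem_Gr ha hb, map_mul π a b⟩)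
    (by
      rintro i j _ _ ⟨a, ha, rfl⟩ ⟨b, hb, rfl⟩
      change π a * π b = _ • (π b * π a)
      rw [← map_mul, Gr_comm ha hb, map_smul, map_mul])
    (descend hs (Dd A))
    (by
      intro b
      obtain ⟨a, rfl⟩ := hs b
      rw [descend_apply hs hI.dd, descend_apply hs hI.dd, Dd_Dd, map_zero])
    (by
      rintro i _ ⟨a, ha, rfl⟩
      exact ⟨_, Dd_mem ha, (descend_apply hs hI.dd a).symm⟩)
    (by
      rintro i _ b ⟨a, ha, rfl⟩
      obtain ⟨b, rfl⟩ := hs b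
      change descend hs (Dd A) (π a * π b) =
        descend hs (Dd A) (π a) * π b + _ • (π a * descend hs (Dd A) (π b))
      rw [← map_mul, descend_apply hs hI.dd, descend_apply hs hI.dd, descend_apply hs hI.dd,
        leibniz, sc_apply _ ha, smul_mul_assoc, map_add, map_mul, map_smul, map_mul])

theorem isDGAHom_ofSurj (hs : Function.Surjective π)
    (hI : IsDId (LinearMap.ker π.toLinearMap)) :
    letI := GCDGA.ofSurj hs hI
    @IsDGAHom A B _ (GCDGA.ofSurj hs hI) π :=
  ⟨fun a => (descend_apply hs hI.dd a).symm, fun _ a ha => ⟨a, ha, rfl⟩⟩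

end Descend

/-- Quotients by homogeneous differential ideals. -/
theorem exists_quotient {I : Submodule ℚ A} (hI : IsDId I) :
    ∃ (Q : Type) (_ : GCDGA Q) (π : A →ₐ[ℚ] Q), IsDGAHom π ∧ Function.Surjective π ∧
      LinearMap.ker π.toLinearMap = I := by
  let I' : Ideal A :=
    { carrier := I
      add_mem' := fun ha hb => add_mem ha hb
      zero_mem' := zero_mem I
      smul_mem' := fun b a ha => hI.left b a ha }
  have : I'.IsTwoSided := ⟨fun b ha => hI.right b ha⟩
  have hs := Ideal.Quotient.mkₐ_surjective ℚ I'
  have hk : LinearMap.ker (Ideal.Quotient.mkₐ ℚ I').toLinearMap = I := by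
    ext a
    exact Ideal.Quotient.eq_zero_iff_mem
  exact ⟨A ⧸ I', GCDGA.ofSurj hs (by rwa [hk]), Ideal.Quotient.mkₐ ℚ I',
    isDGAHom_ofSurj hs (by rwa [hk]), hs, hk⟩

theorem isDId_ker {B : Type} [GCDGA B] {f : A →ₐ[ℚ] B} (hf : IsDGAHom f) :
    IsDId (LinearMap.ker f.toLinearMap) where
  homog i a ha := by
    have h : f a = 0 := ha
    change f (pr A i a) = 0
    rw [← AlgHom.toLinearMap_apply, map_pr hf.2, AlgHom.toLinearMap_apply, h, map_zero]
  left b a ha := by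
    have h : f a = 0 := ha
    change f (b * a) = 0
    rw [map_mul, h, mul_zero]
  dd a ha := by
    have h : f a = 0 := ha
    change f (Dd A a) = 0
    rw [hf.1, h, map_zero]

end Quotient

section SubProd

variable {A B : Type} [GCDGA A] [GCDGA B]

/-- The gcdga structure on a homogeneous differential subalgebra of a product. -/
@[reducible] def GCDGA.subProd (R : Subalgebra ℚ (A × B))
    (hpr : ∀ i, ∀ c ∈ R, (pr A i c.1, pr B i c.2) ∈ R)
    (hd : ∀ c ∈ R, (Dd A c.1, Dd B c.2) ∈ R) : GCDGA R :=
  GCDGA.ofPr R (fun i => ((Gr A i).prod (Gr B i)).comap R.val.toLinearMap)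
    (isInternal_of_pr _ (fun i => ((pr A i).prodMap (pr B i)).restrict (p := R.toSubmodule)
        (q := R.toSubmodule) (hpr i))
      (by
        rintro i ⟨⟨a, b⟩, hab⟩ ⟨ha, hb⟩
        exact Subtype.ext (Prod.ext (pr_same ha) (pr_same hb)))
      (by
        rintro i j hij ⟨⟨a, b⟩, hab⟩ ⟨ha, hb⟩
        exact Subtype.ext (Prod.ext (pr_ne ha hij) (pr_ne hb hij)))
      (by
        classical
        rintro ⟨⟨a, b⟩, hab⟩
        have key : (⟨(a, b), hab⟩ : R) = ∑ i ∈ (DirectSum.decompose (Gr A) a).support ∪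
            (DirectSum.decompose (Gr B) b).support, (⟨(pr A i a, pr B i b), hpr i _ hab⟩ : R) := by
          refine Subtype.ext (Prod.ext ?_ ?_)
          · rw [AddSubmonoidClass.coe_finsetSum, Prod.fst_sum]
            change a = ∑ i ∈ _, pr A i a
            conv_lhs => rw [← DirectSum.sum_support_decompose (Gr A) a]
            refine Finset.sum_subset Finset.subset_union_left fun i _ hi => ?_
            simpa using hi
          · rw [AddSubmonoidClass.coe_finsetSum, Prod.snd_sum]
            change b = ∑ i ∈ _, pr B i b
            conv_lhs => rw [← DirectSum.sum_support_decompose (Gr B) b]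
            refine Finset.sum_subset Finset.subset_union_right fun i _ hi => ?_
            simpa using hi
        rw [key]
        exact Submodule.sum_mem _ fun i _ => Submodule.mem_iSup_of_mem i ⟨pr_mem i a, pr_mem i b⟩))
    ⟨one_mem_Gr, one_mem_Gr⟩
    (fun i j a b ha hb => ⟨mul_mem_Gr ha.1 hb.1, mul_mem_Gr ha.2 hb.2⟩)
    (fun i j a b ha hb => Subtype.ext (Prod.ext (Gr_comm ha.1 hb.1) (Gr_comm ha.2 hb.2)))
    (((Dd A).prodMap (Dd B)).restrict (p := R.toSubmodule) (q := R.toSubmodule) hd)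
    (fun a => Subtype.ext (Prod.ext (Dd_Dd _) (Dd_Dd _)))
    (fun i a ha => ⟨Dd_mem ha.1, Dd_mem ha.2⟩)
    (fun i a b ha => Subtype.ext (Prod.ext (GCDGA.d_leibniz i _ _ ha.1)
      (GCDGA.d_leibniz i _ _ ha.2)))

end SubProd

section Pullback

variable {A Q : Type} [GCDGA A] [GCDGA Q]

theorem IsDGAHom.map_pr {f : A →ₐ[ℚ] Q} (hf : IsDGAHom f) (i : ℕ) (a : A) :
    f (pr A i a) = pr Q i (f a) :=
  RHT.map_pr (f := f.toLinearMap) hf.2 i a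

/-- A surjection whose kernel lies in an acyclic ideal admits a homotopy retraction. -/
theorem htpyRetraction_of_acyc {π : A →ₐ[ℚ] Q} (hπ : IsDGAHom π) (hs : Function.Surjective π)
    {J : Submodule ℚ A} (hJ : IsDId J) (hac : Acyc J) (hle : LinearMap.ker π.toLinearMap ≤ J) :
    Nonempty (HtpyRetraction π) := by
  have hJr := fun b a (ha : a ∈ J) => hJ.right b ha
  let R : Subalgebra ℚ (Q × A) :=
    { carrier := {c | ∃ a ∈ J, c.1 = π (c.2 + a)}
      mul_mem' := by
        rintro ⟨q, b⟩ ⟨q', b'⟩ ⟨a, ha, h⟩ ⟨a', ha', h'⟩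
        simp only at h h'
        refine ⟨b * a' + a * b' + a * a', ?_, ?_⟩
        · exact add_mem (add_mem (hJ.left _ _ ha') (hJr _ _ ha)) (hJ.left _ _ ha')
        · simp only [Prod.mk_mul_mk, h, h', ← map_mul]
          congr 1; noncomm_ring
      add_mem' := by
        rintro ⟨q, b⟩ ⟨q', b'⟩ ⟨a, ha, h⟩ ⟨a', ha', h'⟩
        simp only at h h'
        refine ⟨a + a', add_mem ha ha', ?_⟩
        simp only [Prod.mk_add_mk, h, h', ← map_add]
        congr 1; abel
      algebraMap_mem' := fun r => ⟨0, zero_mem _, by simp⟩ }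
  have hpr : ∀ i, ∀ c ∈ R, (pr Q i c.1, pr A i c.2) ∈ R := by
    rintro i ⟨q, b⟩ ⟨a, ha, h⟩
    simp only at h
    exact ⟨pr A i a, hJ.homog i a ha, by simp only [h, ← hπ.map_pr, map_add]⟩
  have hd : ∀ c ∈ R, (Dd Q c.1, Dd A c.2) ∈ R := by
    rintro ⟨q, b⟩ ⟨a, ha, h⟩
    simp only at h
    exact ⟨Dd A a, hJ.dd a ha, by simp only [h, ← hπ.1, map_add]⟩
  let _ : GCDGA R := GCDGA.subProd R hpr hd
  have hDd : ∀ c : R, ((Dd R c : R) : Q × A) = (Dd Q c.1.1, Dd A c.1.2) := fun c => rfl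
  let j : A →ₐ[ℚ] R := (π.prod (AlgHom.id ℚ A)).codRestrict R fun a => ⟨0, zero_mem _, by simp⟩
  let q : R →ₐ[ℚ] Q := (AlgHom.fst ℚ Q A).comp R.val
  let τ : R →ₐ[ℚ] A := (AlgHom.snd ℚ Q A).comp R.val
  have hq : IsDGAHom q := ⟨fun c => rfl, fun i c hc => hc.1⟩
  have hqs : Function.Surjective q := fun x => by
    obtain ⟨a, rfl⟩ := hs x
    exact ⟨j a, rfl⟩
  refine ⟨{ C := R, j := j, q := q, τ := τ, j_dga := ?_, q_dga := hq, τ_dga := ?_,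
            q_surj := hqs, q_quasi := ?_, hqj := rfl, hτj := rfl }⟩
  · exact ⟨fun a => Subtype.ext (Prod.ext (hπ.1 a) rfl), fun i a ha => ⟨hπ.2 i a ha, ha⟩⟩
  · exact ⟨fun c => rfl, fun i c hc => hc.2⟩
  · refine quasi_of_acyc_ker hq hqs ?_
    rintro ⟨⟨x, b⟩, a, ha, h⟩ hc hdc
    have hx : x = 0 := hc
    simp only at h
    have hb : b ∈ J := by
      have h1 : b + a ∈ J := hle (by change π (b + a) = 0; rw [← h, hx])
      simpa using sub_mem h1 ha
    obtain ⟨e, he, hbe⟩ := hac b hb (congrArg (fun c : R => c.1.2) hdc)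
    refine ⟨⟨(0, e), -e, neg_mem he, by simp⟩, rfl, ?_⟩
    exact Subtype.ext (Prod.ext (by simp [hDd, hx]) hbe)

theorem HtpyRetraction.toMod {ρ : A →ₐ[ℚ] Q} (h : HtpyRetraction ρ) :
    Nonempty (ModHtpyRetraction ρ) :=
  ⟨{ C := h.C, j := h.j, q := h.q, τ := h.τ.toLinearMap, j_dga := h.j_dga, q_dga := h.q_dga,
     q_surj := h.q_surj, q_quasi := h.q_quasi, hqj := h.hqj,
     τ_chain := fun c => (h.τ_dga.1 c),
     τ_mod := fun t c => by
       have := AlgHom.congr_fun h.hτj t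
       simp only [AlgHom.comp_apply, AlgHom.id_apply] at this
       simp [this],
     hτj := fun t => AlgHom.congr_fun h.hτj t }⟩

end Pullback

section Graded

variable {A : Type} [GCDGA A]

theorem exists_pr_bound (a : A) : ∃ N, ∀ i, N ≤ i → pr A i a = 0 := by
  induction a using hom_induction with
  | hadd a b ha hb =>
    obtain ⟨N, hN⟩ := ha
    obtain ⟨M, hM⟩ := hb
    exact ⟨max N M, fun i hi => by
      rw [map_add, hN i (le_trans (le_max_left _ _) hi), hM i (le_trans (le_max_right _ _) hi),
        add_zero]⟩
  | hhom i a ha => exact ⟨i + 1, fun j hj => pr_ne ha (by omega)⟩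

theorem exists_pr_bound_fg {U : Submodule ℚ A} (hU : U.FG) :
    ∃ N, ∀ u ∈ U, ∀ i, N ≤ i → pr A i u = 0 := by
  obtain ⟨s, rfl⟩ := hU
  choose f hf using fun a : A => exists_pr_bound a
  refine ⟨s.sup f, fun u hu i hi => ?_⟩
  have : Submodule.span ℚ (s : Set A) ≤ LinearMap.ker (pr A i) :=
    Submodule.span_le.2 fun a ha => hf a i ((Finset.le_sup ha).trans hi)
  exact this hu

theorem pr_zero_mul (a b : A) : pr A 0 (a * b) = pr A 0 a * pr A 0 b := by
  induction a using hom_induction with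
  | hadd a a' h h' => simp only [add_mul, map_add, h, h']
  | hhom i a ha =>
  induction b using hom_induction with
  | hadd a a' h h' => simp only [mul_add, map_add, h, h']
  | hhom j b hb =>
    rw [pr_of_mem _ ha, pr_of_mem _ hb, pr_of_mem _ (mul_mem_Gr ha hb)]
    by_cases hi : i = 0 <;> by_cases hj : j = 0 <;> simp [hi, hj]

/-- A subalgebra spanned by homogeneous elements, with the zero differential. -/
@[reducible] def GCDGA.ofSubalgebra (R : Subalgebra ℚ A) (hR : ∀ i, ∀ a ∈ R, pr A i a ∈ R) :
    GCDGA R :=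
  GCDGA.ofPr R (fun i => (Gr A i).comap R.val.toLinearMap)
    (isInternal_of_pr _ (fun i => (pr A i).restrict (p := R.toSubmodule) (q := R.toSubmodule)
        (hR i))
      (by
        rintro i ⟨a, ha⟩ hi
        exact Subtype.ext (pr_same hi))
      (by
        rintro i j hij ⟨a, ha⟩ hi
        exact Subtype.ext (pr_ne hi hij))
      (by
        classical
        rintro ⟨a, ha⟩
        have key : (⟨a, ha⟩ : R) = ∑ i ∈ (DirectSum.decompose (Gr A) a).support,
            (⟨pr A i a, hR i _ ha⟩ : R) := by
          refine Subtype.ext ?_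
          rw [AddSubmonoidClass.coe_finsetSum]
          exact (DirectSum.sum_support_decompose (Gr A) a).symm
        rw [key]
        exact Submodule.sum_mem _ fun i _ => Submodule.mem_iSup_of_mem i (pr_mem i a)))
    one_mem_Gr (fun i j a b ha hb => mul_mem_Gr ha hb)
    (fun i j a b ha hb => Subtype.ext (Gr_comm ha hb))
    0 (fun a => rfl) (fun i a ha => zero_mem _) (fun i a b ha => by simp)

theorem pr_mem_adjoin {s : Set A} (hs : ∀ a ∈ s, ∃ i, a ∈ Gr A i) (i : ℕ) {a : A}
    (ha : a ∈ Algebra.adjoin ℚ s) : pr A i a ∈ Algebra.adjoin ℚ s := by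
  set R := Algebra.adjoin ℚ s with hR
  let M : ℕ → Submodule ℚ A := fun i => R.toSubmodule ⊓ Gr A i
  have hM : ∀ a ∈ ⨆ i, M i, ∀ b ∈ ⨆ i, M i, a * b ∈ ⨆ i, M i := by
    intro a ha b hb
    have h := Submodule.mul_mem_mul ha hb
    rw [Submodule.iSup_mul] at h
    simp_rw [Submodule.mul_iSup] at h
    refine (iSup_le fun i => iSup_le fun j => ?_ : (⨆ i, ⨆ j, M i * M j) ≤ ⨆ i, M i) h
    refine Submodule.mul_le.2 fun x hx y hy => ?_
    exact Submodule.mem_iSup_of_mem (i + j) ⟨R.mul_mem hx.1 hy.1, mul_mem_Gr hx.2 hy.2⟩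
  have key : a ∈ ⨆ i, M i := by
    refine Algebra.adjoin_induction (fun x hx => ?_) (fun c => ?_) (fun x y _ _ hx hy => ?_)
      (fun x y _ _ hx hy => hM x hx y hy) ha
    · obtain ⟨i, hi⟩ := hs x hx
      exact Submodule.mem_iSup_of_mem i ⟨Algebra.subset_adjoin hx, hi⟩
    · refine Submodule.mem_iSup_of_mem 0 ⟨R.algebraMap_mem c, ?_⟩
      rw [Algebra.algebraMap_eq_smul_one]; exact Submodule.smul_mem _ _ one_mem_Gr
    · exact add_mem hx hy
  have : (⨆ i, M i) ≤ R.toSubmodule.comap (pr A i) := iSup_le fun j x hx => by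
    change pr A i x ∈ R
    rw [pr_of_mem _ hx.2]
    split_ifs
    · exact hx.1
    · exact zero_mem _
  exact this key

end Graded

section Lattice

/-- Comparing an independent family with a smaller family. -/
theorem inf_iSup_le_of_iSupIndep {M : Type} [AddCommGroup M] [Module ℚ M]
    {L N : ℕ → Submodule ℚ M} (hL : iSupIndep L) (hN : ∀ p, N p ≤ L p) (p : ℕ) :
    L p ⊓ ⨆ q, N q ≤ N p := by
  have h1 : (⨆ q, N q) ≤ N p ⊔ ⨆ q, ⨆ (_ : q ≠ p), L q := iSup_le fun q => by
    by_cases h : q = p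
    · subst h; exact le_sup_left
    · exact ((hN q).trans (le_iSup₂_of_le q h le_rfl)).trans le_sup_right
  calc L p ⊓ ⨆ q, N q ≤ L p ⊓ (N p ⊔ ⨆ q, ⨆ (_ : q ≠ p), L q) := inf_le_inf_left _ h1
    _ = (N p ⊔ ⨆ q, ⨆ (_ : q ≠ p), L q) ⊓ L p := inf_comm _ _
    _ = N p ⊔ (⨆ q, ⨆ (_ : q ≠ p), L q) ⊓ L p := sup_inf_assoc_of_le _ (hN p)
    _ = N p := by rw [inf_comm, (hL p).eq_bot, sup_bot_eq]

theorem adjoin_toSubmodule_eq_iSup {A : Type} [Ring A] [Algebra ℚ A] (U : Submodule ℚ A) :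
    (Algebra.adjoin ℚ (U : Set A)).toSubmodule = ⨆ p, U ^ p := by
  apply le_antisymm
  · intro a ha
    have hM : ∀ a ∈ ⨆ p, U ^ p, ∀ b ∈ ⨆ p, U ^ p, a * b ∈ ⨆ p, U ^ p := by
      intro a ha b hb
      have h := Submodule.mul_mem_mul ha hb
      rw [Submodule.iSup_mul] at h
      simp_rw [Submodule.mul_iSup, ← pow_add] at h
      exact (iSup_le fun i => iSup_le fun j => le_iSup (fun p => U ^ p) (i + j) :
        (⨆ i, ⨆ j, U ^ (i + j)) ≤ ⨆ p, U ^ p) h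
    refine Algebra.adjoin_induction (fun x hx => ?_) (fun c => ?_) (fun x y _ _ hx hy => ?_)
      (fun x y _ _ hx hy => hM x hx y hy) ha
    · exact Submodule.mem_iSup_of_mem 1 (by rwa [pow_one])
    · exact Submodule.mem_iSup_of_mem 0 (by rw [pow_zero]; exact Submodule.algebraMap_mem c)
    · exact add_mem hx hy
  · exact iSup_le fun p => by
      have : U ≤ (Algebra.adjoin ℚ (U : Set A)).toSubmodule := Algebra.subset_adjoin
      induction p with
      | zero => rw [pow_zero, Submodule.one_le]; exact one_mem (Algebra.adjoin ℚ (U : Set A))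
      | succ p ih =>
        rw [pow_succ]
        exact Submodule.mul_le.2 fun x hx y hy =>
          (Algebra.adjoin ℚ (U : Set A)).mul_mem (ih hx) (this hy)

end Lattice

namespace MinimalSullivan

variable {A : Type} [GCDGA A]

theorem adjoin_eq_top (S : MinimalSullivan A) : Algebra.adjoin ℚ (⋃ n, (S.V n : Set A)) = ⊤ := by
  set R := Algebra.adjoin ℚ (⋃ n, (S.V n : Set A)) with hR
  have hpr : ∀ i, ∀ a ∈ R, pr A i a ∈ R := fun i a ha =>
    pr_mem_adjoin (fun a ha => by
      obtain ⟨n, hn⟩ := Set.mem_iUnion.1 ha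
      exact ⟨n, S.V_le n hn⟩) i ha
  let _ : GCDGA R := GCDGA.ofSubalgebra R hpr
  have hV : ∀ n, S.V n ≤ R.toSubmodule := fun n v hv =>
    Algebra.subset_adjoin (Set.mem_iUnion.2 ⟨n, hv⟩)
  obtain ⟨g, ⟨hg1, hg2⟩, -⟩ := S.free R (fun n => Submodule.inclusion (hV n))
    (fun n v => S.V_le n v.2)
  obtain ⟨g', -, hg'⟩ := S.free A (fun n => (S.V n).subtype) (fun n v => S.V_le n v.2)
  have h1 : R.val.comp g = AlgHom.id ℚ A := by
    rw [hg' (R.val.comp g) ⟨fun i a ha => hg1 i a ha, fun n v => ?_⟩,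
      hg' (AlgHom.id ℚ A) ⟨fun i a ha => ha, fun n v => rfl⟩]
    rw [AlgHom.comp_apply, hg2]; rfl
  refine eq_top_iff.2 fun a _ => ?_
  rw [← AlgHom.id_apply (R := ℚ) a, ← h1]
  exact (g a).2

theorem adjoin_iSup_eq_top (S : MinimalSullivan A) : Algebra.adjoin ℚ ((⨆ n, S.V n : Submodule ℚ A) : Set A) = ⊤ := by
  rw [eq_top_iff, ← S.adjoin_eq_top]
  exact Algebra.adjoin_mono (Set.iUnion_subset fun n => le_iSup S.V n)

theorem pow_le_lam (S : MinimalSullivan A) {M : Submodule ℚ A} (hM : M ≤ ⨆ n, S.V n) (p : ℕ) : M ^ p ≤ S.lam p := by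
  induction p with
  | zero => rw [pow_zero, S.lam_zero]
  | succ p ih =>
    rw [pow_succ]
    exact (mul_le_mul' ih (hM.trans S.lam_one.ge)).trans (S.lam_mul p 1)

theorem lam_eq_pow (S : MinimalSullivan A) (p : ℕ) : S.lam p = (⨆ n, S.V n) ^ p := by
  refine le_antisymm ?_ (S.pow_le_lam le_rfl p)
  have h := inf_iSup_le_of_iSupIndep S.lam_internal.submodule_iSupIndep
    (S.pow_le_lam (le_refl (⨆ n, S.V n))) p
  rwa [← adjoin_toSubmodule_eq_iSup, S.adjoin_iSup_eq_top, Algebra.top_toSubmodule,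
    inf_top_eq] at h

theorem nontrivial (S : MinimalSullivan A) : Nontrivial A := by
  obtain ⟨g, -, -⟩ := S.free (DA true 0) (fun n => 0) (fun n v => zero_mem _)
  by_contra h
  rw [not_nontrivial_iff_subsingleton] at h
  have h1 : (1 : A) = 0 := Subsingleton.elim _ _
  have h2 : (1 : DA true 0) = 0 := by rw [← map_one g, h1, map_zero]
  have h3 := congrArg DA.aug h2
  rw [map_one, map_zero] at h3
  exact one_ne_zero h3

theorem conn (S : MinimalSullivan A) : Conn A := by
  intro a ha
  have key : ∀ a : A, pr A 0 a ∈ (1 : Submodule ℚ A) := by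
    intro a
    have ha : a ∈ Algebra.adjoin ℚ (⋃ n, (S.V n : Set A)) := by rw [S.adjoin_eq_top]; trivial
    refine Algebra.adjoin_induction (fun x hx => ?_) (fun c => ?_) (fun x y _ _ hx hy => ?_)
      (fun x y _ _ hx hy => ?_) ha
    · obtain ⟨n, hn⟩ := Set.mem_iUnion.1 hx
      by_cases h : n = 0
      · subst h
        have : x ∈ S.V 0 := hn
        rw [S.V0] at this
        rw [(Submodule.mem_bot ℚ).1 this, map_zero]; exact zero_mem _
      · rw [pr_ne (S.V_le n hn) h]; exact zero_mem _
    · rw [Algebra.algebraMap_eq_smul_one, map_smul, pr_same one_mem_Gr,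
        ← Algebra.algebraMap_eq_smul_one]
      exact Submodule.algebraMap_mem c
    · rw [map_add]; exact add_mem hx hy
    · rw [pr_zero_mul]
      simpa using Submodule.mul_mem_mul hx hy
  have := key a
  rw [pr_same ha] at this
  obtain ⟨c, rfl⟩ := Submodule.mem_one.1 this
  exact ⟨c, Algebra.algebraMap_eq_smul_one c⟩

end MinimalSullivan

/-- Generators and structure constants of a pure coformal model. -/
structure Gens (A : Type) [GCDGA A] (n m : ℕ) where
  x : Fin n → A
  y : Fin m → A
  kx : Fin n → ℕ
  ky : Fin m → ℕ
  x_mem : ∀ i, x i ∈ Gr A (2 * kx i + 2)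
  y_mem : ∀ j, y j ∈ Gr A (2 * ky j + 3)
  B : Fin m → Fin n → Fin n → ℚ
  B_symm : ∀ j i k, B j i k = B j k i
  B_deg : ∀ j i k, B j i k ≠ 0 → kx i + kx k = ky j
  dx : ∀ i, Dd A (x i) = 0
  dy : ∀ j, Dd A (y j) = ∑ i, ∑ k, B j i k • (x i * x k)
  lift : ∀ (C : Type) [GCDGA C] (f : Fin n → C) (g : Fin m → C),
    (∀ i, f i ∈ Gr C (2 * kx i + 2)) → (∀ j, g j ∈ Gr C (2 * ky j + 3)) →
    ∃ h : A →ₐ[ℚ] C, IsGrHom h ∧ (∀ i, h (x i) = f i) ∧ ∀ j, h (y j) = g j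
  adjoin : Algebra.adjoin ℚ (Set.range x ∪ Set.range y) = ⊤
  internal : DirectSum.IsInternal fun p => Submodule.span ℚ (Set.range x ∪ Set.range y) ^ p
  conn : Conn A
  nt : Nontrivial A

section Exists

variable {A : Type} [GCDGA A]

theorem pr_dy_symm {n : ℕ} {x : Fin n → A} {kx : Fin n → ℕ} {k : ℕ}
    (hx : ∀ i, x i ∈ Gr A (2 * kx i + 2)) {b : A} (hb : b ∈ Gr A (2 * k + 3 + 1))
    (hq : b ∈ (Submodule.span ℚ (Set.range x)) ^ 2) :
    ∃ B : Fin n → Fin n → ℚ, (∀ i j, B i j = B j i) ∧ (∀ i j, B i j ≠ 0 → kx i + kx j = k) ∧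
      b = ∑ i, ∑ j, B i j • (x i * x j) := by
  have h1 : ∃ B : Fin n → Fin n → ℚ, b = ∑ i, ∑ j, B i j • (x i * x j) := by
    rw [pow_two, Submodule.span_mul_span] at hq
    refine Submodule.span_induction ?_ ⟨0, by simp⟩ ?_ ?_ hq
    · rintro _ ⟨_, ⟨i, rfl⟩, _, ⟨j, rfl⟩, rfl⟩
      refine ⟨fun i' j' => if i' = i then if j' = j then 1 else 0 else 0, ?_⟩
      simp [ite_smul]
    · rintro a b _ _ ⟨B, rfl⟩ ⟨B', rfl⟩
      exact ⟨B + B', by simp [add_smul, Finset.sum_add_distrib]⟩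
    · rintro c a _ ⟨B, rfl⟩
      exact ⟨c • B, by simp [Finset.smul_sum, mul_smul]⟩
  obtain ⟨B, hB⟩ := h1
  refine ⟨fun i j => if kx i + kx j = k then (B i j + B j i) / 2 else 0, fun i j => ?_,
    fun i j h => ?_, ?_⟩
  · dsimp only
    rw [add_comm (kx i), add_comm (B i j)]
  · by_contra h'
    exact h (if_neg h')
  · have h2 : ∀ (B : Fin n → Fin n → ℚ), pr A (2 * k + 3 + 1) (∑ i, ∑ j, B i j • (x i * x j)) =
        ∑ i, ∑ j, (if kx i + kx j = k then B i j else 0) • (x i * x j) := by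
      intro B
      simp only [map_sum, map_smul, pr_of_mem _ (mul_mem_Gr (hx _) (hx _))]
      refine Finset.sum_congr rfl fun i _ => Finset.sum_congr rfl fun j _ => ?_
      by_cases h : kx i + kx j = k
      · rw [if_pos (by omega), if_pos h]
      · rw [if_neg (by omega), if_neg h]; simp
    have h3 : ∑ i, ∑ j, B i j • (x i * x j) = ∑ i, ∑ j, B j i • (x i * x j) := by
      rw [Finset.sum_comm]
      refine Finset.sum_congr rfl fun i _ => Finset.sum_congr rfl fun j _ => ?_
      rw [mul_comm_even ⟨kx j + 1, by ring⟩ (hx j)]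
    rw [← h2 (fun i j => (B i j + B j i) / 2)]
    have h4 : ∑ i, ∑ j, ((B i j + B j i) / 2) • (x i * x j) = b := by
      have : ∀ i j, ((B i j + B j i) / 2) • (x i * x j) =
          (1 / 2 : ℚ) • (B i j • (x i * x j) + B j i • (x i * x j)) := fun i j => by
        rw [← add_smul, smul_smul]; congr 1; ring
      simp only [this, ← Finset.smul_sum, Finset.sum_add_distrib]
      rw [← h3, ← hB, ← two_smul ℚ b, smul_smul]; norm_num
    rw [h4, pr_same hb]

theorem MinimalSullivan.exists_gens (S : MinimalSullivan A) (hpure : S.Pure) (hcof : S.Coformal)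
    (hell : Elliptic A S) :
    ∃ n m, ∃ G : Gens A n m, ∀ p, S.lam p =
      Submodule.span ℚ (Set.range G.x ∪ Set.range G.y) ^ p := by
  classical
  obtain ⟨N, hN⟩ := exists_pr_bound_fg (Submodule.fg_iff_finiteDimensional _ |>.2 hell.1)
  have hVN : ∀ k, N ≤ k → S.V k = ⊥ := fun k hk => by
    rw [eq_bot_iff]
    intro v hv
    rw [Submodule.mem_bot, ← pr_same (S.V_le k hv)]
    exact hN v (Submodule.mem_iSup_of_mem k hv) k hk
  have hVfin := S.V_fin
  let bas : ∀ k, Module.Basis (Fin (Module.finrank ℚ (S.V k))) ℚ (S.V k) :=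
    fun k => Module.finBasis ℚ (S.V k)
  let I : Type := Σ k, Fin (Module.finrank ℚ (S.V k))
  let v : I → A := fun i => (bas i.1 i.2 : A)
  have hne : ∀ i : I, S.V i.1 ≠ ⊥ := fun i h => by
    have h0 : Module.finrank ℚ (S.V i.1) = 0 := by rw [h]; exact finrank_bot ℚ A
    exact (Fin.cast h0 i.2).elim0
  have h2 : ∀ i : I, 2 ≤ i.1 ∧ i.1 < N := fun i => by
    have h0 : i.1 ≠ 0 := fun h => hne i (by rw [h]; exact S.V0)
    have h1 : i.1 ≠ 1 := fun h => hne i (by rw [h]; exact S.V1)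
    have h3 : ¬ N ≤ i.1 := fun h => hne i (hVN _ h)
    omega
  have hfin : Finite I := by
    let f : I → Σ k : Fin N, Fin (Module.finrank ℚ (S.V k)) := fun i => ⟨⟨i.1, (h2 i).2⟩, i.2⟩
    refine Finite.of_injective f fun i j h => ?_
    obtain ⟨i, a⟩ := i
    obtain ⟨j, b⟩ := j
    simp only [f, Sigma.mk.injEq, Fin.mk.injEq] at h
    obtain ⟨rfl, h⟩ := h
    rw [eq_of_heq h]
  obtain ⟨n, ⟨ex⟩⟩ := Finite.exists_equiv_fin {i : I // Even i.1}
  obtain ⟨m, ⟨ey⟩⟩ := Finite.exists_equiv_fin {i : I // ¬ Even i.1}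
  let x : Fin n → A := fun i => v (ex.symm i).1
  let y : Fin m → A := fun i => v (ey.symm i).1
  have hv : ∀ i : I, v i ∈ S.V i.1 := fun i => (bas i.1 i.2).2
  let kx : Fin n → ℕ := fun i => ((ex.symm i).1.1 - 2) / 2
  let ky : Fin m → ℕ := fun i => ((ey.symm i).1.1 - 3) / 2
  have hkx : ∀ i, (ex.symm i).1.1 = 2 * kx i + 2 := fun i => by
    obtain ⟨c, hc⟩ := (ex.symm i).2
    have := (h2 (ex.symm i).1).1
    simp only [kx]; omega
  have hky : ∀ i, (ey.symm i).1.1 = 2 * ky i + 3 := fun i => by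
    obtain ⟨c, hc⟩ := Nat.not_even_iff_odd.1 (ey.symm i).2
    have := (h2 (ey.symm i).1).1
    simp only [ky]; omega
  have hxV : ∀ i, x i ∈ S.V (2 * kx i + 2) := fun i => by rw [← hkx]; exact hv _
  have hyV : ∀ i, y i ∈ S.V (2 * ky i + 3) := fun i => by rw [← hky]; exact hv _
  have hspan : ∀ k, S.V k = Submodule.span ℚ (Set.range fun a => v ⟨k, a⟩) := fun k => by
    have := congrArg (Submodule.map (S.V k).subtype) (bas k).span_eq
    rw [Submodule.map_span, Submodule.map_top, Submodule.range_subtype, ← Set.range_comp] at this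
    exact this.symm
  have hxr : ∀ i : I, Even i.1 → v i ∈ Set.range x := fun i hi =>
    ⟨ex ⟨i, hi⟩, by simp only [x, Equiv.symm_apply_apply]⟩
  have hyr : ∀ i : I, ¬ Even i.1 → v i ∈ Set.range y := fun i hi =>
    ⟨ey ⟨i, hi⟩, by simp only [y, Equiv.symm_apply_apply]⟩
  have hU : Submodule.span ℚ (Set.range x ∪ Set.range y) = ⨆ k, S.V k := by
    apply le_antisymm
    · rw [Submodule.span_le]
      rintro _ (⟨i, rfl⟩ | ⟨i, rfl⟩)
      · exact Submodule.mem_iSup_of_mem _ (hxV i)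
      · exact Submodule.mem_iSup_of_mem _ (hyV i)
    · refine iSup_le fun k => ?_
      rw [hspan k]
      refine Submodule.span_mono ?_
      rintro _ ⟨a, rfl⟩
      by_cases h : Even k
      · exact Or.inl (hxr ⟨k, a⟩ h)
      · exact Or.inr (hyr ⟨k, a⟩ h)
  have hX : S.Veven ≤ Submodule.span ℚ (Set.range x) := iSup_le fun k => by
    rw [hspan]
    refine Submodule.span_mono ?_
    rintro _ ⟨a, rfl⟩
    exact hxr ⟨_, a⟩ (by simp)
  have hX' : Submodule.span ℚ (Set.range x) ≤ ⨆ k, S.V k := by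
    rw [← hU]; exact Submodule.span_mono Set.subset_union_left
  have hlam : ∀ p, S.lam p = Submodule.span ℚ (Set.range x ∪ Set.range y) ^ p := fun p => by
    rw [hU, S.lam_eq_pow]
  have hdy : ∀ j, ∃ B : Fin n → Fin n → ℚ, (∀ i k, B i k = B k i) ∧
      (∀ i k, B i k ≠ 0 → kx i + kx k = ky j) ∧ Dd A (y j) = ∑ i, ∑ k, B i k • (x i * x k) := by
    intro j
    refine pr_dy_symm (fun i => S.V_le _ (hxV i)) (Dd_mem (S.V_le _ (hyV j))) ?_
    refine inf_iSup_le_of_iSupIndep S.lam_internal.submodule_iSupIndep (S.pow_le_lam hX') 2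
      ⟨hcof _ _ (hyV j), ?_⟩
    rw [← adjoin_toSubmodule_eq_iSup]
    exact Algebra.adjoin_mono (fun a ha => hX ha)
      (hpure.2 _ (Submodule.mem_iSup_of_mem (ky j + 1) (hyV j)))
  choose B hB1 hB2 hB3 using hdy
  refine ⟨n, m, ⟨x, y, kx, ky, fun i => S.V_le _ (hxV i), fun j => S.V_le _ (hyV j), B, hB1, hB2,
    fun i => hpure.1 _ (Submodule.mem_iSup_of_mem (kx i + 1) (hxV i)), hB3, ?_, ?_, ?_, S.conn,
    S.nontrivial⟩, hlam⟩
  · intro C _ f g hf hg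
    let F : I → C := fun i => if h : Even i.1 then f (ex ⟨i, h⟩) else g (ey ⟨i, h⟩)
    have hF : ∀ i, F i ∈ Gr C i.1 := fun i => by
      by_cases h : Even i.1
      · have := hf (ex ⟨i, h⟩)
        rw [← hkx, Equiv.symm_apply_apply] at this
        simpa only [F, dif_pos h] using this
      · have := hg (ey ⟨i, h⟩)
        rw [← hky, Equiv.symm_apply_apply] at this
        simpa only [F, dif_neg h] using this
    obtain ⟨h, ⟨h1, h2⟩, -⟩ := S.free C (fun k => (bas k).constr ℚ fun a => F ⟨k, a⟩) (by
      intro k w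
      rw [Module.Basis.constr_apply_fintype]
      exact Submodule.sum_mem _ fun a _ => Submodule.smul_mem _ _ (hF ⟨k, a⟩))
    have h3 : ∀ i : I, h (v i) = F i := fun i => by
      rw [h2 i.1 (bas i.1 i.2), Module.Basis.constr_basis]
    refine ⟨h, h1, fun i => ?_, fun j => ?_⟩
    · rw [h3]
      simp only [F, dif_pos (ex.symm i).2, Subtype.coe_eta, Equiv.apply_symm_apply]
    · rw [h3]
      simp only [F, dif_neg (ey.symm j).2, Subtype.coe_eta, Equiv.apply_symm_apply]
  · rw [← Algebra.adjoin_span, hU, S.adjoin_iSup_eq_top]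
  · simp_rw [← hlam]; exact S.lam_internal

end Exists

section Coef

variable {C : Type} [GCDGA C] {t : Bool} {k : ℕ}

theorem tensDA_ext {M : Type*} [AddCommGroup M] [Module ℚ M] {f g : Tens C (DA t k) →ₗ[ℚ] M}
    (h1 : ∀ c n, f (tm c (DA.ev n)) = g (tm c (DA.ev n)))
    (h2 : ∀ c n, f (tm c (DA.od n)) = g (tm c (DA.od n))) : f = g :=
  tens_ext fun _ _ c z _ _ => LinearMap.congr_fun
    (DA.lin_ext (f := f ∘ₗ (tmL (A := C) (B := DA t k) c)) (g := g ∘ₗ (tmL (A := C) (B := DA t k) c))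
      (h1 c) (h2 c)) z

theorem DA.odd_exp (n : ℕ) : ((-1 : ℚ) ^ (n * (2 * k + 2) + dO t k)) = -1 := by
  apply Odd.neg_one_pow
  cases t
  · exact ⟨n * (k + 1) + k + 1, by simp [dO]; ring⟩
  · exact ⟨n * (k + 1) + k, by simp [dO]; ring⟩

theorem tm_ev_mul (c c' : C) (n : ℕ) (b : DA t k) :
    tm c (DA.ev n) * tm c' b = tm (c * c') (DA.ev n * b) := by
  rw [tm_mul c (DA.ev_mem n), Even.neg_one_pow ⟨n * (k + 1), by ring⟩, sc_one]

theorem tm_od_mul (c c' : C) (n : ℕ) (b : DA t k) :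
    tm c (DA.od n) * tm c' b = tm (c * eps C c') (DA.od n * b) := by
  rw [tm_mul c (DA.od_mem n), DA.odd_exp]

/-- The coefficient of a linear functional on the second factor. -/
def cf (φ : DA t k →ₗ[ℚ] ℚ) : Tens C (DA t k) →ₗ[ℚ] C :=
  tLift ((LinearMap.lsmul ℚ C).flip.compl₂ φ)

theorem cf_tm (φ : DA t k →ₗ[ℚ] ℚ) (c : C) (z : DA t k) : cf φ (tm c z) = φ z • c := by
  simp [cf]

/-- The coefficient of `e ^ n`. -/
def cE (n : ℕ) : Tens C (DA t k) →ₗ[ℚ] C := cf (DA.lin (fun l => if l = n then 1 else 0) fun _ => 0)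
/-- The coefficient of `o e ^ n`. -/
def cO (n : ℕ) : Tens C (DA t k) →ₗ[ℚ] C := cf (DA.lin (fun _ => 0) fun l => if l = n then 1 else 0)

theorem cE_ev (n l : ℕ) (c : C) : cE n (tm c (DA.ev l : DA t k)) = if l = n then c else 0 := by
  simp [cE, cf_tm]
theorem cE_od (n l : ℕ) (c : C) : cE n (tm c (DA.od l : DA t k)) = 0 := by
  simp [cE, cf_tm]
theorem cO_ev (n l : ℕ) (c : C) : cO n (tm c (DA.ev l : DA t k)) = 0 := by
  simp [cO, cf_tm]
theorem cO_od (n l : ℕ) (c : C) : cO n (tm c (DA.od l : DA t k)) = if l = n then c else 0 := by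
  simp [cO, cf_tm]

theorem tAug_eq_cE (z : Tens C (DA t k)) : tAug C t k z = cE 0 z :=
  LinearMap.congr_fun (tensDA_ext (f := (tAug C t k).toLinearMap) (g := cE 0)
    (fun c n => by simp [tAug_tm, cE_ev, DA.aug_ev]) (fun c n => by simp [tAug_tm, cE_od, DA.aug_od])) z

theorem cE_bound (z : Tens C (DA t k)) : ∃ N, ∀ n, N ≤ n → cE n z = 0 := by
  let S : Submodule ℚ (Tens C (DA t k)) :=
    { carrier := {z | ∃ N, ∀ n, N ≤ n → cE n z = 0}
      zero_mem' := ⟨0, fun n _ => map_zero _⟩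
      add_mem' := by
        rintro a b ⟨N, hN⟩ ⟨M, hM⟩
        exact ⟨max N M, fun i hi => by
          rw [map_add, hN i (le_trans (le_max_left _ _) hi), hM i (le_trans (le_max_right _ _) hi),
            add_zero]⟩
      smul_mem' := by
        rintro c a ⟨N, hN⟩
        exact ⟨N, fun n hn => by rw [map_smul, hN n hn, smul_zero]⟩ }
  have : S.mkQ = 0 := tensDA_ext
    (fun c n => (Submodule.Quotient.mk_eq_zero S).2
      ⟨n + 1, fun l hl => by rw [cE_ev, if_neg (by omega)]⟩)
    (fun c n => (Submodule.Quotient.mk_eq_zero S).2 ⟨0, fun l hl => cE_od _ _ _⟩)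
  exact (Submodule.Quotient.mk_eq_zero S).1 (LinearMap.congr_fun this z)

theorem cE_tm_mul_zero (c : C) (z : Tens C (DA t k)) (n : ℕ) :
    cE n (tm c 1 * z) = c * cE n z :=
  LinearMap.congr_fun (tensDA_ext (f := cE n ∘ₗ LinearMap.mulLeft ℚ (tm c (1 : DA t k)))
    (g := LinearMap.mulLeft ℚ c ∘ₗ cE n)
    (fun c n => by simp [tm_mul_one_left, cE_ev])
    (fun c n => by simp [tm_mul_one_left, cE_od])) z

theorem cE_e_mul (z : Tens C (DA t k)) (n : ℕ) :
    cE (n + 1) (tm 1 (DA.ev 1) * z) = cE n z :=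
  LinearMap.congr_fun (tensDA_ext (f := cE (n + 1) ∘ₗ LinearMap.mulLeft ℚ (tm 1 (DA.ev 1)))
    (g := cE n)
    (fun c n => by simp [tm_ev_mul, DA.ev_mul_ev, cE_ev, add_comm 1])
    (fun c n => by simp [tm_ev_mul, DA.ev_mul_od, cE_od])) z

theorem cO_mul (z w : Tens C (DA t k)) :
    cO 0 (z * w) = cE 0 z * cO 0 w + cO 0 z * eps C (cE 0 w) := by
  have key : (LinearMap.mul ℚ (Tens C (DA t k))).compr₂ (cO 0) =
      (LinearMap.mul ℚ C).compl₁₂ (cE 0) (cO 0) +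
        (LinearMap.mul ℚ C).compl₁₂ (cO 0) ((eps C).toLinearMap ∘ₗ cE 0) := by
    refine tensDA_ext (fun c n => tensDA_ext (fun c' l => ?_) (fun c' l => ?_))
      (fun c n => tensDA_ext (fun c' l => ?_) (fun c' l => ?_))
    · simp [tm_ev_mul, DA.ev_mul_ev, cO_ev, cE_ev]
    · by_cases hn : n = 0 <;> by_cases hl : l = 0 <;>
        simp [tm_ev_mul, DA.ev_mul_od, cO_ev, cE_ev, cO_od, cE_od, hn, hl]
    · by_cases hn : n = 0 <;> by_cases hl : l = 0 <;>
        simp [tm_od_mul, DA.od_mul_ev, cO_ev, cE_ev, cO_od, cE_od, hn, hl]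
    · simp [tm_od_mul, DA.od_mul_od, cO_od, cE_od]
  exact LinearMap.congr_fun (LinearMap.congr_fun key z) w

theorem cO_eps (z : Tens C (DA t k)) : cO 0 (eps _ z) = -eps C (cO 0 z) :=
  LinearMap.congr_fun (tensDA_ext (f := cO 0 ∘ₗ (eps (Tens C (DA t k))).toLinearMap)
    (g := -((eps C).toLinearMap ∘ₗ cO 0))
    (fun c n => by simp [sc_tm, DA.sc_ev, cO_ev])
    (fun c n => by by_cases hn : n = 0 <;> simp [sc_tm, DA.sc_od, cO_od, hn, tm_neg])) z

end Coef

section OddDer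

variable {T : Type} [GCDGA T]

/-- Odd derivations. -/
structure OddDer (δ : T →ₗ[ℚ] T) : Prop where
  mul : ∀ a b, δ (a * b) = δ a * b + eps T a * δ b
  anti : ∀ a, eps T (δ a) = -δ (eps T a)

theorem OddDer.dd : OddDer (Dd T) := ⟨leibniz, eps_Dd⟩

theorem OddDer.one {δ : T →ₗ[ℚ] T} (h : OddDer δ) : δ 1 = 0 := by
  have := h.mul 1 1
  simp only [mul_one, map_one, one_mul] at this
  simpa using this

theorem OddDer.algebraMap {δ : T →ₗ[ℚ] T} (h : OddDer δ) (c : ℚ) :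
    δ (algebraMap ℚ T c) = 0 := by
  rw [Algebra.algebraMap_eq_smul_one, map_smul, h.one, smul_zero]

theorem OddDer.sum {ι : Type*} (s : Finset ι) {δ : ι → T →ₗ[ℚ] T} (c : ι → T) {κ : ι → ℕ}
    (hκ : ∀ i, Even (κ i)) (hc : ∀ i, c i ∈ Gr T (κ i)) (h : ∀ i, OddDer (δ i)) :
    OddDer (∑ i ∈ s, LinearMap.mulLeft ℚ (c i) ∘ₗ δ i) := by
  refine ⟨fun a b => ?_, fun a => ?_⟩
  · simp only [LinearMap.sum_apply, LinearMap.comp_apply, LinearMap.mulLeft_apply, (h _).mul,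
      mul_add, Finset.sum_add_distrib, Finset.sum_mul, Finset.mul_sum, mul_assoc]
    congr 1
    refine Finset.sum_congr rfl fun i _ => ?_
    rw [← mul_assoc, mul_comm_even (hκ i) (hc i), mul_assoc]
  · simp only [LinearMap.sum_apply, LinearMap.comp_apply, LinearMap.mulLeft_apply, map_sum, map_mul,
      (h _).anti, sc_apply _ (hc _), (hκ _).neg_one_pow, one_smul, mul_neg, Finset.sum_neg_distrib]

/-- Intertwining an odd derivation with algebra morphisms can be checked on generators. -/
theorem OddDer.ext_hom {T' : Type} [GCDGA T'] {δ : T →ₗ[ℚ] T} {δ' : T' →ₗ[ℚ] T'} (h : OddDer δ)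
    (h' : OddDer δ') {f : T →ₐ[ℚ] T'} (hf : IsGrHom f) {s : Set T}
    (hv : ∀ v ∈ s, f (δ v) = δ' (f v)) {a : T} (ha : a ∈ Algebra.adjoin ℚ s) :
    f (δ a) = δ' (f a) := by
  refine Algebra.adjoin_induction hv (fun c => ?_) (fun x y _ _ hx hy => ?_)
    (fun x y _ _ hx hy => ?_) ha
  · rw [h.algebraMap, AlgHom.commutes, h'.algebraMap, map_zero]
  · rw [map_add, map_add, map_add, map_add, hx, hy]
  · rw [h.mul, map_add, map_mul, map_mul, map_mul, h'.mul, hx, hy, map_sc hf]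

theorem OddDer.ext_mem {δ δ' : T →ₗ[ℚ] T} (h : OddDer δ) (h' : OddDer δ') {s : Set T}
    (hv : ∀ v ∈ s, δ v = δ' v) {a : T} (ha : a ∈ Algebra.adjoin ℚ s) : δ a = δ' a :=
  h.ext_hom h' (isDGAHom_id T).gr (f := AlgHom.id ℚ T) hv ha

/-- Odd derivations that anticommute on generators anticommute. -/
theorem OddDer.anticomm {δ δ' : T →ₗ[ℚ] T} (h : OddDer δ) (h' : OddDer δ') {s : Set T}
    (hs : Algebra.adjoin ℚ s = ⊤) (hv : ∀ v ∈ s, δ (δ' v) + δ' (δ v) = 0) (a : T) :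
    δ (δ' a) + δ' (δ a) = 0 := by
  have ha : a ∈ Algebra.adjoin ℚ s := by rw [hs]; trivial
  refine Algebra.adjoin_induction hv (fun c => ?_) (fun x y _ _ hx hy => ?_)
    (fun x y _ _ hx hy => ?_) ha
  · rw [h.algebraMap, h'.algebraMap, map_zero, map_zero, add_zero]
  · simp only [map_add]
    rw [add_add_add_comm, hx, hy, add_zero]
  · simp only [h.mul, h'.mul, map_add, h.anti, h'.anti, eps_eps]
    have e1 : δ (δ' x) = -δ' (δ x) := eq_neg_of_add_eq_zero_left hx
    have e2 : δ (δ' y) = -δ' (δ y) := eq_neg_of_add_eq_zero_left hy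
    rw [e1, e2]
    noncomm_ring

/-- The odd derivation attached to a morphism into an infinitesimal extension. -/
theorem exists_oddDer {t : Bool} {k : ℕ} {Φ : T →ₐ[ℚ] Tens T (DA t k)} (hΦ : IsGrHom Φ)
    (haug : ∀ a, tAug T t k (Φ a) = a) :
    ∃ δ : T →ₗ[ℚ] T, OddDer δ ∧ ∀ v a, Φ v = tm v 1 + tm a (DA.od 0) → δ v = eps T a := by
  refine ⟨(eps T).toLinearMap ∘ₗ cO 0 ∘ₗ Φ.toLinearMap, ⟨fun a b => ?_, fun a => ?_⟩,
    fun v a h => ?_⟩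
  · simp only [LinearMap.comp_apply, AlgHom.toLinearMap_apply, map_mul, cO_mul, map_add, eps_eps,
      ← tAug_eq_cE, haug]
    rw [add_comm]
  · simp only [LinearMap.comp_apply, AlgHom.toLinearMap_apply, map_sc hΦ, cO_eps, map_neg, neg_neg]
  · simp only [LinearMap.comp_apply, AlgHom.toLinearMap_apply, h, map_add, ← DA.ev_zero, cO_ev,
      cO_od, if_true, zero_add]

end OddDer

/-- The projection onto a summand of an internal direct sum decomposition. -/
theorem exists_proj {M : Type*} [AddCommGroup M] [Module ℚ M] {L : ℕ → Submodule ℚ M}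
    (hL : DirectSum.IsInternal L) : ∃ P : ℕ → M →ₗ[ℚ] M, (∀ p a, P p a ∈ L p) ∧
      (∀ p, ∀ a ∈ L p, P p a = a) ∧ (∀ p q, ∀ a ∈ L q, q ≠ p → P p a = 0) ∧
      (∀ (N : Submodule ℚ M) a, (∀ p, P p a ∈ N) → a ∈ N) ∧ ∀ a, ∃ N, ∀ p, N ≤ p → P p a = 0 := by
  classical
  let D : DirectSum.Decomposition L := hL.chooseDecomposition
  refine ⟨fun p => (L p).subtype ∘ₗ DirectSum.component ℚ ℕ (fun i => L i) p ∘ₗ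
    (DirectSum.decomposeLinearEquiv L).toLinearMap, fun p a => SetLike.coe_mem _, fun p a ha =>
    DirectSum.decompose_of_mem_same L ha, fun p q a ha h =>
    DirectSum.decompose_of_mem_ne L ha h, fun N a h => ?_, fun a => ?_⟩
  · rw [← DirectSum.sum_support_decompose L a]
    exact N.sum_mem fun p _ => h p
  · refine ⟨(DirectSum.decompose L a).support.sup id + 1, fun p hp => ?_⟩
    by_contra h
    have h2 : p ∈ (DirectSum.decompose L a).support := by
      rw [DFinsupp.mem_support_iff]
      intro h3
      exact h (congrArg Subtype.val h3)
    have := Finset.le_sup (f := id) h2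
    simp only [id] at this
    omega

/-- Complements inside a submodule. -/
theorem exists_compl_le {M : Type*} [AddCommGroup M] [Module ℚ M] {K N : Submodule ℚ M}
    (h : K ≤ N) : ∃ C ≤ N, K ⊓ C = ⊥ ∧ K ⊔ C = N := by
  obtain ⟨D, hD⟩ := Submodule.exists_isCompl K
  refine ⟨D ⊓ N, inf_le_right, ?_, ?_⟩
  · rw [← inf_assoc, hD.inf_eq_bot, bot_inf_eq]
  · rw [← sup_inf_assoc_of_le _ h, hD.sup_eq_top, top_inf_eq]

section OddProducts

variable {A : Type} [GCDGA A]

theorem odd_mul_self {k : ℕ} {a : A} (ha : a ∈ Gr A (2 * k + 1)) : a * a = 0 := by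
  have h := Gr_comm ha ha
  rw [Odd.neg_one_pow ⟨2 * k * k + 2 * k, by ring⟩, neg_one_smul] at h
  have h2 : (2 : ℚ) • (a * a) = 0 := by rw [two_smul]; nth_rw 1 [h]; exact neg_add_cancel _
  exact (smul_eq_zero.1 h2).resolve_left two_ne_zero

theorem sup_pow_succ_le {Z U : Submodule ℚ A} (hZ : Z * Z = ⊥) (hc : U * Z ≤ Z * U) (p : ℕ) :
    (Z ⊔ U) ^ (p + 1) ≤ U ^ (p + 1) ⊔ Z * U ^ p := by
  induction p with
  | zero => simp [sup_comm]
  | succ p ih =>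
    rw [pow_succ']
    refine (mul_le_mul' le_rfl ih).trans ?_
    rw [Submodule.sup_mul, Submodule.mul_sup, Submodule.mul_sup, ← mul_assoc, hZ, Submodule.bot_mul,
      sup_bot_eq, ← pow_succ', ← mul_assoc]
    refine sup_le le_sup_right (sup_le le_sup_left (le_trans (mul_le_mul' hc le_rfl) ?_))
    rw [mul_assoc, ← pow_succ']
    exact le_sup_right

theorem span_odd_pow (l : List A) (hl : ∀ a ∈ l, ∃ k, a ∈ Gr A (2 * k + 1)) :
    Submodule.span ℚ {a | a ∈ l} ^ l.length ≤ Submodule.span ℚ {l.prod} ∧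
      ∀ p, l.length < p → Submodule.span ℚ {a | a ∈ l} ^ p = ⊥ := by
  induction l with
  | nil => 
    refine ⟨by simp [Submodule.one_eq_span], fun p hp => ?_⟩
    obtain ⟨q, rfl⟩ : ∃ q, p = q + 1 := ⟨p - 1, by simp at hp; omega⟩
    simp [pow_succ]
  | cons a l ih =>
    obtain ⟨ih1, ih2⟩ := ih fun b hb => hl b (List.mem_cons_of_mem _ hb)
    obtain ⟨k, hk⟩ := hl a List.mem_cons_self
    have e : Submodule.span ℚ {b | b ∈ a :: l} =
        Submodule.span ℚ {a} ⊔ Submodule.span ℚ {b | b ∈ l} := by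
      rw [← Submodule.span_union]
      congr 1
      ext b
      simp
    have hZ : Submodule.span ℚ {a} * Submodule.span ℚ {a} = ⊥ := by
      rw [Submodule.span_mul_span, Set.singleton_mul_singleton, odd_mul_self hk,
        Submodule.span_singleton_eq_bot.2 rfl]
    have hc : Submodule.span ℚ {b | b ∈ l} * Submodule.span ℚ {a} ≤
        Submodule.span ℚ {a} * Submodule.span ℚ {b | b ∈ l} := by
      rw [Submodule.span_mul_span, Submodule.span_le]
      rintro _ ⟨b, hb, c, hc, rfl⟩
      obtain ⟨k', hk'⟩ := hl b (List.mem_cons_of_mem _ hb)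
      rw [Set.mem_singleton_iff] at hc
      subst hc
      change b * c ∈ _
      rw [Gr_comm hk' hk]
      exact Submodule.smul_mem _ _ (Submodule.mul_mem_mul (Submodule.mem_span_singleton_self _)
        (Submodule.subset_span hb))
    refine ⟨?_, fun p hp => ?_⟩
    · rw [e, List.length_cons]
      refine (sup_pow_succ_le hZ hc _).trans ?_
      rw [ih2 _ (Nat.lt_succ_self _), bot_sup_eq]
      refine (mul_le_mul' le_rfl ih1).trans ?_
      rw [Submodule.span_mul_span, Set.singleton_mul_singleton, List.prod_cons]
    · obtain ⟨q, rfl⟩ : ∃ q, p = q + 1 := ⟨p - 1, by simp at hp; omega⟩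
      rw [List.length_cons] at hp
      rw [e, eq_bot_iff]
      refine (sup_pow_succ_le hZ hc _).trans ?_
      rw [ih2 _ (by omega), ih2 q (by omega), Submodule.mul_bot, bot_sup_eq]

theorem OddDer.zero : OddDer (0 : A →ₗ[ℚ] A) := ⟨by simp, by simp⟩

/-- An odd derivation raising word length by `s` on generators does so everywhere. -/
theorem OddDer.map_pow {δ : A →ₗ[ℚ] A} (h : OddDer δ) {U : Submodule ℚ A}
    (hU : ∀ u ∈ U, eps A u ∈ U) {s : ℕ} (hs : ∀ u ∈ U, δ u ∈ U ^ (1 + s)) (p : ℕ) :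
    ∀ a ∈ U ^ p, δ a ∈ U ^ (p + s) := by
  induction p with
  | zero =>
    intro a ha
    rw [pow_zero, Submodule.mem_one] at ha
    obtain ⟨c, rfl⟩ := ha
    rw [h.algebraMap]
    exact zero_mem _
  | succ p ih =>
    intro a ha
    rw [pow_succ'] at ha
    refine Submodule.mul_induction_on ha (fun u hu b hb => ?_) fun b c hb hc => ?_
    · rw [h.mul]
      refine add_mem ?_ ?_
      · rw [show p + 1 + s = 1 + s + p by ring, pow_add]
        exact Submodule.mul_mem_mul (hs u hu) hb
      · rw [show p + 1 + s = 1 + (p + s) by ring, pow_add, pow_one]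
        exact Submodule.mul_mem_mul (hU u hu) (ih b hb)
    · rw [map_add]
      exact add_mem hb hc

theorem algHom_map_pow {B : Type*} [Ring B] [Algebra ℚ B] (f : A →ₐ[ℚ] B) {U : Submodule ℚ A}
    {V : Submodule ℚ B} (h : ∀ u ∈ U, f u ∈ V) (p : ℕ) {a : A} (ha : a ∈ U ^ p) : f a ∈ V ^ p := by
  have h1 : (U ^ p).map f.toLinearMap ≤ V ^ p := by
    rw [Submodule.map_pow]
    exact pow_le_pow_left' (Submodule.map_le_iff_le_comap.2 h) p
  exact h1 (Submodule.mem_map_of_mem ha)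

theorem Homog.mul {M N : Submodule ℚ A} (hM : Homog M) (hN : Homog N) : Homog (M * N) := by
  intro i a ha
  refine Submodule.mul_induction_on ha (fun u hu v hv => ?_) fun b c hb hc => ?_
  · have key : ∀ u' : A, ∀ v' : A, (∀ i, pr A i u' ∈ M) → (∀ i, pr A i v' ∈ N) →
        u' * v' ∈ (M * N).comap (pr A i) := by
      intro u' v' hu' hv'
      refine mem_of_pr (M := ((M * N).comap (pr A i)).comap (LinearMap.mulRight ℚ v')) (fun k => ?_)
      refine mem_of_pr (M := ((M * N).comap (pr A i)).comap (LinearMap.mulLeft ℚ (pr A k u')))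
        (fun k' => ?_)
      change pr A i (pr A k u' * pr A k' v') ∈ M * N
      rw [pr_of_mem i (mul_mem_Gr (pr_mem k u') (pr_mem k' v'))]
      split_ifs
      · exact Submodule.mul_mem_mul (hu' _) (hv' _)
      · exact zero_mem _
    exact key u v (fun i => hM i u hu) (fun i => hN i v hv)
  · rw [map_add]; exact add_mem hb hc

theorem Homog.span {s : Set A} (hs : ∀ a ∈ s, ∃ i, a ∈ Gr A i) : Homog (Submodule.span ℚ s) := by
  intro i a ha
  induction ha using Submodule.span_induction with
  | mem a ha =>
    obtain ⟨k, hk⟩ := hs a ha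
    rw [pr_of_mem i hk]
    split_ifs
    · exact Submodule.subset_span ha
    · exact zero_mem _
  | zero => rw [map_zero]; exact zero_mem _
  | add a b _ _ h h' => rw [map_add]; exact add_mem h h'
  | smul c a _ h => rw [map_smul]; exact Submodule.smul_mem _ _ h

theorem Homog.pow {M : Submodule ℚ A} (hM : Homog M) (p : ℕ) : Homog (M ^ p) := by
  induction p with
  | zero =>
    rw [pow_zero, Submodule.one_eq_span]
    exact Homog.span fun a ha => ⟨0, by rw [Set.mem_singleton_iff.1 ha]; exact one_mem_Gr⟩
  | succ p ih => rw [pow_succ]; exact ih.mul hM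

theorem Homog.iSup {ι : Sort*} {M : ι → Submodule ℚ A} (hM : ∀ i, Homog (M i)) :
    Homog (⨆ i, M i) := by
  intro i a ha
  have : (⨆ i, M i) ≤ (⨆ i, M i).comap (pr A i) :=
    iSup_le fun k a ha => Submodule.mem_iSup_of_mem k (hM k i a ha)
  exact this ha

end OddProducts

namespace Gens

variable {A : Type} [GCDGA A] {n m : ℕ} (G : Gens A n m)

/-- The span of the generators. -/
def U : Submodule ℚ A := Submodule.span ℚ (Set.range G.x ∪ Set.range G.y)

theorem x_mem_U (i : Fin n) : G.x i ∈ G.U := Submodule.subset_span (Or.inl ⟨i, rfl⟩)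
theorem y_mem_U (j : Fin m) : G.y j ∈ G.U := Submodule.subset_span (Or.inr ⟨j, rfl⟩)

theorem mem_adjoin (a : A) : a ∈ Algebra.adjoin ℚ (Set.range G.x ∪ Set.range G.y) := by
  rw [G.adjoin]; trivial

theorem forall_gens {P : A → Prop} (hx : ∀ i, P (G.x i)) (hy : ∀ j, P (G.y j)) :
    ∀ v ∈ Set.range G.x ∪ Set.range G.y, P v := by
  rintro _ (⟨i, rfl⟩ | ⟨j, rfl⟩)
  exacts [hx i, hy j]

theorem hom_ext {B : Type*} [Ring B] [Algebra ℚ B] {f g : A →ₐ[ℚ] B}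
    (hx : ∀ i, f (G.x i) = g (G.x i)) (hy : ∀ j, f (G.y j) = g (G.y j)) : f = g :=
  AlgHom.ext_of_adjoin_eq_top G.adjoin (G.forall_gens (P := fun v => f v = g v) hx hy)

theorem U_le {M : Submodule ℚ A} (hx : ∀ i, G.x i ∈ M) (hy : ∀ j, G.y j ∈ M) : G.U ≤ M :=
  Submodule.span_le.2 (G.forall_gens (P := fun v => v ∈ M) hx hy)

theorem homog_U : Homog G.U :=
  Homog.span (G.forall_gens (P := fun v => ∃ i, v ∈ Gr A i) (fun i => ⟨_, G.x_mem i⟩)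
    fun j => ⟨_, G.y_mem j⟩)

theorem eps_U {u : A} (hu : u ∈ G.U) : eps A u ∈ G.U := G.homog_U.sc _ hu

theorem eps_x (i : Fin n) : eps A (G.x i) = G.x i := by
  rw [sc_apply _ (G.x_mem i), Even.neg_one_pow ⟨G.kx i + 1, by ring⟩, one_smul]

theorem x_comm (i : Fin n) (a : A) : G.x i * a = a * G.x i :=
  mul_comm_even ⟨G.kx i + 1, by ring⟩ (G.x_mem i) a

/-- The coefficients of the differential. -/
def a (l : Fin n) (j : Fin m) : A := ∑ k, G.B j l k • G.x k

theorem a_mem_U (l : Fin n) (j : Fin m) : G.a l j ∈ G.U :=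
  Submodule.sum_mem _ fun k _ => Submodule.smul_mem _ _ (G.x_mem_U k)

theorem eps_a (l : Fin n) (j : Fin m) : eps A (G.a l j) = G.a l j := by
  simp only [a, map_sum, map_smul, G.eps_x]

theorem dy' (j : Fin m) : Dd A (G.y j) = ∑ l, G.x l * G.a l j := by
  rw [G.dy]
  simp only [a, Finset.mul_sum, mul_smul_comm]

theorem sq_mem {u v : A} (hu : u ∈ G.U) (hv : v ∈ G.U) : u * v ∈ G.U ^ 2 := by
  rw [pow_two]; exact Submodule.mul_mem_mul hu hv

theorem d_U {u : A} (hu : u ∈ G.U) : Dd A u ∈ G.U ^ (1 + 1) := by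
  refine G.U_le (M := (G.U ^ (1 + 1)).comap (Dd A)) (fun i => ?_) (fun j => ?_) hu
  · simp [G.dx]
  · rw [Submodule.mem_comap, G.dy']
    exact Submodule.sum_mem _ fun k _ => G.sq_mem (G.x_mem_U k) (G.a_mem_U _ _)

theorem d_pow (p : ℕ) {a : A} (ha : a ∈ G.U ^ p) : Dd A a ∈ G.U ^ (p + 1) :=
  OddDer.dd.map_pow (fun _ => G.eps_U) (fun _ => G.d_U) p a ha

theorem exists_kill (i : ℕ) : ∃ h : A →ₐ[ℚ] A, IsGrHom h ∧
    (∀ l, h (G.x l) = if l.val < i then G.x l else 0) ∧ ∀ j, h (G.y j) = G.y j :=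
  G.lift A _ _ (fun l => by
    split_ifs
    · exact G.x_mem l
    · exact zero_mem _) G.y_mem

/-- The endomorphism killing the even generators of index at least `i`. -/
def kill (i : ℕ) : A →ₐ[ℚ] A := (G.exists_kill i).choose

theorem kill_gr (i : ℕ) : IsGrHom (G.kill i) := (G.exists_kill i).choose_spec.1
theorem kill_x (i : ℕ) (l : Fin n) : G.kill i (G.x l) = if l.val < i then G.x l else 0 :=
  (G.exists_kill i).choose_spec.2.1 l
@[simp] theorem kill_y (i : ℕ) (j : Fin m) : G.kill i (G.y j) = G.y j :=
  (G.exists_kill i).choose_spec.2.2 j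

theorem kill_pow (i p : ℕ) {a : A} (ha : a ∈ G.U ^ p) : G.kill i a ∈ G.U ^ p := by
  refine algHom_map_pow _ (fun u hu => ?_) p ha
  refine G.U_le (M := G.U.comap (G.kill i).toLinearMap) (fun l => ?_) (fun j => ?_) hu
  · change G.kill i (G.x l) ∈ G.U
    rw [kill_x]
    split_ifs
    · exact G.x_mem_U l
    · exact zero_mem _
  · change G.kill i (G.y j) ∈ G.U
    rw [kill_y]
    exact G.y_mem_U j

theorem kill_kill {i k : ℕ} (h : i ≤ k) (a : A) : G.kill i (G.kill k a) = G.kill i a := by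
  refine AlgHom.congr_fun (G.hom_ext (f := (G.kill i).comp (G.kill k)) (g := G.kill i)
    (fun l => ?_) fun j => ?_) a
  · simp only [AlgHom.comp_apply, kill_x]
    split_ifs <;> simp [kill_x] <;> omega
  · simp

theorem kill_n (a : A) : G.kill n a = a := by
  refine AlgHom.congr_fun (G.hom_ext (f := G.kill n) (g := AlgHom.id ℚ A)
    (fun l => ?_) fun j => ?_) a
  · simp [kill_x]
  · simp

theorem kill_d_kill (i : ℕ) (a : A) : G.kill i (Dd A (G.kill i a)) = G.kill i (Dd A a) := by
  refine Algebra.adjoin_induction (G.forall_gens (fun l => ?_) fun j => ?_) (fun c => ?_)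
    (fun a b _ _ ha hb => ?_) (fun a b _ _ ha hb => ?_) (G.mem_adjoin a)
  · rw [kill_x]; split_ifs <;> simp [G.dx]
  · simp
  · simp
  · simp only [map_add, ha, hb]
  · simp only [leibniz, map_add, map_mul, ha, hb, ← map_sc (G.kill_gr i), G.kill_kill le_rfl]

theorem kill_zero_d (a : A) : G.kill 0 (Dd A a) = 0 := by
  refine Algebra.adjoin_induction (G.forall_gens (fun l => ?_) fun j => ?_) (fun c => ?_)
    (fun a b _ _ ha hb => ?_) (fun a b _ _ ha hb => ?_) (G.mem_adjoin a)
  · simp [G.dx]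
  · simp [G.dy, kill_x]
  · simp [OddDer.dd.algebraMap]
  · simp only [map_add, ha, hb, add_zero]
  · simp only [leibniz, map_add, map_mul, ha, hb, zero_mul, mul_zero, add_zero]

/-- The kernel of one more killing is generated by the killed variable. -/
theorem kill_sub (l : Fin n) (a : A) :
    ∃ b, G.kill (l + 1) a - G.kill l a = G.x l * b := by
  refine Algebra.adjoin_induction (p := fun a _ => ∃ b, G.kill (l + 1) a - G.kill l a = G.x l * b)
    (G.forall_gens (fun k => ?_) fun j => ⟨0, by simp⟩) (fun c => ⟨0, by simp⟩)
    (fun a b _ _ ha hb => ?_) (fun a b _ _ ha hb => ?_) (G.mem_adjoin a)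
  · rw [kill_x, kill_x]
    rcases lt_trichotomy k.val l.val with h | h | h
    · exact ⟨0, by rw [if_pos (by omega), if_pos h]; simp⟩
    · have : k = l := Fin.ext h
      subst this
      exact ⟨1, by simp⟩
    · exact ⟨0, by rw [if_neg (by omega), if_neg (by omega)]; simp⟩
  · obtain ⟨u, hu⟩ := ha
    obtain ⟨v, hv⟩ := hb
    exact ⟨u + v, by rw [map_add, map_add, mul_add, ← hu, ← hv]; abel⟩
  · obtain ⟨u, hu⟩ := ha
    obtain ⟨v, hv⟩ := hb
    refine ⟨u * G.kill (l + 1) b + G.kill l a * v, ?_⟩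
    rw [map_mul, map_mul, mul_add, ← mul_assoc, ← hu, ← mul_assoc, G.x_comm l (G.kill l a),
      mul_assoc, ← hv]
    noncomm_ring

/-- Even generators are not zero divisors. -/
theorem x_nzd (l : Fin n) {a : A} (h : G.x l * a = 0) : a = 0 := by
  classical
  obtain ⟨f, hf, hx, hy⟩ := G.lift (Tens A (DA true (G.kx l)))
    (fun i => tm (G.x i) 1 + if i = l then tm 1 (DA.ev 1) else 0) (fun j => tm (G.y j) 1)
    (fun i => by
      refine add_mem (by simpa using tm_mem (G.x_mem i) (one_mem_Gr (A := DA true (G.kx l)))) ?_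
      split_ifs with hi
      · subst hi
        simpa using tm_mem (one_mem_Gr (A := A)) (DA.ev_mem (t := true) (k := G.kx i) 1)
      · exact zero_mem _)
    (fun j => by simpa using tm_mem (G.y_mem j) (one_mem_Gr (A := DA true (G.kx l))))
  have hid : ∀ a, tAug A true (G.kx l) (f a) = a := fun a =>
    AlgHom.congr_fun (G.hom_ext (f := (tAug A true (G.kx l)).comp f) (g := AlgHom.id ℚ A)
      (fun i => by
        simp only [AlgHom.comp_apply, hx, map_add, tAug_tm]
        split_ifs <;> simp [tAug_tm, DA.aug_ev])
      fun j => by simp [hy, tAug_tm]) a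
  have h2 : ∀ k, cE k (f a) = - (G.x l * cE (k + 1) (f a)) := fun k => by
    have h3 := congrArg (cE (k + 1)) (congrArg f h)
    rw [map_mul, hx, if_pos rfl, add_mul, map_add, cE_tm_mul_zero, cE_e_mul, map_zero,
      map_zero] at h3
    exact eq_neg_of_add_eq_zero_right h3
  obtain ⟨N, hN⟩ := cE_bound (f a)
  have h4 : ∀ k, cE (N - k) (f a) = 0 := fun k => by
    induction k with
    | zero => exact hN _ le_rfl
    | succ k ih =>
      by_cases hk : k < N
      · rw [h2, show N - (k + 1) + 1 = N - k by omega, ih, mul_zero, neg_zero]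
      · rwa [show N - (k + 1) = N - k by omega]
  rw [← hid a, tAug_eq_cE, ← h4 N, Nat.sub_self]

theorem x_cancel (l : Fin n) {a b : A} (h : G.x l * a = G.x l * b) : a = b :=
  sub_eq_zero.1 (G.x_nzd l (by rw [mul_sub, h, sub_self]))

/-- Odd derivations with prescribed values on the odd generators. -/
theorem exists_der (t : Bool) (k : ℕ) (b : Fin m → A)
    (hb : ∀ j, tm (b j) (DA.od 0 : DA t k) ∈ Gr (Tens A (DA t k)) (2 * G.ky j + 3)) :
    ∃ δ : A →ₗ[ℚ] A, OddDer δ ∧ (∀ i, δ (G.x i) = 0) ∧ ∀ j, δ (G.y j) = eps A (b j) := by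
  obtain ⟨f, hf, hx, hy⟩ := G.lift (Tens A (DA t k))
    (fun i => tm (G.x i) 1) (fun j => tm (G.y j) 1 + tm (b j) (DA.od 0))
    (fun i => by simpa using tm_mem (G.x_mem i) (one_mem_Gr (A := DA t k)))
    (fun j => add_mem (by simpa using tm_mem (G.y_mem j) (one_mem_Gr (A := DA t k))) (hb j))
  have hid : ∀ a, tAug A t k (f a) = a := fun a =>
    AlgHom.congr_fun (G.hom_ext (f := (tAug A t k).comp f) (g := AlgHom.id ℚ A)
      (fun i => by simp [hx, tAug_tm])
      fun j => by simp [hy, tAug_tm, DA.aug_od]) a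
  obtain ⟨δ, h1, h2⟩ := exists_oddDer hf hid
  exact ⟨δ, h1, fun i => by rw [h2 (G.x i) 0 (by rw [hx]; simp [zero_tm]), map_zero], fun j => h2 _ _ (hy j)⟩

theorem tm_a_mem (l : Fin n) (j : Fin m) : tm (G.a l j) (DA.od 0 : DA true (G.kx l)) ∈
    Gr (Tens A (DA true (G.kx l))) (2 * G.ky j + 3) := by
  have : G.a l j ∈ (Gr (Tens A (DA true (G.kx l))) (2 * G.ky j + 3)).comap
      ((tmL (A := A) (B := DA true (G.kx l))).flip (DA.od 0)) := by
    refine Submodule.sum_mem _ fun k _ => ?_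
    by_cases h : G.B j l k = 0
    · rw [h, zero_smul]; exact zero_mem _
    · refine Submodule.smul_mem _ _ ?_
      have h2 := tm_mem (G.x_mem k) (DA.od_mem (t := true) (k := G.kx l) 0)
      have h3 : 2 * G.kx k + 2 + (0 * (2 * G.kx l + 2) + dO true (G.kx l)) = 2 * G.ky j + 3 := by
        rw [← G.B_deg j l k h]; simp [dO]; ring
      rw [h3] at h2
      exact h2
  exact this

/-- The partial derivations of the differential. -/
theorem exists_delta (l : Fin n) : ∃ δ : A →ₗ[ℚ] A, OddDer δ ∧ (∀ i, δ (G.x i) = 0) ∧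
    ∀ j, δ (G.y j) = G.a l j := by
  obtain ⟨δ, h1, h2, h3⟩ := G.exists_der true (G.kx l) (G.a l) (G.tm_a_mem l)
  exact ⟨δ, h1, h2, fun j => by rw [h3, G.eps_a]⟩

theorem exists_contraction (j : Fin m) : ∃ δ : A →ₗ[ℚ] A, OddDer δ ∧ (∀ i, δ (G.x i) = 0) ∧
    ∀ k, δ (G.y k) = if k = j then 1 else 0 := by
  obtain ⟨δ, h1, h2, h3⟩ := G.exists_der false (G.ky j) (fun k => if k = j then 1 else 0) (fun k => by
    split_ifs with h
    · subst h
      simpa [dO] using tm_mem (one_mem_Gr (A := A)) (DA.od_mem (t := false) (k := G.ky k) 0)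
    · rw [zero_tm]; exact zero_mem _)
  exact ⟨δ, h1, h2, fun k => by rw [h3]; split_ifs <;> simp⟩

theorem prod_y_ne_zero : ∀ l : List (Fin m), l.Nodup → (l.map G.y).prod ≠ 0 := by
  intro l
  induction l with
  | nil => intro _; have := G.nt; simp
  | cons j l ih =>
    intro h
    rw [List.nodup_cons] at h
    obtain ⟨δ, h1, -, h3⟩ := G.exists_contraction j
    have h4 : δ (l.map G.y).prod = 0 := by
      refine h1.ext_mem OddDer.zero (s := {a | a ∈ l.map G.y}) (fun v hv => ?_)
        (list_prod_mem fun v hv => Algebra.subset_adjoin hv)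
      obtain ⟨k, hk, rfl⟩ := List.mem_map.1 hv
      rw [h3, if_neg (show ¬ k = j from fun e => h.1 (e ▸ hk))]
      rfl
    intro h5
    have h6 := congrArg δ h5
    rw [List.map_cons, List.prod_cons, h1.mul, h3, if_pos rfl, h4, mul_zero, add_zero, one_mul,
      map_zero] at h6
    exact ih h.2 h6

end Gens

/-- Iterated application of a family of operators. -/
def iterD {T : Type*} [AddCommGroup T] [Module ℚ T] {n : ℕ} (δ : Fin n → T →ₗ[ℚ] T) (w : T) : ℕ → T
  | 0 => w
  | i + 1 => if h : i < n then δ ⟨i, h⟩ (iterD δ w i) else iterD δ w i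

section IterD

variable {T : Type} [AddCommGroup T] [Module ℚ T] {n : ℕ} (δ : Fin n → T →ₗ[ℚ] T) (w : T)

theorem iterD_succ (l : Fin n) : iterD δ w (l + 1) = δ l (iterD δ w l) := dif_pos l.2

theorem iterD_mem {M : Submodule ℚ T} (hM : ∀ l, ∀ a ∈ M, δ l a ∈ M) (hw : w ∈ M) (i : ℕ) :
    iterD δ w i ∈ M := by
  induction i with
  | zero => exact hw
  | succ i ih =>
    rw [iterD]
    split_ifs
    · exact hM _ _ ih
    · exact ih

theorem iterD_killed (hδ : ∀ k l a, δ k (δ l a) = -δ l (δ k a)) (l : Fin n) (i : ℕ) (hi : l < i) :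
    δ l (iterD δ w i) = 0 := by
  induction i with
  | zero => omega
  | succ i ih =>
    rw [iterD]
    split_ifs with h
    · by_cases hl : l.val = i
      · have : l = ⟨i, h⟩ := Fin.ext hl
        subst this
        have h2 : (2 : ℚ) • δ ⟨i, h⟩ (δ ⟨i, h⟩ (iterD δ w i)) = 0 := by
          rw [two_smul]; nth_rw 1 [hδ]; exact neg_add_cancel _
        exact (smul_eq_zero.1 h2).resolve_left two_ne_zero
      · rw [hδ, ih (by omega), map_zero, neg_zero]
    · exact ih (by omega)

theorem map_iterD {T' : Type} [AddCommGroup T'] [Module ℚ T'] {δ' : Fin n → T' →ₗ[ℚ] T'}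
    {f : T →ₗ[ℚ] T'} (hf : ∀ l a, f (δ l a) = δ' l (f a)) (i : ℕ) :
    f (iterD δ w i) = iterD δ' (f w) i := by
  induction i with
  | zero => rfl
  | succ i ih =>
    rw [iterD, iterD]
    split_ifs
    · rw [hf, ih]
    · exact ih

end IterD

namespace Gens

variable {A : Type} [GCDGA A] {n m : ℕ} (G : Gens A n m)

theorem one_mem_pow_zero : (1 : A) ∈ G.U ^ 0 := by rw [pow_zero]; exact Submodule.one_le.1 le_rfl

theorem x_mul_mem (l : Fin n) {p : ℕ} {b : A} (hb : b ∈ G.U ^ p) : G.x l * b ∈ G.U ^ (p + 1) := by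
  rw [pow_succ']; exact Submodule.mul_mem_mul (G.x_mem_U l) hb

/-- The projections to fixed word length. -/
def pl : ℕ → A →ₗ[ℚ] A := (exists_proj G.internal).choose

theorem pl_mem (p : ℕ) (a : A) : G.pl p a ∈ G.U ^ p := (exists_proj G.internal).choose_spec.1 p a
theorem pl_same {p : ℕ} {a : A} (h : a ∈ G.U ^ p) : G.pl p a = a :=
  (exists_proj G.internal).choose_spec.2.1 p a h
theorem pl_ne {p q : ℕ} {a : A} (h : a ∈ G.U ^ q) (hq : q ≠ p) : G.pl p a = 0 :=
  (exists_proj G.internal).choose_spec.2.2.1 p q a h hq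
theorem mem_of_pl {N : Submodule ℚ A} {a : A} (h : ∀ p, G.pl p a ∈ N) : a ∈ N :=
  (exists_proj G.internal).choose_spec.2.2.2.1 N a h
theorem exists_pl_bound (a : A) : ∃ N, ∀ p, N ≤ p → G.pl p a = 0 :=
  (exists_proj G.internal).choose_spec.2.2.2.2 a

theorem pl_shift {f : A →ₗ[ℚ] A} {s : ℕ} (hf : ∀ p, ∀ a ∈ G.U ^ p, f a ∈ G.U ^ (p + s)) (p : ℕ)
    (a : A) : G.pl (p + s) (f a) = f (G.pl p a) := by
  have : a ∈ LinearMap.eqLocus (G.pl (p + s) ∘ₗ f) (f ∘ₗ G.pl p) := G.mem_of_pl fun q => by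
    change G.pl (p + s) (f (G.pl q a)) = f (G.pl p (G.pl q a))
    by_cases h : q = p
    · subst h
      rw [G.pl_same (hf q _ (G.pl_mem q a)), G.pl_same (G.pl_mem q a)]
    · rw [G.pl_ne (hf q _ (G.pl_mem q a)) (by omega), G.pl_ne (G.pl_mem q a) h, map_zero]
  exact this

theorem pl_shift_zero {f : A →ₗ[ℚ] A} (hf : ∀ p, ∀ a ∈ G.U ^ p, f a ∈ G.U ^ (p + 1)) (a : A) :
    G.pl 0 (f a) = 0 := by
  have : a ∈ LinearMap.ker (G.pl 0 ∘ₗ f) := G.mem_of_pl fun q =>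
    G.pl_ne (hf q _ (G.pl_mem q a)) (by omega)
  exact this

theorem pl_kd (i p : ℕ) (a : A) :
    G.pl (p + 1) (G.kill i (Dd A a)) = G.kill i (Dd A (G.pl p a)) :=
  G.pl_shift (f := (G.kill i).toLinearMap ∘ₗ Dd A)
    (fun p _ ha => G.kill_pow i _ (G.d_pow p ha)) p a

theorem pl_kd_zero (i : ℕ) (a : A) : G.pl 0 (G.kill i (Dd A a)) = 0 :=
  G.pl_shift_zero (f := (G.kill i).toLinearMap ∘ₗ Dd A)
    (fun p _ ha => G.kill_pow i _ (G.d_pow p ha)) a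

theorem pl_x (l : Fin n) (p : ℕ) (a : A) : G.pl (p + 1) (G.x l * a) = G.x l * G.pl p a :=
  G.pl_shift (f := LinearMap.mulLeft ℚ (G.x l)) (fun _ _ ha => G.x_mul_mem l ha) p a

theorem d_x_mul (l : Fin n) (a : A) : Dd A (G.x l * a) = G.x l * Dd A a := by
  rw [leibniz, G.dx, zero_mul, zero_add, G.eps_x]

theorem kill_succ_x (l : Fin n) : G.kill (l + 1) (G.x l) = G.x l := by
  rw [kill_x, if_pos (by omega)]

/-- Division by the last even generator. -/
theorem exists_div (l : Fin n) {a : A} (h : G.kill l a = 0) :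
    ∃ b, G.kill (l + 1) a = G.x l * b ∧ G.kill (l + 1) b = b := by
  obtain ⟨b, hb⟩ := G.kill_sub l a
  rw [h, sub_zero] at hb
  refine ⟨G.kill (l + 1) b, ?_, G.kill_kill le_rfl b⟩
  have := congrArg (G.kill (l + 1)) hb
  rwa [G.kill_kill le_rfl, map_mul, G.kill_succ_x] at this

theorem exists_div_pow (l : Fin n) {p : ℕ} {a : A} (ha : a ∈ G.U ^ (p + 1)) (h : G.kill l a = 0) :
    ∃ b ∈ G.U ^ p, G.kill (l + 1) a = G.x l * b ∧ G.kill (l + 1) b = b := by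
  obtain ⟨b, hb, hb2⟩ := G.exists_div l h
  have h2 : G.kill (l + 1) a = G.x l * G.pl p b := by
    rw [← G.pl_x, ← hb, G.pl_same (G.kill_pow _ _ ha)]
  refine ⟨G.pl p b, G.pl_mem p b, h2, ?_⟩
  exact (G.pl_shift (f := (G.kill (l + 1)).toLinearMap) (s := 0)
    (fun p a ha => G.kill_pow _ p ha) p b).symm.trans (by rw [AlgHom.toLinearMap_apply, hb2, add_zero])

theorem kill_d_x_mul (l : Fin n) (b : A) :
    G.kill (l + 1) (Dd A (G.x l * b)) = G.x l * G.kill (l + 1) (Dd A b) := by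
  rw [G.d_x_mul, map_mul, G.kill_succ_x]

theorem kill_x_mul (l : Fin n) (b : A) : G.kill l (G.x l * b) = 0 := by
  rw [map_mul, kill_x, if_neg (lt_irrefl _), zero_mul]

theorem kill_of_succ (l : Fin n) {a b : A} (h : G.kill (l + 1) a = G.kill (l + 1) b) :
    G.kill l a = G.kill l b := by
  rw [← G.kill_kill (Nat.le_succ l) a, ← G.kill_kill (Nat.le_succ l) b]
  exact congrArg (G.kill l) h

/-- Acyclicity in large word length, modulo the even generators of index at least `i`. -/
def AcycAbove (N i : ℕ) : Prop := ∀ p, N ≤ p → ∀ a ∈ G.U ^ (p + 1), G.kill i (Dd A a) = 0 →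
  ∃ c ∈ G.U ^ p, G.kill i a = G.kill i (Dd A c)

variable {G}

theorem AcycAbove.pred {N : ℕ} {l : Fin n} (h : G.AcycAbove N (l + 1)) : G.AcycAbove N l := by
  intro p hp a ha hda
  obtain ⟨b, hb, hab, hbb⟩ := G.exists_div_pow l (G.d_pow _ ha) hda
  have h1 : G.kill (l + 1) (Dd A b) = 0 := by
    refine G.x_nzd l ?_
    rw [← G.kill_d_x_mul, ← hab, G.kill_d_kill, Dd_Dd, map_zero]
  obtain ⟨c, hc, hbc⟩ := h p hp b hb h1
  have h2 : G.kill (l + 1) (Dd A (a - G.x l * c)) = 0 := by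
    rw [map_sub, map_sub, G.kill_d_x_mul, ← hbc, hbb, hab, sub_self]
  obtain ⟨e, he, hae⟩ := h p hp _ (sub_mem ha (G.x_mul_mem l hc)) h2
  refine ⟨e, he, ?_⟩
  have := G.kill_of_succ l hae
  rwa [map_sub, G.kill_x_mul, sub_zero] at this

theorem AcycAbove.mono {N N' i : ℕ} (h : G.AcycAbove N i) (hN : N ≤ N') : G.AcycAbove N' i :=
  fun p hp => h p (hN.trans hp)

theorem AcycAbove.lower {N : ℕ} {l : Fin n} (h : G.AcycAbove N l)
    (h' : G.AcycAbove (N + 1) (l + 1)) : G.AcycAbove N (l + 1) := by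
  intro p hp b hb hdb
  obtain ⟨a, ha, hba⟩ := h' (p + 1) (by omega) _ (G.x_mul_mem l hb) (by
    rw [G.kill_d_x_mul, hdb, mul_zero])
  have h1 : G.kill l (Dd A a) = 0 := by rw [← G.kill_of_succ l hba, G.kill_x_mul]
  obtain ⟨c, hc, hac⟩ := h p hp a ha h1
  obtain ⟨e, he, hae, -⟩ := G.exists_div_pow l (sub_mem ha (G.d_pow _ hc))
    (by rw [map_sub, hac, sub_self])
  refine ⟨e, he, G.x_cancel l ?_⟩
  rw [← G.kill_d_x_mul, ← hae, G.kill_d_kill, map_sub, Dd_Dd, sub_zero, ← hba, map_mul,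
    G.kill_succ_x]

theorem AcycAbove.succ {N M : ℕ} {l : Fin n} (h : G.AcycAbove N l)
    (h' : G.AcycAbove M (l + 1)) : G.AcycAbove N (l + 1) := by
  have key : ∀ k, G.AcycAbove (N + k) (l + 1) → G.AcycAbove N (l + 1) := fun k => by
    induction k with
    | zero => exact id
    | succ k ih => exact fun h2 => ih ((h.mono (Nat.le_add_right N k)).lower h2)
  exact key M (h'.mono (by omega))

variable (G)

theorem exists_acycAbove (hfin : FiniteDimensional ℚ (CohClasses A)) : ∃ N, G.AcycAbove N n := by
  let K := (LinearMap.range (Dd A)).comap (LinearMap.ker (Dd A)).subtype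
  obtain ⟨σ, hσ⟩ := K.mkQ.exists_rightInverse_of_surjective K.range_mkQ
  have hfin' : FiniteDimensional ℚ (LinearMap.ker (Dd A) ⧸ K) := hfin
  obtain ⟨s, hs⟩ := Module.Finite.fg_top (R := ℚ) (M := LinearMap.ker (Dd A) ⧸ K)
  choose f hf using fun z => G.exists_pl_bound (σ z : A)
  obtain ⟨N, hN⟩ : ∃ N, ∀ z, ∀ p, N ≤ p → G.pl p (σ z : A) = 0 := by
    refine ⟨s.sup f, fun z p hp => ?_⟩
    have h1 : Submodule.span ℚ (s : Set _) ≤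
        LinearMap.ker (G.pl p ∘ₗ (LinearMap.ker (Dd A)).subtype ∘ₗ σ) :=
      Submodule.span_le.2 fun z hz => hf z p ((Finset.le_sup hz).trans hp)
    exact h1 (hs ▸ Submodule.mem_top)
  refine ⟨N, fun p hp a ha hda => ?_⟩
  rw [G.kill_n] at hda
  have h2 : (⟨a, hda⟩ : LinearMap.ker (Dd A)) - σ (K.mkQ ⟨a, hda⟩) ∈ K := by
    rw [← Submodule.Quotient.mk_eq_zero K]
    change K.mkQ _ = 0
    rw [map_sub, sub_eq_zero]
    exact (LinearMap.congr_fun hσ _).symm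
  obtain ⟨e, he⟩ := h2
  refine ⟨G.pl p e, G.pl_mem p e, ?_⟩
  have h3 := G.pl_kd n p e
  rw [he] at h3
  rw [← h3, G.kill_n, G.kill_n]
  change a = G.pl (p + 1) (a - (σ (K.mkQ ⟨a, hda⟩) : A))
  rw [map_sub, hN _ _ (by omega), G.pl_same ha, sub_zero]

theorem kill_zero_mem_span {p : ℕ} {a : A} (ha : a ∈ G.U ^ p) :
    G.kill 0 a ∈ Submodule.span ℚ {b | b ∈ List.ofFn G.y} ^ p := by
  refine algHom_map_pow _ (fun u hu => ?_) p ha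
  refine G.U_le (M := (Submodule.span ℚ {b | b ∈ List.ofFn G.y}).comap (G.kill 0).toLinearMap)
    (fun l => ?_) (fun j => ?_) hu
  · change G.kill 0 (G.x l) ∈ Submodule.span ℚ {b | b ∈ List.ofFn G.y}
    simp [kill_x]
  · change G.kill 0 (G.y j) ∈ Submodule.span ℚ {b | b ∈ List.ofFn G.y}
    rw [kill_y]
    exact Submodule.subset_span (List.mem_ofFn.2 ⟨j, rfl⟩)

theorem span_y_pow :
    Submodule.span ℚ {b | b ∈ List.ofFn G.y} ^ m ≤ Submodule.span ℚ {(List.ofFn G.y).prod} ∧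
      ∀ p, m < p → Submodule.span ℚ {b | b ∈ List.ofFn G.y} ^ p = ⊥ := by
  have := span_odd_pow (List.ofFn G.y) fun a ha => by
    obtain ⟨j, rfl⟩ := List.mem_ofFn.1 ha
    exact ⟨G.ky j + 1, by simpa [show 2 * (G.ky j + 1) + 1 = 2 * G.ky j + 3 by ring] using G.y_mem j⟩
  simpa using this

theorem acycAbove_zero : G.AcycAbove m 0 := by
  intro p hp a ha _
  refine ⟨0, zero_mem _, ?_⟩
  have := G.kill_zero_mem_span ha
  rw [G.span_y_pow.2 _ (by omega)] at this
  rw [(Submodule.mem_bot ℚ).1 this, map_zero, map_zero]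

theorem acycAbove (hfin : FiniteDimensional ℚ (CohClasses A)) : ∀ i ≤ n, G.AcycAbove m i := by
  obtain ⟨N, hN⟩ := G.exists_acycAbove hfin
  have h1 : ∀ k, G.AcycAbove N (n - k) := fun k => by
    induction k with
    | zero => exact hN
    | succ k ih =>
      by_cases hk : k < n
      · exact AcycAbove.pred (l := ⟨n - (k + 1), by omega⟩)
          (by rwa [show n - (k + 1) + 1 = n - k by omega])
      · rwa [show n - (k + 1) = n - k by omega]
  intro i
  induction i with
  | zero => exact fun _ => G.acycAbove_zero
  | succ i ih =>
    intro hi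
    refine AcycAbove.succ (l := ⟨i, hi⟩) (ih (by omega)) (M := N) ?_
    have := h1 (n - (i + 1))
    rwa [show n - (n - (i + 1)) = i + 1 by omega] at this

end Gens

namespace Gens

variable {A : Type} [GCDGA A] {n m : ℕ} (G : Gens A n m)

/-- The partial derivations `δ l` with `d = ∑ x l * δ l`. -/
structure IsPartial (δ : Fin n → A →ₗ[ℚ] A) : Prop where
  odd : ∀ l, OddDer (δ l)
  x : ∀ l i, δ l (G.x i) = 0
  y : ∀ l j, δ l (G.y j) = G.a l j

theorem exists_isPartial : ∃ δ, G.IsPartial δ := by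
  choose δ h1 h2 h3 using G.exists_delta
  exact ⟨δ, h1, h2, h3⟩

namespace IsPartial

variable {G} {δ : Fin n → A →ₗ[ℚ] A}

theorem a (h : G.IsPartial δ) (k l : Fin n) (j : Fin m) : δ k (G.a l j) = 0 := by
  simp [Gens.a, h.x]

theorem anti (h : G.IsPartial δ) (k l : Fin n) (a : A) : δ k (δ l a) = -δ l (δ k a) :=
  eq_neg_of_add_eq_zero_left ((h.odd k).anticomm (h.odd l) G.adjoin (G.forall_gens
    (fun i => by simp [h.x]) fun j => by simp [h.y, h.a]) a)

theorem dd (h : G.IsPartial δ) (a : A) : Dd A a = ∑ l, G.x l * δ l a := by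
  have := OddDer.dd.ext_mem (OddDer.sum Finset.univ G.x (fun i => ⟨G.kx i + 1, by ring⟩) G.x_mem h.odd)
    (G.forall_gens (fun i => by simp [h.x, G.dx]) fun j => by simp [h.y, G.dy']) (G.mem_adjoin a)
  rw [this]
  simp

theorem map_pow (h : G.IsPartial δ) (l : Fin n) (p : ℕ) : ∀ a ∈ G.U ^ p, δ l a ∈ G.U ^ p :=
  (h.odd l).map_pow (fun _ => G.eps_U) (s := 0) (fun u hu => by
    rw [add_zero, pow_one]
    refine G.U_le (M := G.U.comap (δ l)) (fun i => ?_) (fun j => ?_) hu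
    · simp [h.x]
    · rw [Submodule.mem_comap, h.y]; exact G.a_mem_U l j) p

theorem kill_dd (h : G.IsPartial δ) (l : Fin n) (w : A) (hw : ∀ k, k < l → δ k w = 0) :
    G.kill (l + 1) (Dd A w) = G.x l * G.kill (l + 1) (δ l w) := by
  rw [h.dd, map_sum, Finset.sum_eq_single l]
  · rw [map_mul, G.kill_succ_x]
  · intro k _ hk
    rcases lt_or_gt_of_ne hk with h1 | h1
    · rw [hw k h1, mul_zero, map_zero]
    · rw [map_mul, kill_x, if_neg (by have : l.val < k.val := h1; omega), zero_mul]
  · simp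

/-- The successive approximations of the top class. -/
theorem approx (h : G.IsPartial δ) (hfin : FiniteDimensional ℚ (CohClasses A)) (i : ℕ) (hi : i ≤ n) :
    (∀ b ∈ G.U ^ m, G.kill i (Dd A b) = 0 → ∃ (c : ℚ) (e : A),
      G.kill i (b - c • iterD δ (List.ofFn G.y).prod i - Dd A e) = 0) ∧
    ∀ e, G.kill i (iterD δ (List.ofFn G.y).prod i - Dd A e) ≠ 0 := by
  have hm : ∀ i, iterD δ (List.ofFn G.y).prod i ∈ G.U ^ m := iterD_mem δ _ (fun l => h.map_pow l m) (by
    have : ∀ l : List A, (∀ a ∈ l, a ∈ G.U) → l.prod ∈ G.U ^ l.length := fun l => by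
      induction l with
      | nil => exact fun _ => G.one_mem_pow_zero
      | cons a l ih =>
        intro hl
        rw [List.prod_cons, List.length_cons, pow_succ']
        exact Submodule.mul_mem_mul (hl a List.mem_cons_self)
          (ih fun b hb => hl b (List.mem_cons_of_mem _ hb))
    simpa using this (List.ofFn G.y) fun a ha => by
      obtain ⟨j, rfl⟩ := List.mem_ofFn.1 ha
      exact G.y_mem_U j)
  induction i with
  | zero =>
    refine ⟨fun b hb _ => ?_, fun e => ?_⟩
    · obtain ⟨c, hc⟩ := Submodule.mem_span_singleton.1 (G.span_y_pow.1 (G.kill_zero_mem_span hb))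
      refine ⟨c, 0, ?_⟩
      rw [map_zero, sub_zero, map_sub, ← hc, map_smul]
      simp [iterD, map_list_prod, List.map_ofFn, Function.comp_def]
    · rw [map_sub, G.kill_zero_d, sub_zero]
      have : (List.ofFn G.y).prod ≠ 0 := by
        have := G.prod_y_ne_zero (List.finRange m) (List.nodup_finRange m)
        rwa [← List.ofFn_eq_map] at this
      simpa [iterD, map_list_prod, List.map_ofFn, Function.comp_def] using this
  | succ i ih =>
    obtain ⟨ih1, ih2⟩ := ih (by omega)
    obtain ⟨l, hl⟩ : ∃ l : Fin n, l.val = i := ⟨⟨i, hi⟩, rfl⟩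
    subst hl
    have hac := G.acycAbove hfin (l + 1) hi
    set w := iterD δ (List.ofFn G.y).prod l
    set w' := iterD δ (List.ofFn G.y).prod (l + 1) with hw'
    have hww : G.kill (l + 1) (Dd A w) = G.x l * G.kill (l + 1) w' := by
      rw [h.kill_dd l w fun k hk => iterD_killed δ _ h.anti k l hk, hw', iterD_succ]
    have hsp : ∀ b ∈ G.U ^ m, G.kill (l + 1) (Dd A b) = 0 → ∃ (c : ℚ) (e : A),
        G.kill (l + 1) (b - c • w' - Dd A e) = 0 := by
      intro b hb hdb
      obtain ⟨a, ha, hba⟩ := hac m le_rfl _ (G.x_mul_mem l hb) (by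
        rw [G.kill_d_x_mul, hdb, mul_zero])
      have h1 : G.kill l (Dd A a) = 0 := by rw [← G.kill_of_succ l hba, G.kill_x_mul]
      obtain ⟨c, e, hce⟩ := ih1 a ha h1
      obtain ⟨f, hf, -⟩ := G.exists_div l hce
      refine ⟨c, f, G.x_nzd l ?_⟩
      have h2 : G.kill (l + 1) (Dd A (G.kill (l + 1) (a - c • w - Dd A e))) =
          G.x l * (G.kill (l + 1) b - c • G.kill (l + 1) w') := by
        rw [G.kill_d_kill, map_sub, Dd_Dd, sub_zero, map_sub, map_smul, map_sub, map_smul, hww,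
          ← hba, map_mul, G.kill_succ_x, mul_sub, mul_smul_comm]
      rw [hf, G.kill_d_x_mul] at h2
      rw [map_sub, map_sub, map_smul, mul_sub, ← h2, sub_self]
    refine ⟨hsp, fun e he => ?_⟩
    obtain ⟨f, hxf, hf⟩ : ∃ f, G.x l * f ∈ G.U ^ m ∧ G.kill (l + 1) w' = G.kill (l + 1) (Dd A f) := by
      rw [map_sub, sub_eq_zero] at he
      rcases Nat.eq_zero_or_pos m with h0 | h0
      · have hU : G.U ^ m = G.U ^ 0 := congrArg _ h0
        refine ⟨0, by rw [mul_zero]; exact zero_mem _, ?_⟩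
        have h3 := G.pl_kd_zero (l + 1) e
        rw [← he, G.pl_same (hU ▸ G.kill_pow _ _ (hm _))] at h3
        rw [h3, map_zero, map_zero]
      · obtain ⟨p, hp⟩ : ∃ p, m = p + 1 := ⟨m - 1, by omega⟩
        have hU : G.U ^ m = G.U ^ (p + 1) := congrArg _ hp
        refine ⟨G.pl p e, hU ▸ G.x_mul_mem l (G.pl_mem p e), ?_⟩
        rw [← G.pl_kd, ← he, G.pl_same (hU ▸ G.kill_pow _ _ (hm _))]
    obtain ⟨c, g, hcg⟩ := hsp (w - G.x l * f) (sub_mem (hm _) hxf) (by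
      rw [map_sub, map_sub, hww, G.kill_d_x_mul, hf, sub_self])
    refine ih2 (c • f + g) ?_
    have h4 : G.kill (l + 1) (w - Dd A (c • f + g)) = G.kill (l + 1) (G.x l * f) := by
      rw [map_sub, map_sub, map_sub, map_smul, hf, sub_sub, sub_sub, sub_eq_zero] at hcg
      rw [map_sub, hcg, map_add, map_add, map_smul, map_smul]
      abel
    exact (G.kill_of_succ l h4).trans (G.kill_x_mul l f)

/-- The top class is a nontrivial cocycle. -/
theorem top (h : G.IsPartial δ) (hfin : FiniteDimensional ℚ (CohClasses A)) :
    Dd A (iterD δ (List.ofFn G.y).prod n) = 0 ∧ ∀ e, iterD δ (List.ofFn G.y).prod n ≠ Dd A e := by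
  refine ⟨?_, fun e he => (h.approx hfin n le_rfl).2 e (by rw [he, sub_self, map_zero])⟩
  rw [h.dd]
  exact Finset.sum_eq_zero fun l _ => by
    rw [iterD_killed δ _ h.anti l n l.2, mul_zero]

end IsPartial

end Gens

namespace Gens

variable {A : Type} [GCDGA A] {n m : ℕ} (G : Gens A n m)

theorem exact_of_pow (hfin : FiniteDimensional ℚ (CohClasses A)) {p : ℕ} (hp : m ≤ p) {a : A}
    (ha : a ∈ G.U ^ (p + 1)) (hda : Dd A a = 0) : ∃ c ∈ G.U ^ p, a = Dd A c := by
  obtain ⟨c, hc, h⟩ := G.acycAbove hfin n le_rfl p hp a ha (by rw [hda, map_zero])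
  rw [G.kill_n, G.kill_n] at h
  exact ⟨c, hc, h⟩

/-- Elements of word length greater than `m`. -/
def above (m : ℕ) : Submodule ℚ A := ⨆ k, ⨆ (_ : m < k), G.U ^ k

theorem pow_le_above {k p : ℕ} (h : k < p) : G.U ^ p ≤ G.above k :=
  le_iSup₂_of_le p h le_rfl

theorem pl_above {k p : ℕ} (h : p ≤ k) {a : A} (ha : a ∈ G.above k) : G.pl p a = 0 := by
  have : G.above k ≤ LinearMap.ker (G.pl p) := iSup₂_le fun q hq b hb => G.pl_ne hb (by omega)
  exact this ha

theorem mem_above {k : ℕ} {a : A} (h : ∀ p ≤ k, G.pl p a = 0) : a ∈ G.above k :=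
  G.mem_of_pl fun p => by
    by_cases hp : p ≤ k
    · rw [h p hp]; exact zero_mem _
    · exact G.pow_le_above (not_le.1 hp) (G.pl_mem p a)

theorem homog_above (k : ℕ) : Homog (G.above k) :=
  Homog.iSup fun p => Homog.iSup fun _ => G.homog_U.pow p

theorem pr_pow (p i : ℕ) (a : A) : G.pl p (pr A i a) = pr A i (G.pl p a) :=
  G.pl_shift (s := 0) (fun p a ha => G.homog_U.pow p i a ha) p a

/-- The ideal generated by long words together with a complement to the cocycles of length `m`
is acyclic. -/
theorem exists_acyc (hfin : FiniteDimensional ℚ (CohClasses A)) :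
    ∃ J : Submodule ℚ A, IsDId J ∧ Acyc J ∧ G.above m ≤ J := by
  choose C hC1 hC2 hC3 using fun i => exists_compl_le
    (show LinearMap.ker (Dd A) ⊓ (G.U ^ m ⊓ Gr A i) ≤ G.U ^ m ⊓ Gr A i from inf_le_right)
  have hCpr : ∀ i, ∀ c ∈ ⨆ i, C i, pr A i c ∈ C i := fun i c hc => by
    have : (⨆ i, C i) ≤ (C i).comap (pr A i) := iSup_le fun k c hc => by
      rw [Submodule.mem_comap, pr_of_mem i (hC1 k hc).2]
      split_ifs with h
      · exact h ▸ hc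
      · exact zero_mem _
    exact this hc
  have hCm : (⨆ i, C i) ≤ G.U ^ m := iSup_le fun i => (hC1 i).trans inf_le_left
  have hhom : Homog (⨆ i, C i) := fun i c hc => Submodule.mem_iSup_of_mem i (hCpr i c hc)
  refine ⟨(⨆ i, C i) ⊔ G.above m, ⟨?_, fun b a ha => ?_, fun a ha => ?_⟩, fun z hz hdz => ?_,
    le_sup_right⟩
  · intro i a ha
    obtain ⟨c, hc, w, hw, rfl⟩ := Submodule.mem_sup.1 ha
    rw [map_add]
    exact Submodule.add_mem_sup (hhom i c hc) (G.homog_above m i w hw)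
  · obtain ⟨c, hc, w, hw, rfl⟩ := Submodule.mem_sup.1 ha
    have : b ∈ ((⨆ i, C i) ⊔ G.above m).comap (LinearMap.mulRight ℚ (c + w)) :=
      G.mem_of_pl fun p => by
        change G.pl p b * (c + w) ∈ (⨆ i, C i) ⊔ G.above m
        rw [mul_add]
        have hb := G.pl_mem p b
        refine add_mem ?_ (Submodule.mem_sup_right ?_)
        · rcases Nat.eq_zero_or_pos p with rfl | hp
          · rw [pow_zero, Submodule.mem_one] at hb
            obtain ⟨q, hq⟩ := hb
            rw [← hq, ← Algebra.smul_def]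
            exact Submodule.mem_sup_left (Submodule.smul_mem _ _ hc)
          · refine Submodule.mem_sup_right (G.pow_le_above (p := p + m) (by omega) ?_)
            rw [pow_add]
            exact Submodule.mul_mem_mul hb (hCm hc)
        · have h2 : G.above m ≤ (G.above m).comap (LinearMap.mulLeft ℚ (G.pl p b)) :=
            iSup₂_le fun q hq v hv => G.pow_le_above (p := p + q) (by omega) (by
              rw [pow_add]; exact Submodule.mul_mem_mul hb hv)
          exact h2 hw
    exact this
  · refine Submodule.mem_sup_right ?_
    have h2 : (⨆ i, C i) ⊔ G.above m ≤ (G.above m).comap (Dd A) :=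
      sup_le (fun c hc => G.pow_le_above (Nat.lt_succ_self m) (G.d_pow m (hCm hc)))
        (iSup₂_le fun q hq v hv => G.pow_le_above (p := q + 1) (by omega) (G.d_pow q hv))
    exact h2 ha
  · have hplz : ∀ p, Dd A (G.pl p z) = 0 := fun p => by
      have := G.pl_shift (f := Dd A) (s := 1) (fun p a ha => G.d_pow p ha) p z
      rw [← this, hdz, map_zero]
    obtain ⟨c, hc, w, hw, rfl⟩ := Submodule.mem_sup.1 hz
    have hc0 : c = 0 := by
      refine eq_zero_of_pr fun i => ?_
      have h1 : Dd A c = 0 := by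
        have := hplz m
        rwa [map_add, G.pl_same (hCm hc), G.pl_above le_rfl hw, add_zero] at this
      have h2 : pr A i c ∈ LinearMap.ker (Dd A) ⊓ (G.U ^ m ⊓ Gr A i) ⊓ C i :=
        ⟨⟨by change Dd A (pr A i c) = 0; rw [← pr_Dd, h1, map_zero], hC1 i (hCpr i c hc)⟩, hCpr i c hc⟩
      rw [hC2] at h2
      exact h2
    subst hc0
    rw [zero_add] at hz hdz hplz ⊢
    have h3 : w ∈ ((⨆ i, C i) ⊔ G.above m).map (Dd A) := G.mem_of_pl fun p => by
      by_cases hp : p ≤ m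
      · rw [G.pl_above hp hw]; exact zero_mem _
      · obtain ⟨q, rfl⟩ : ∃ q, p = q + 1 := ⟨p - 1, by omega⟩
        obtain ⟨e, he, hwe⟩ := G.exact_of_pow hfin (by omega) (G.pl_mem (q + 1) w) (hplz _)
        rw [hwe]
        rcases eq_or_lt_of_le (show m ≤ q by omega) with h | h
        · have hem : ∀ i, pr A i e ∈ G.U ^ m ⊓ Gr A i := fun i =>
            ⟨(G.homog_U.pow m) i e (by rw [show G.U ^ m = G.U ^ q from congrArg _ h]; exact he),
              pr_mem i e⟩
          have h4 : e ∈ (((⨆ i, C i) ⊔ G.above m).map (Dd A)).comap (Dd A) := mem_of_pr fun i => by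
            have h5 := hem i
            rw [← hC3 i] at h5
            obtain ⟨u, hu, v, hv, huv⟩ := Submodule.mem_sup.1 h5
            refine ⟨v, Submodule.mem_sup_left (Submodule.mem_iSup_of_mem i hv), ?_⟩
            rw [← huv, map_add, show Dd A u = 0 from hu.1, zero_add]
          exact h4
        · exact Submodule.mem_map_of_mem (Submodule.mem_sup_right (G.pow_le_above h he))
    obtain ⟨e, he, hde⟩ := h3
    exact ⟨e, he, hde.symm⟩

theorem gr_le_above (k : ℕ) : ∃ N, ∀ i, N ≤ i → Gr A i ≤ G.above k := by
  have h : ∀ p, ∃ N, ∀ u ∈ G.U ^ p, ∀ i, N ≤ i → pr A i u = 0 := fun p =>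
    exists_pr_bound_fg (Submodule.FG.pow (Submodule.fg_span
      ((Set.finite_range _).union (Set.finite_range _))) p)
  choose f hf using h
  refine ⟨(Finset.range (k + 1)).sup f, fun i hi a ha => G.mem_above fun p hp => ?_⟩
  rw [← pr_same ha, G.pr_pow]
  exact hf p _ (G.pl_mem p a) i
    ((Finset.le_sup (f := f) (Finset.mem_range.2 (by omega))).trans hi)

theorem cat_le (S : MinimalSullivan A) (hS : ∀ p, S.lam p = G.U ^ p)
    (hfin : FiniteDimensional ℚ (CohClasses A)) : cat A S ≤ m := by
  have hid : IsDId (G.above m) := by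
    refine ⟨G.homog_above m, fun b a ha => ?_, fun a ha => ?_⟩
    · have : b ∈ (G.above m).comap (LinearMap.mulRight ℚ a) :=
        G.mem_of_pl fun p => by
          have h2 : G.above m ≤ (G.above m).comap (LinearMap.mulLeft ℚ (G.pl p b)) :=
            iSup₂_le fun q hq v hv => G.pow_le_above (p := p + q) (by omega) (by
              rw [pow_add]; exact Submodule.mul_mem_mul (G.pl_mem p b) hv)
          exact h2 ha
      exact this
    · have h2 : G.above m ≤ (G.above m).comap (Dd A) :=
        iSup₂_le fun q hq v hv => G.pow_le_above (p := q + 1) (by omega) (G.d_pow q hv)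
      exact h2 ha
  obtain ⟨Q, _, π, h1, h2, h3⟩ := exists_quotient hid
  obtain ⟨J, hJ, hac, hle⟩ := G.exists_acyc hfin
  exact Nat.sInf_le ⟨{
    Q := Q, π := π, π_dga := h1, π_surj := h2
    π_ker := by rw [h3, above]; simp only [hS]
    retr := htpyRetraction_of_acyc h1 h2 hJ hac (h3.le.trans hle) }⟩

end Gens

section Small

/-- Existence of a surjection with acyclic kernel onto a gcdga of bounded degree. -/
def Small (T : Type) [GCDGA T] : Prop :=
  ∃ (Q : Type) (_ : GCDGA Q) (π : T →ₐ[ℚ] Q), IsDGAHom π ∧ Function.Surjective π ∧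
    Acyc (LinearMap.ker π.toLinearMap) ∧ ∃ N, ∀ i, N ≤ i → ∀ q ∈ Gr Q i, q = 0

theorem Acyc.comp {A B C : Type} [GCDGA A] [GCDGA B] [GCDGA C] {g : B →ₐ[ℚ] C} {f : A →ₐ[ℚ] B}
    (hf : IsDGAHom f) (hs : Function.Surjective f)
    (haf : Acyc (LinearMap.ker f.toLinearMap)) (hag : Acyc (LinearMap.ker g.toLinearMap)) :
    Acyc (LinearMap.ker (g.comp f).toLinearMap) := by
  intro z hz hdz
  obtain ⟨w, hw, h⟩ := hag (f z) hz (by rw [← hf.1, hdz, map_zero])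
  obtain ⟨w', rfl⟩ := hs w
  obtain ⟨v, hv, h2⟩ := haf (z - Dd A w')
    (by
      change f (z - Dd A w') = 0
      rw [map_sub, h, hf.1, sub_self]) (by rw [map_sub, hdz, Dd_Dd, sub_zero])
  refine ⟨w' + v, ?_, by rw [map_add, ← h2]; abel⟩
  change g (f (w' + v)) = 0
  have hv' : f v = 0 := hv
  rw [map_add, hv', add_zero]
  exact hw

variable {A Q B : Type} [GCDGA A] [GCDGA Q] [GCDGA B]

theorem exists_range_section {M : Type*} [AddCommGroup M] [Module ℚ M] (D : M →ₗ[ℚ] M) :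
    ∃ s : LinearMap.range D →ₗ[ℚ] M, ∀ x, D (s x) = x := by
  obtain ⟨s, hs⟩ := D.rangeRestrict.exists_rightInverse_of_surjective D.range_rangeRestrict
  exact ⟨s, fun x => congrArg Subtype.val (LinearMap.congr_fun hs x)⟩

/-- An acyclic submodule stable under the differential admits a linear contraction. -/
theorem Acyc.exists_contr {K : Submodule ℚ A} (hK : Acyc K) (hd : ∀ a ∈ K, Dd A a ∈ K) :
    ∃ h : A →ₗ[ℚ] A, (∀ a, h a ∈ K) ∧ ∀ a ∈ K, Dd A (h a) + h (Dd A a) = a := by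
  obtain ⟨L, hL⟩ := Submodule.exists_isCompl K
  let D : K →ₗ[ℚ] K := (Dd A).restrict hd
  obtain ⟨s, hs'⟩ := exists_range_section D
  have hDD : ∀ k, D (D k) = 0 := fun k => Subtype.ext (Dd_Dd _)
  have hac : ∀ k, D k = 0 → k ∈ LinearMap.range D := fun k hk => by
    obtain ⟨b, hb, h⟩ := hK k k.2 (congrArg Subtype.val hk)
    exact ⟨⟨b, hb⟩, Subtype.ext h.symm⟩
  let e : K →ₗ[ℚ] K := LinearMap.id - s ∘ₗ D.rangeRestrict
  have he : ∀ k, e k ∈ LinearMap.range D := fun k => hac _ (by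
    change D (k - s (D.rangeRestrict k)) = 0
    rw [map_sub, hs']
    exact sub_self _)
  let hh : K →ₗ[ℚ] K := s ∘ₗ e.codRestrict _ he
  refine ⟨K.subtype ∘ₗ hh ∘ₗ K.projectionOnto L hL, fun a => (hh _).2, fun a ha => ?_⟩
  have h1 : ∀ k : K, K.projectionOnto L hL k = k := fun k =>
    Submodule.projectionOnto_apply_left hL k
  have h2 : ∀ k : K, D (hh k) + hh (D k) = k := fun k => by
    have e1 : D (hh k) = e k := hs' ⟨e k, he k⟩
    have e2 : e (D k) = D k := by
      change D k - s (D.rangeRestrict (D k)) = D k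
      have : D.rangeRestrict (D k) = 0 := Subtype.ext (hDD k)
      rw [this, map_zero, sub_zero]
    have e3 : hh (D k) = s (D.rangeRestrict k) :=
      congrArg s (Subtype.ext e2)
    rw [e1, e3]
    exact sub_add_cancel _ _
  have h3 := congrArg Subtype.val (h2 ⟨a, ha⟩)
  change Dd A (hh (K.projectionOnto L hL ((⟨a, ha⟩ : K) : A)) : A) +
    hh (K.projectionOnto L hL ((D ⟨a, ha⟩ : K) : A)) = a
  rw [h1, h1]
  exact h3

theorem Acyc.exists_contr_anti {K : Submodule ℚ A} (hK : Acyc K) (hI : IsDId K) :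
    ∃ h : A →ₗ[ℚ] A, (∀ a, h a ∈ K) ∧ (∀ a ∈ K, Dd A (h a) + h (Dd A a) = a) ∧
      ∀ a, h (eps A a) = - eps A (h a) := by
  obtain ⟨h, h1, h2⟩ := hK.exists_contr hI.dd
  have hE : ∀ a ∈ K, eps A a ∈ K := fun a ha => hI.homog.sc _ ha
  refine ⟨(1 / 2 : ℚ) • (h - (eps A).toLinearMap ∘ₗ h ∘ₗ (eps A).toLinearMap),
    fun a => K.smul_mem _ (sub_mem (h1 a) (hE _ (h1 _))), fun a ha => ?_, fun a => ?_⟩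
  · change Dd A ((1 / 2 : ℚ) • (h a - eps A (h (eps A a)))) +
      (1 / 2 : ℚ) • (h (Dd A a) - eps A (h (eps A (Dd A a)))) = a
    have e1 := h2 a ha
    have e2 := congrArg (eps A) (h2 _ (hE a ha))
    rw [map_add, eps_Dd, eps_eps] at e2
    rw [eps_Dd, map_neg, map_neg, map_smul, map_sub, ← smul_add]
    have e3 : Dd A (h a) - Dd A (eps A (h (eps A a))) +
        (h (Dd A a) - -eps A (h (Dd A (eps A a)))) = (2 : ℚ) • a := by
      rw [two_smul]
      refine Eq.trans ?_ (congrArg₂ (· + ·) e1 e2)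
      abel
    rw [e3, smul_smul]
    norm_num
  · change (1 / 2 : ℚ) • (h (eps A a) - eps A (h (eps A (eps A a)))) =
      - eps A ((1 / 2 : ℚ) • (h a - eps A (h (eps A a))))
    rw [eps_eps, map_smul, map_sub, eps_eps, ← smul_neg, neg_sub]

variable {π : A →ₐ[ℚ] Q} (hπ : IsDGAHom π)

variable (B) in
/-- Tensoring a morphism with an identity on the right. -/
def tRight : Tens A B →ₐ[ℚ] Tens Q B :=
  tHom ((tInl Q B).comp π) (tInr Q B) (tInl_dga.comp hπ).gr tInr_dga.gr

variable (B) in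
/-- Tensoring a morphism with an identity on the left. -/
def tLeft : Tens B A →ₐ[ℚ] Tens B Q :=
  tHom (tInl B Q) ((tInr B Q).comp π) tInl_dga.gr (tInr_dga.comp hπ).gr

theorem tRight_tm (a : A) (b : B) : tRight B hπ (tm a b) = tm (π a) b :=
  (tHom_tm _ _ _ _ _ _).trans (tInl_mul_tInr _ _)

theorem tLeft_tm (a : A) (b : B) : tLeft B hπ (tm b a) = tm b (π a) :=
  (tHom_tm _ _ _ _ _ _).trans (tInl_mul_tInr _ _)

theorem tRight_dga : IsDGAHom (tRight B hπ) := tHom_dga _ _ (tInl_dga.comp hπ) tInr_dga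

theorem tLeft_dga : IsDGAHom (tLeft B hπ) := tHom_dga _ _ tInl_dga (tInr_dga.comp hπ)

theorem tRight_surj (hs : Function.Surjective π) : Function.Surjective (tRight B hπ) := by
  intro z
  induction z using tens_induction with
  | h0 => exact ⟨0, map_zero _⟩
  | hadd x y hx hy =>
    obtain ⟨a, rfl⟩ := hx
    obtain ⟨b, rfl⟩ := hy
    exact ⟨a + b, map_add _ _ _⟩
  | htm i j q b hq hb =>
    obtain ⟨a, rfl⟩ := hs q
    exact ⟨tm a b, tRight_tm hπ a b⟩

theorem tLeft_surj (hs : Function.Surjective π) : Function.Surjective (tLeft B hπ) := by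
  intro z
  induction z using tens_induction with
  | h0 => exact ⟨0, map_zero _⟩
  | hadd x y hx hy =>
    obtain ⟨a, rfl⟩ := hx
    obtain ⟨b, rfl⟩ := hy
    exact ⟨a + b, map_add _ _ _⟩
  | htm i j b q hq hb =>
    obtain ⟨a, rfl⟩ := hs q
    exact ⟨tm b a, tLeft_tm hπ a b⟩

theorem Acyc.tRight (hs : Function.Surjective π) (hK : Acyc (LinearMap.ker π.toLinearMap)) :
    Acyc (LinearMap.ker (tRight B hπ).toLinearMap) := by
  intro z hz hdz
  obtain ⟨h, h1, h2, h3⟩ := hK.exists_contr_anti (isDId_ker hπ)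
  let s := linSection hs
  have hsp : ∀ a, a - s (π a) ∈ LinearMap.ker π.toLinearMap := fun a => by
    change π (a - s (π a)) = 0
    rw [map_sub, linSection_spec, sub_self]
  let H : Tens A B →ₗ[ℚ] Tens A B := tMap h LinearMap.id
  have hH : ∀ z : Tens A B, RHT.tRight B hπ (H z) = 0 := fun z => by
    induction z using tens_induction with
    | h0 => simp
    | hadd x y hx hy => rw [map_add, map_add, hx, hy, add_zero]
    | htm i j a b ha hb =>
      rw [tMap_tm, tRight_tm, show π (h a) = 0 from h1 a, zero_tm]
  let S : Tens Q B →ₗ[ℚ] Tens A B := tMap s LinearMap.id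
  have key : ∀ z : Tens A B, Dd _ (H (z - S (RHT.tRight B hπ z))) +
      H (Dd _ (z - S (RHT.tRight B hπ z))) = z - S (RHT.tRight B hπ z) := fun z => by
    induction z using tens_induction with
    | h0 => simp
    | hadd x y hx hy =>
      have : x + y - S (RHT.tRight B hπ (x + y)) =
          (x - S (RHT.tRight B hπ x)) + (y - S (RHT.tRight B hπ y)) := by
        rw [map_add, map_add]; abel
      rw [this, map_add, map_add, map_add, map_add]
      refine Eq.trans ?_ (congrArg₂ (· + ·) hx hy)
      abel
    | htm i j a b ha hb =>
      rw [tRight_tm, tMap_tm, LinearMap.id_apply, ← sub_tm]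
      generalize hk : a - s (π a) = k
      have hk' := hsp a
      rw [hk] at hk'
      rw [Dd_tm, map_add, tMap_tm, tMap_tm, tMap_tm, Dd_tm, h3]
      simp only [LinearMap.id_apply, neg_tm]
      conv_rhs => rw [← h2 k hk', add_tm]
      abel
  have hz' : RHT.tRight B hπ z = 0 := hz
  have := key z
  rw [hz', map_zero, sub_zero, hdz, map_zero, add_zero] at this
  exact ⟨H z, hH z, this.symm⟩

theorem Acyc.tLeft (hs : Function.Surjective π) (hK : Acyc (LinearMap.ker π.toLinearMap)) :
    Acyc (LinearMap.ker (tLeft B hπ).toLinearMap) := by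
  intro z hz hdz
  obtain ⟨h, h1, h2⟩ := hK.exists_contr (isDId_ker hπ).dd
  let s := linSection hs
  have hsp : ∀ a, a - s (π a) ∈ LinearMap.ker π.toLinearMap := fun a => by
    change π (a - s (π a)) = 0
    rw [map_sub, linSection_spec, sub_self]
  let H : Tens B A →ₗ[ℚ] Tens B A := tMap (eps B).toLinearMap h
  have hH : ∀ z : Tens B A, RHT.tLeft B hπ (H z) = 0 := fun z => by
    induction z using tens_induction with
    | h0 => simp
    | hadd x y hx hy => rw [map_add, map_add, hx, hy, add_zero]
    | htm i j a b ha hb =>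
      rw [tMap_tm, tLeft_tm, show π (h b) = 0 from h1 b, tm_zero]
  let S : Tens B Q →ₗ[ℚ] Tens B A := tMap LinearMap.id s
  have key : ∀ z : Tens B A, Dd _ (H (z - S (RHT.tLeft B hπ z))) +
      H (Dd _ (z - S (RHT.tLeft B hπ z))) = z - S (RHT.tLeft B hπ z) := fun z => by
    induction z using tens_induction with
    | h0 => simp
    | hadd x y hx hy =>
      have : x + y - S (RHT.tLeft B hπ (x + y)) =
          (x - S (RHT.tLeft B hπ x)) + (y - S (RHT.tLeft B hπ y)) := by
        rw [map_add, map_add]; abel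
      rw [this, map_add, map_add, map_add, map_add]
      refine Eq.trans ?_ (congrArg₂ (· + ·) hx hy)
      abel
    | htm i j b a hb ha =>
      rw [tLeft_tm, tMap_tm, LinearMap.id_apply, ← tm_sub]
      generalize hk : a - s (π a) = k
      have hk' := hsp a
      rw [hk] at hk'
      rw [Dd_tm, map_add, tMap_tm, tMap_tm, tMap_tm, Dd_tm]
      simp only [AlgHom.toLinearMap_apply, eps_eps, eps_Dd, neg_tm]
      conv_rhs => rw [← h2 k hk', tm_add]
      abel
  have hz' : RHT.tLeft B hπ z = 0 := hz
  have := key z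
  rw [hz', map_zero, sub_zero, hdz, map_zero, add_zero] at this
  exact ⟨H z, hH z, this.symm⟩

theorem Small.tens (hA : Small A) (hB : Small B) : Small (Tens A B) := by
  obtain ⟨Q, _, π, h1, h2, h3, N, h4⟩ := hA
  obtain ⟨R, _, θ, k1, k2, k3, M, k4⟩ := hB
  refine ⟨Tens Q R, inferInstance, (tLeft Q k1).comp (tRight B h1),
    (tLeft_dga k1).comp (tRight_dga h1), ?_,
    Acyc.comp (tRight_dga h1) (tRight_surj h1 h2) (h3.tRight h1 h2) (k3.tLeft k1 k2),
    N + M, fun i hi q hq => ?_⟩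
  · rw [AlgHom.coe_comp]
    exact (tLeft_surj k1 k2).comp (tRight_surj h1 h2)
  · have key : ∀ n, ∀ z ∈ tGr Q R n, N + M ≤ n → z = 0 := by
      intro n z hz hn
      induction hz using tGr_induction with
      | h0 => rfl
      | hadd x y _ _ hx hy => rw [hx, hy, add_zero]
      | htm i j a b hij ha hb =>
        rcases le_or_gt N i with h | h
        · rw [h4 i h a ha, zero_tm]
        · rw [k4 j (by omega) b hb, tm_zero]
    exact key i q hq hi

end Small

theorem Gens.small {A : Type} [GCDGA A] {n m : ℕ} (G : Gens A n m)
    (hfin : FiniteDimensional ℚ (CohClasses A)) : Small A := by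
  obtain ⟨J, hJ, hac, hle⟩ := G.exists_acyc hfin
  obtain ⟨Q, _, π, h1, h2, h3⟩ := exists_quotient hJ
  obtain ⟨N, hN⟩ := G.gr_le_above m
  refine ⟨Q, _, π, h1, h2, by rwa [h3], N, fun i hi q hq => ?_⟩
  obtain ⟨a, rfl⟩ := h2 q
  have h4 : pr A i a ∈ LinearMap.ker π.toLinearMap := h3 ▸ hle (hN i hi (pr_mem i a))
  have h5 : π.toLinearMap (pr A i a) = pr Q i (π a) := map_pr h1.2 i a
  rw [← pr_same hq, ← h5]
  exact h4

/-- Tensor powers of connected gcdgas exist. -/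
theorem exists_tensorPower {A : Type} [GCDGA A] (hc : Conn A) (hs : Small A) (r : ℕ) :
    ∃ (T : Type) (_ : GCDGA T) (TP : TensorPower A (r + 1) T),
      Algebra.adjoin ℚ (⋃ c, Set.range (TP.ι c)) = ⊤ ∧ Conn T ∧ Small T := by
  induction r with
  | zero =>
    refine ⟨A, inferInstance, ⟨fun _ => AlgHom.id ℚ A, fun _ => isDGAHom_id A,
      fun B _ f hf => ⟨f 0, ⟨hf 0, fun j => ?_⟩, fun g hg => ?_⟩⟩, ?_, hc, hs⟩
    · rw [Fin.fin_one_eq_zero j]; rfl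
    · rw [← hg.2 0]; rfl
    · rw [eq_top_iff]
      exact fun a _ => Algebra.subset_adjoin (Set.mem_iUnion.2 ⟨0, a, rfl⟩)
  | succ r ih =>
    obtain ⟨T, _, TP, h1, h2, h3⟩ := ih
    let ι : Fin (r + 1 + 1) → (A →ₐ[ℚ] Tens T A) :=
      Fin.lastCases (tInr T A) fun c => (tInl T A).comp (TP.ι c)
    have hι1 : ι (Fin.last _) = tInr T A := Fin.lastCases_last
    have hι2 : ∀ c, ι (Fin.castSucc c) = (tInl T A).comp (TP.ι c) := fun c =>
      Fin.lastCases_castSucc c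
    have hcop : ∀ (B : Type) [GCDGA B] (f : Fin (r + 1 + 1) → (A →ₐ[ℚ] B)),
        (∀ j, IsDGAHom (f j)) → ∃! g : Tens T A →ₐ[ℚ] B, IsDGAHom g ∧ ∀ j, g.comp (ι j) = f j := by
      intro B _ f hf
      obtain ⟨g, ⟨hg1, hg2⟩, hg3⟩ := TP.coprod B (fun c => f (Fin.castSucc c)) fun c => hf _
      refine ⟨tHom g (f (Fin.last _)) hg1.gr (hf _).gr, ⟨tHom_dga _ _ hg1 (hf _), fun j => ?_⟩,
        fun g' hg' => tens_algHom_ext (fun a => ?_) fun b => ?_⟩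
      · refine Fin.lastCases ?_ (fun c => ?_) j
        · rw [hι1]
          exact AlgHom.ext fun a => tHom_inr _ _ hg1.gr (hf _).gr _
        · rw [hι2, ← hg2]
          exact AlgHom.ext fun a => tHom_inl _ _ hg1.gr (hf _).gr _
      · rw [tHom_inl]
        have := hg3 (g'.comp (tInl T A)) ⟨hg'.1.comp tInl_dga, fun c => by
          rw [← hg'.2, hι2]; rfl⟩
        exact AlgHom.congr_fun this a
      · rw [tHom_inr, ← hg'.2, hι1]; rfl
    refine ⟨Tens T A, inferInstance, ⟨ι, fun j => ?_, hcop⟩, ?_, h2.tens hc, h3.tens hs⟩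
    · refine Fin.lastCases ?_ (fun c => ?_) j
      · rw [hι1]; exact tInr_dga
      · rw [hι2]; exact tInl_dga.comp (TP.ι_dga c)
    · have h4 := adjoin_tens h1 (show Algebra.adjoin ℚ (Set.univ : Set A) = ⊤ from
        Algebra.adjoin_univ _ _)
      rw [eq_top_iff, ← h4]
      refine Algebra.adjoin_mono (Set.union_subset ?_ ?_)
      · rintro _ ⟨t, ht, rfl⟩
        obtain ⟨c, a, rfl⟩ := Set.mem_iUnion.1 ht
        exact Set.mem_iUnion.2 ⟨Fin.castSucc c, a, AlgHom.congr_fun (hι2 c) a⟩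
      · rintro _ ⟨a, -, rfl⟩
        exact Set.mem_iUnion.2 ⟨Fin.last _, a, AlgHom.congr_fun hι1 a⟩

section Omega

theorem OddDer.mem_adjoin {T : Type} [GCDGA T] {δ : T →ₗ[ℚ] T} (h : OddDer δ) {s : Set T}
    (he : ∀ v ∈ s, eps T v ∈ Algebra.adjoin ℚ s) (hs : ∀ v ∈ s, δ v ∈ Algebra.adjoin ℚ s) {a : T}
    (ha : a ∈ Algebra.adjoin ℚ s) : δ a ∈ Algebra.adjoin ℚ s := by
  have he' : ∀ a ∈ Algebra.adjoin ℚ s, eps T a ∈ Algebra.adjoin ℚ s := fun a ha =>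
    (Algebra.adjoin_le (S := (Algebra.adjoin ℚ s).comap (eps T)) he) ha
  refine Algebra.adjoin_induction hs (fun c => ?_) (fun x y _ _ hx hy => ?_)
    (fun x y hx' hy' hx hy => ?_) ha
  · rw [h.algebraMap]; exact zero_mem _
  · rw [map_add]; exact add_mem hx hy
  · rw [h.mul]; exact add_mem (mul_mem hx hy') (mul_mem (he' _ hx') hy)

theorem list_prod_mem_pow {R : Type*} [Ring R] [Algebra ℚ R] {U : Submodule ℚ R} (l : List R)
    (h : ∀ a ∈ l, a ∈ U) : l.prod ∈ U ^ l.length := by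
  induction l with
  | nil => rw [List.prod_nil, List.length_nil, pow_zero]; exact Submodule.one_le.1 le_rfl
  | cons a l ih =>
    rw [List.prod_cons, List.length_cons, pow_succ']
    exact Submodule.mul_mem_mul (h a List.mem_cons_self)
      (ih fun b hb => h b (List.mem_cons_of_mem _ hb))

/-- A nontrivial class is detected by a closed linear functional concentrated in one degree. -/
theorem exists_functional {A : Type} [GCDGA A] {ω : A} (hne : ∀ e, ω ≠ Dd A e) :
    ∃ N, ∃ φ : A →ₗ[ℚ] ℚ, (∀ a, φ (Dd A a) = 0) ∧ (∀ i, ∀ a ∈ Gr A i, i ≠ N → φ a = 0) ∧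
      φ (pr A N ω) = 1 := by
  obtain ⟨N, hN⟩ : ∃ N, pr A N ω ∉ LinearMap.range (Dd A) := by
    by_contra! h
    obtain ⟨e, he⟩ := mem_of_pr h
    exact hne e he.symm
  obtain ⟨ψ, h1, h2⟩ := Submodule.exists_le_ker_of_notMem hN
  refine ⟨N, (ψ (pr A N ω))⁻¹ • ψ ∘ₗ pr A N, fun a => ?_, fun i a ha hi => ?_, ?_⟩
  · have h3 : pr A N (Dd A a) ∈ LinearMap.range (Dd A) := by
      cases N with
      | zero => rw [pr_zero_Dd]; exact zero_mem _
      | succ N => exact ⟨pr A N a, (pr_Dd N a).symm⟩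
    have h4 : ψ (pr A N (Dd A a)) = 0 := h2 h3
    simp [h4]
  · simp [pr_ne ha hi]
  · simp [pr_same (pr_mem N ω), h1]

namespace Gens

variable {A : Type} [GCDGA A]

section

variable {n m : ℕ} (G : Gens A n m)

theorem adjoin_mem_tens (z : Tens A A) : z ∈ Algebra.adjoin ℚ
    (tInl A A '' (Set.range G.x ∪ Set.range G.y) ∪ tInr A A '' (Set.range G.x ∪ Set.range G.y)) := by
  rw [adjoin_tens G.adjoin G.adjoin]; trivial

theorem forall_tens {P : Tens A A → Prop} (h1 : ∀ a, P (tInl A A a)) (h2 : ∀ i, P (tInr A A (G.x i)))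
    (h3 : ∀ j, P (tInr A A (G.y j))) : ∀ v ∈ tInl A A '' (Set.range G.x ∪ Set.range G.y) ∪
      tInr A A '' (Set.range G.x ∪ Set.range G.y), P v := by
  rintro _ (⟨a, -, rfl⟩ | ⟨v, hv, rfl⟩)
  · exact h1 a
  · exact G.forall_gens (P := fun v => P (tInr A A v)) h2 h3 v hv

/-- The partial derivations on the tensor square, with respect to the second factor and
relative to the diagonal. -/
theorem exists_delta_tens (l : Fin n) : ∃ δ : Tens A A →ₗ[ℚ] Tens A A, OddDer δ ∧
    (∀ a, δ (tInl A A a) = 0) ∧ (∀ i, δ (tInr A A (G.x i)) = 0) ∧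
    ∀ j, δ (tInr A A (G.y j)) = tInr A A (G.a l j) - tInl A A (G.a l j) := by
  let D := DA true (G.kx l)
  have hmem : ∀ j, tm (tInr A A (G.a l j) - tInl A A (G.a l j)) (DA.od 0 : D) ∈
      Gr (Tens (Tens A A) D) (2 * G.ky j + 3) := fun j => by
    rw [sub_tm, ← tRight_tm (B := D) tInr_dga, ← tRight_tm (B := D) tInl_dga]
    exact sub_mem ((tRight_dga _).2 _ _ (G.tm_a_mem l j)) ((tRight_dga _).2 _ _ (G.tm_a_mem l j))
  obtain ⟨f, hf, hx, hy⟩ := G.lift (Tens (Tens A A) D) (fun i => tInl _ _ (tInr A A (G.x i)))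
    (fun j => tInl _ _ (tInr A A (G.y j)) +
      tm (tInr A A (G.a l j) - tInl A A (G.a l j)) (DA.od 0))
    (fun i => tInl_dga.2 _ _ (tInr_dga.2 _ _ (G.x_mem i)))
    (fun j => add_mem (tInl_dga.2 _ _ (tInr_dga.2 _ _ (G.y_mem j))) (hmem j))
  have hl : IsDGAHom ((tInl (Tens A A) D).comp (tInl A A)) := tInl_dga.comp tInl_dga
  let Φ := tHom ((tInl (Tens A A) D).comp (tInl A A)) f hl.gr hf
  have hΦ1 : ∀ a, Φ (tInl A A a) = tm (tInl A A a) 1 := fun a => tHom_inl _ _ hl.gr hf a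
  have hΦ2 : ∀ a, Φ (tInr A A a) = f a := fun a => tHom_inr _ _ hl.gr hf a
  have hid : ∀ z, tAug (Tens A A) true (G.kx l) (Φ z) = z := fun z =>
    AlgHom.congr_fun (tens_algHom_ext (f := (tAug (Tens A A) true (G.kx l)).comp Φ)
      (g := AlgHom.id ℚ _) (fun a => by
        rw [AlgHom.comp_apply, hΦ1, ← tInl_apply, tAug_inl]; rfl)
      (fun b => by
        rw [AlgHom.comp_apply, hΦ2]
        exact AlgHom.congr_fun (G.hom_ext (f := (tAug (Tens A A) true (G.kx l)).comp f)
          (g := tInr A A) (fun i => by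
            rw [AlgHom.comp_apply, hx]; exact tAug_inl ..) fun j => by
            rw [AlgHom.comp_apply, hy, map_add, tAug_tm, DA.aug_od, zero_smul, add_zero]
            exact tAug_inl ..) b)) z
  obtain ⟨δ, h1, h2⟩ := exists_oddDer (tHom_gr _ _ hl.gr hf) hid
  refine ⟨δ, h1, fun a => ?_, fun i => ?_, fun j => ?_⟩
  · rw [h2 _ 0 (by rw [hΦ1, zero_tm, add_zero]), map_zero]
  · rw [h2 _ 0 (by rw [hΦ2, hx, zero_tm, add_zero, tInl_apply]), map_zero]
  · rw [h2 _ _ (by rw [hΦ2, hy, tInl_apply]), map_sub, ← map_sc tInr_dga.2, ← map_sc tInl_dga.2, G.eps_a]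

end

variable (A) in
/-- The multiplication as a morphism of gcdgas. -/
def mul₂ : Tens A A →ₐ[ℚ] A :=
  tHom (AlgHom.id ℚ A) (AlgHom.id ℚ A) (isDGAHom_id A).gr (isDGAHom_id A).gr

theorem mul₂_dga : IsDGAHom (mul₂ A) := tHom_dga _ _ (isDGAHom_id A) (isDGAHom_id A)

theorem mul₂_inl (a : A) : mul₂ A (tInl A A a) = a := tHom_inl _ _ (isDGAHom_id A).gr (isDGAHom_id A).gr a
theorem mul₂_inr (a : A) : mul₂ A (tInr A A a) = a := tHom_inr _ _ (isDGAHom_id A).gr (isDGAHom_id A).gr a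

/-- The fundamental zero divisor of weight `m`. -/
theorem exists_omega {n m : ℕ} (G : Gens A n m) (hfin : FiniteDimensional ℚ (CohClasses A)) :
    ∃ (η : A →ₐ[ℚ] A) (hη : IsGrHom η) (N : ℕ) (φ : A →ₗ[ℚ] ℚ) (Ω : Tens A A),
      (∀ a, ∃ c : ℚ, η a = algebraMap ℚ A c) ∧
      (∀ a, φ (Dd A a) = 0) ∧ (∀ i, ∀ a ∈ Gr A i, i ≠ N → φ a = 0) ∧
      Ω ∈ LinearMap.ker (mul₂ A).toLinearMap ^ m ∧ Dd _ Ω = 0 ∧ Ω ∈ Gr (Tens A A) N ∧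
      φ (tHom η (AlgHom.id ℚ A) hη (isDGAHom_id A).gr Ω) = 1 := by
  obtain ⟨η, hη, hηx, hηy⟩ := G.lift A 0 0 (fun _ => zero_mem _) (fun _ => zero_mem _)
  simp only [Pi.zero_apply] at hηx hηy
  obtain ⟨δ, hδ⟩ := G.exists_isPartial
  choose δ' h1 h2 h3 h4 using G.exists_delta_tens
  let I := LinearMap.ker (mul₂ A).toLinearMap
  have hI : IsDId I := isDId_ker mul₂_dga
  have hδI : ∀ l z, δ' l z ∈ I := fun l z => by
    change mul₂ A (δ' l z) = 0
    rw [(h1 l).ext_hom (OddDer.zero (A := A)) mul₂_dga.gr (G.forall_tens (fun a => ?_) (fun i => ?_)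
      fun j => ?_) (G.adjoin_mem_tens z)]
    · rfl
    · rw [h2, map_zero]; rfl
    · rw [h3, map_zero]; rfl
    · rw [h4, map_sub, mul₂_inl, mul₂_inr, sub_self]; rfl
  have hδp : ∀ l p, ∀ z ∈ I ^ p, δ' l z ∈ I ^ p := fun l p =>
    (h1 l).map_pow (fun u hu => hI.homog.sc _ hu) (s := 0)
      (fun u _ => by rw [add_zero, pow_one]; exact hδI l u) p
  have ha : ∀ k l j, δ' k (tInr A A (G.a l j)) = 0 := fun k l j => by simp [Gens.a, h3]
  have hanti : ∀ k l z, δ' k (δ' l z) = -δ' l (δ' k z) := fun k l z =>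
    eq_neg_of_add_eq_zero_left ((h1 k).anticomm (h1 l) (adjoin_tens G.adjoin G.adjoin)
      (G.forall_tens (fun a => by simp [h2]) (fun i => by simp [h3])
        fun j => by simp [h4, ha, h2]) z)
  let Y : Fin m → Tens A A := fun j => tInr A A (G.y j) - tInl A A (G.y j)
  let u : Fin n → Tens A A := fun i => tInr A A (G.x i) - tInl A A (G.x i)
  let s : Fin n → Tens A A := fun i => tInr A A (G.x i) + tInl A A (G.x i)
  have hau : ∀ l j, tInr A A (G.a l j) - tInl A A (G.a l j) = ∑ k, G.B j l k • u k := fun l j => by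
    simp only [Gens.a, map_sum, map_smul, ← Finset.sum_sub_distrib, ← smul_sub, u]
  have hδY : ∀ l j, δ' l (Y j) = ∑ k, G.B j l k • u k := fun l j => by
    simp only [Y, map_sub, h4, h2, sub_zero, hau]
  have hδu : ∀ l i, δ' l (u i) = 0 := fun l i => by simp only [u, map_sub, h3, h2, sub_zero]
  let S : Set (Tens A A) := Set.range u ∪ Set.range Y
  have huS : ∀ i, u i ∈ Algebra.adjoin ℚ S := fun i => Algebra.subset_adjoin (Or.inl ⟨i, rfl⟩)
  have hYS : ∀ j, Y j ∈ Algebra.adjoin ℚ S := fun j => Algebra.subset_adjoin (Or.inr ⟨j, rfl⟩)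
  have hsev : ∀ i, s i ∈ Gr (Tens A A) (2 * G.kx i + 2) := fun i =>
    add_mem (tInr_dga.2 _ _ (G.x_mem i)) (tInl_dga.2 _ _ (G.x_mem i))
  have hu_mem : ∀ i, u i ∈ Gr (Tens A A) (2 * G.kx i + 2) := fun i =>
    sub_mem (tInr_dga.2 _ _ (G.x_mem i)) (tInl_dga.2 _ _ (G.x_mem i))
  have hY_mem : ∀ j, Y j ∈ Gr (Tens A A) (2 * G.ky j + 3) := fun j =>
    sub_mem (tInr_dga.2 _ _ (G.y_mem j)) (tInl_dga.2 _ _ (G.y_mem j))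
  have hdd : ∀ z ∈ Algebra.adjoin ℚ S, Dd _ z = ∑ l, s l * δ' l z := fun z hz => by
    rw [OddDer.dd.ext_mem (OddDer.sum Finset.univ s (fun i => ⟨G.kx i + 1, by ring⟩) hsev h1)
      ?_ hz]
    · simp
    · rintro _ (⟨i, rfl⟩ | ⟨j, rfl⟩)
      · simp [hδu, u, ← tInr_dga.1, ← tInl_dga.1, G.dx]
      · simp only [LinearMap.sum_apply, LinearMap.comp_apply, LinearMap.mulLeft_apply, hδY]
        simp only [Y, map_sub, ← tInr_dga.1, ← tInl_dga.1, G.dy, map_sum, map_smul, map_mul, u, s,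
          Finset.mul_sum, mul_smul_comm]
        have hx : ∀ l k, (tInr A A (G.x l) + tInl A A (G.x l)) * (tInr A A (G.x k) - tInl A A (G.x k)) =
          (tInr A A (G.x l) * tInr A A (G.x k) - tInl A A (G.x l) * tInl A A (G.x k)) +
            (tInl A A (G.x l) * tInr A A (G.x k) - tInr A A (G.x l) * tInl A A (G.x k)) :=
          fun l k => by noncomm_ring
        simp only [hx, smul_add, smul_sub, Finset.sum_add_distrib, Finset.sum_sub_distrib]
        rw [eq_comm, add_eq_left, sub_eq_zero, Finset.sum_comm]
        refine Finset.sum_congr rfl fun k _ => Finset.sum_congr rfl fun l _ => ?_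
        rw [G.B_symm, mul_comm_even ⟨G.kx l + 1, by ring⟩ (tInl_dga.2 _ _ (G.x_mem l))]
  have hδS : ∀ l, ∀ z ∈ Algebra.adjoin ℚ S, δ' l z ∈ Algebra.adjoin ℚ S := fun l z hz =>
    (h1 l).mem_adjoin
      (by
        rintro _ (⟨i, rfl⟩ | ⟨j, rfl⟩)
        · rw [sc_apply _ (hu_mem i)]; exact Subalgebra.smul_mem _ (huS i) _
        · rw [sc_apply _ (hY_mem j)]; exact Subalgebra.smul_mem _ (hYS j) _)
      (by
        rintro _ (⟨i, rfl⟩ | ⟨j, rfl⟩)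
        · rw [hδu]; exact zero_mem _
        · rw [hδY]; exact sum_mem fun k _ => Subalgebra.smul_mem _ (huS k) _) hz
  have hw : (List.ofFn Y).prod ∈ I ^ m := by
    simpa using list_prod_mem_pow (U := I) (List.ofFn Y) fun a ha => by
      obtain ⟨j, rfl⟩ := List.mem_ofFn.1 ha
      change mul₂ A (tInr A A (G.y j) - tInl A A (G.y j)) = 0
      rw [map_sub, mul₂_inl, mul₂_inr, sub_self]
  have hwS : (List.ofFn Y).prod ∈ Algebra.adjoin ℚ S := list_prod_mem fun a ha => by
    obtain ⟨j, rfl⟩ := List.mem_ofFn.1 ha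
    exact hYS j
  let Ω₀ := iterD δ' (List.ofFn Y).prod n
  have hΩI : Ω₀ ∈ I ^ m := iterD_mem δ' _ (fun l => hδp l m) hw n
  have hΩS : Ω₀ ∈ (Algebra.adjoin ℚ S).toSubmodule := iterD_mem δ' _ hδS hwS n
  have hdΩ : Dd _ Ω₀ = 0 := by
    rw [hdd _ hΩS]
    exact Finset.sum_eq_zero fun l _ => by rw [iterD_killed δ' _ hanti l n l.2, mul_zero]
  let ρ := tHom η (AlgHom.id ℚ A) hη (isDGAHom_id A).gr
  have hρg : IsGrHom ρ := tHom_gr _ _ _ _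
  have hρ1 : ∀ a, ρ (tInl A A a) = η a := fun a => tHom_inl _ _ hη (isDGAHom_id A).gr a
  have hρ2 : ∀ a, ρ (tInr A A a) = a := fun a => tHom_inr _ _ hη (isDGAHom_id A).gr a
  have hηa : ∀ l j, η (G.a l j) = 0 := fun l j => by simp [Gens.a, hηx]
  have hηδ : ∀ l a, δ l (η a) = 0 := fun l a => by
    have := OddDer.ext_hom (OddDer.zero (A := A)) (hδ.odd l) hη (G.forall_gens
      (P := fun v => η ((0 : A →ₗ[ℚ] A) v) = δ l (η v)) (fun i => by simp [hηx]) fun j => by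
        simp [hηy]) (G.mem_adjoin a)
    simpa using this.symm
  have hρδ : ∀ l z, ρ (δ' l z) = δ l (ρ z) := fun l z =>
    (h1 l).ext_hom (hδ.odd l) hρg (G.forall_tens (P := fun v => ρ (δ' l v) = δ l (ρ v))
      (fun a => by rw [h2, hρ1, hηδ, map_zero])
      (fun i => by rw [h3, hρ2, hδ.x, map_zero])
      fun j => by rw [h4, map_sub, hρ2, hρ1, hρ2, hηa, hδ.y, sub_zero]) (G.adjoin_mem_tens z)
  have hρΩ : ρ Ω₀ = iterD δ (List.ofFn G.y).prod n := by
    have := map_iterD δ' (List.ofFn Y).prod (f := ρ.toLinearMap) hρδ n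
    refine this.trans (congrArg (fun w => iterD δ w n) ?_)
    rw [AlgHom.toLinearMap_apply, map_list_prod, List.map_ofFn]
    congr 2
    funext j
    simp [Y, hρ1, hρ2, hηy]
  obtain ⟨N, φ, k1, k2, k3⟩ := exists_functional (hδ.top hfin).2
  have hηc : ∀ a, ∃ c : ℚ, η a = algebraMap ℚ A c := fun a => by
    have h : Algebra.adjoin ℚ (Set.range G.x ∪ Set.range G.y) ≤
        (⊥ : Subalgebra ℚ A).comap η := Algebra.adjoin_le (by
      rintro _ (⟨i, rfl⟩ | ⟨j, rfl⟩)
      · change η _ ∈ (⊥ : Subalgebra ℚ A); rw [hηx]; exact zero_mem _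
      · change η _ ∈ (⊥ : Subalgebra ℚ A); rw [hηy]; exact zero_mem _)
    obtain ⟨c, hc⟩ := Algebra.mem_bot.1 (h (G.mem_adjoin a))
    exact ⟨c, hc.symm⟩
  refine ⟨η, hη, N, φ, pr _ N Ω₀, hηc, k1, k2, hI.homog.pow m N _ hΩI, ?_, pr_mem _ _, ?_⟩
  · rw [← pr_Dd, hdΩ, map_zero]
  · have : ρ (pr _ N Ω₀) = pr A N (ρ Ω₀) := map_pr (f := ρ.toLinearMap) hρg N Ω₀
    change φ (ρ (pr _ N Ω₀)) = 1
    rw [this, hρΩ]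
    exact k3

end Gens

end Omega

section Stage

/-- The data of a lifting problem: a morphism of differential `T`-modules `θ` to be lifted through
the surjective quasi-isomorphism `π`, with prescribed value `Ω` at `1`. -/
structure LiftData (T Q P R : Type) [GCDGA T] [GCDGA Q] [GCDGA P] [GCDGA R] where
  ρ : T →ₐ[ℚ] Q
  β : T →ₐ[ℚ] P
  π : P →ₐ[ℚ] R
  θ : Q →ₗ[ℚ] R
  Ω : P
  ρ_dga : IsDGAHom ρ
  β_dga : IsDGAHom β
  π_dga : IsDGAHom π
  π_surj : Function.Surjective π
  acyc : Acyc (LinearMap.ker π.toLinearMap)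
  Dd_Ω : Dd P Ω = 0
  θ_mul : ∀ t c, θ (ρ t * c) = π (β t) * θ c
  θ_one : θ 1 = π Ω
  θ_Dd : ∀ c, θ (Dd Q c) = Dd R (θ c)
  nt : (1 : Q) ≠ 0

variable {T Q P R C : Type} [GCDGA T] [GCDGA Q] [GCDGA P] [GCDGA R] [GCDGA C]

namespace LiftData

variable (E : LiftData T Q P R)

/-- Linearity, up to the sign rule given by `σ`, with respect to the elements of `S`. -/
def SLin (S : Set T) (j : T →ₐ[ℚ] C) (σ : ℚ) (f : C →ₗ[ℚ] P) : Prop :=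
  ∀ s ∈ S, ∀ c, f (j s * c) = E.β (sc T σ s) * f c

variable {E}

theorem SLin.sub {S : Set T} {j : T →ₐ[ℚ] C} {σ : ℚ} {f g : C →ₗ[ℚ] P} (hf : E.SLin S j σ f)
    (hg : E.SLin S j σ g) : E.SLin S j σ (f - g) := fun s hs c => by
  rw [LinearMap.sub_apply, hf s hs, hg s hs, LinearMap.sub_apply, mul_sub]

theorem SLin.smul {S : Set T} {j : T →ₐ[ℚ] C} {σ : ℚ} {f : C →ₗ[ℚ] P} (hf : E.SLin S j σ f)
    (a : ℚ) : E.SLin S j σ (a • f) := fun s hs c => by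
  rw [LinearMap.smul_apply, hf s hs, LinearMap.smul_apply, mul_smul_comm]

theorem SLin.comp_eps {S : Set T} {j : T →ₐ[ℚ] C} {σ : ℚ} {f : C →ₗ[ℚ] P} (hj : IsDGAHom j)
    (hS : ∀ s ∈ S, ∃ i, s ∈ Gr T i) (hf : E.SLin S j σ f) :
    E.SLin S j (-σ) (f ∘ₗ (eps C).toLinearMap) := fun s hs c => by
  obtain ⟨i, hi⟩ := hS s hs
  simp only [LinearMap.comp_apply, AlgHom.toLinearMap_apply, map_mul, ← map_sc hj.2]
  rw [sc_apply _ hi, sc_apply _ hi, map_smul, smul_mul_assoc, map_smul, hf s hs, sc_apply _ hi,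
    map_smul, map_smul, smul_mul_assoc, smul_mul_assoc, smul_smul, ← mul_pow, neg_one_mul]

theorem SLin.adjoin {S : Set T} {j : T →ₐ[ℚ] C} {σ : ℚ} {f : C →ₗ[ℚ] P} (hf : E.SLin S j σ f) :
    E.SLin (Algebra.adjoin ℚ S : Set T) j σ f := fun a ha => by
  refine Algebra.adjoin_induction (fun s hs c => hf s hs c) (fun r c => ?_)
    (fun x y _ _ hx hy c => ?_) (fun x y _ _ hx hy c => ?_) ha
  · rw [AlgHom.commutes, AlgHom.commutes, AlgHom.commutes, ← Algebra.smul_def, map_smul, ← Algebra.smul_def]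
  · rw [map_add, add_mul, map_add, hx, hy, map_add, map_add, add_mul]
  · rw [map_mul j, mul_assoc, hx, hy, map_mul (sc T σ), map_mul E.β, mul_assoc]

/-- The defect of linearity of `g` with respect to a pair of elements. -/
def twist (w : P) (u : C) : (C →ₗ[ℚ] P) →ₗ[ℚ] (C →ₗ[ℚ] P) where
  toFun g := LinearMap.mulLeft ℚ w ∘ₗ g - g ∘ₗ LinearMap.mulLeft ℚ u
  map_add' f g := by ext c; simp [mul_add]; abel
  map_smul' a g := by ext c; simp [smul_sub]

theorem twist_apply (w : P) (u : C) (g : C →ₗ[ℚ] P) (c : C) : twist w u g c = w * g c - g (u * c) := rfl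

variable (E) in
/-- A partial solution of the lifting problem, linear with respect to `S`, together with the
solvability of the homotopy problem. -/
structure Stage (S : Set T) (C : Type) [GCDGA C] where
  q : C →ₐ[ℚ] Q
  j : T →ₐ[ℚ] C
  φ : C →ₗ[ℚ] P
  q_dga : IsDGAHom q
  j_dga : IsDGAHom j
  q_surj : Function.Surjective q
  q_quasi : QuasiIso q
  hqj : ∀ t, q (j t) = E.ρ t
  φ_lin : E.SLin S j 1 φ
  φ_one : φ 1 = E.Ω
  φ_π : ∀ c, E.π (φ c) = E.θ (q c)
  solve : ∀ σ : ℚ, σ * σ = 1 → ∀ f : C →ₗ[ℚ] P, (∀ c, E.π (f c) = 0) → E.SLin S j σ f →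
    (∀ c, Dd P (f c) = σ • f (Dd C c)) → ∃ g : C →ₗ[ℚ] P, (∀ c, E.π (g c) = 0) ∧
      E.SLin S j (-σ) g ∧ (∀ c, Dd P (g c) + σ • g (Dd C c) = f c) ∧ (f 1 = 0 → g 1 = 0)

variable (E) in
theorem stage_empty : Nonempty (E.Stage ∅ Q) := by
  obtain ⟨h, h1, h2⟩ := E.acyc.exists_contr (isDId_ker E.π_dga).dd
  obtain ⟨l, hl⟩ : ∃ l : Q →ₗ[ℚ] ℚ, l 1 = 1 := by
    by_contra! H
    refine E.nt ((Module.forall_dual_apply_eq_zero_iff ℚ (1 : Q)).1 fun l => ?_)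
    by_contra hl
    exact H ((l 1)⁻¹ • l) (by rw [LinearMap.smul_apply, smul_eq_mul, inv_mul_cancel₀ hl])
  let s := linSection E.π_surj
  have hs : ∀ r, E.π (s r) = r := linSection_spec E.π_surj
  refine ⟨{
    q := AlgHom.id ℚ Q
    j := E.ρ
    φ := s ∘ₗ E.θ + l.smulRight (E.Ω - s (E.θ 1))
    q_dga := isDGAHom_id Q
    j_dga := E.ρ_dga
    q_surj := Function.surjective_id
    q_quasi := ⟨fun b hb => ⟨b, hb, 0, by simp⟩, fun a _ h => h⟩
    hqj := fun t => rfl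
    φ_lin := fun s hs => hs.elim
    φ_one := by simp [hl]
    φ_π := fun c => by simp [hs, E.θ_one]
    solve := fun σ hσ f hf _ hd => ⟨h ∘ₗ f, fun c => h1 _, fun s hs => hs.elim, fun c => ?_, fun h => by simp [h]⟩ }⟩
  have := h2 (f c) (hf c)
  rwa [hd, map_smul] at this

variable {t : Bool} {k : ℕ}

/-- The linear map out of `C ⊗ D` with prescribed components. -/
def asm (F G : ℕ → (C →ₗ[ℚ] P)) : Tens C (DA t k) →ₗ[ℚ] P := tLift (DA.lin F G).flip

@[simp] theorem asm_ev (F G : ℕ → (C →ₗ[ℚ] P)) (c : C) (n : ℕ) :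
    asm (t := t) (k := k) F G (tm c (DA.ev n)) = F n c := by
  rw [asm, tLift_tm, LinearMap.flip_apply, DA.lin_ev]

@[simp] theorem asm_od (F G : ℕ → (C →ₗ[ℚ] P)) (c : C) (n : ℕ) :
    asm (t := t) (k := k) F G (tm c (DA.od n)) = G n c := by
  rw [asm, tLift_tm, LinearMap.flip_apply, DA.lin_od]

end LiftData

end Stage

section StageEven

namespace LiftData

variable {T Q P R C : Type} [GCDGA T] [GCDGA Q] [GCDGA P] [GCDGA R] [GCDGA C]
  {E : LiftData T Q P R} {S : Set T} {k : ℕ}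

theorem sc_of_even {i : ℕ} (hi : Even i) {v : T} (hv : v ∈ Gr T i) {σ : ℚ} (hσ : σ * σ = 1) :
    sc T σ v = v := by
  obtain ⟨l, rfl⟩ := hi
  rw [sc_apply σ hv, ← two_mul, pow_mul, pow_two, hσ, one_pow, one_smul]

theorem SLin.twist_even {j : T →ₐ[ℚ] C} {σ : ℚ} {f : C →ₗ[ℚ] P} (hf : E.SLin S j σ f) {i : ℕ}
    (hi : Even i) {v : T} (hv : v ∈ Gr T i) : E.SLin S j σ (twist (E.β v) (j v) f) := fun s hs c => by
  rw [twist_apply, twist_apply, hf s hs, ← mul_assoc (j v), ← map_mul j, mul_comm_even hi hv s,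
    map_mul j, mul_assoc, hf s hs, ← mul_assoc, ← map_mul, mul_comm_even hi hv, map_mul, mul_assoc,
    mul_sub]

/-- Two linear maps compatible with `v' = v ⊗ 1 + 1 ⊗ e` agree if they agree on `1` and `o`. -/
theorem eq_of_even {w : P} {u : C} {f g : Tens C (DA true k) →ₗ[ℚ] P}
    (hf : ∀ z, f ((tm u 1 + tm 1 (DA.ev 1)) * z) = w * f z)
    (hg : ∀ z, g ((tm u 1 + tm 1 (DA.ev 1)) * z) = w * g z)
    (h1 : ∀ c, f (tm c 1) = g (tm c 1)) (h2 : ∀ c, f (tm c (DA.od 0)) = g (tm c (DA.od 0))) :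
    f = g := by
  have key : ∀ (f : Tens C (DA true k) →ₗ[ℚ] P),
      (∀ z, f ((tm u 1 + tm 1 (DA.ev 1)) * z) = w * f z) → ∀ c b,
      f (tm c (DA.ev 1 * b)) = w * f (tm c b) - f (tm (u * c) b) := fun f hf c b => by
    rw [← hf, add_mul, tm_mul_one_left, tm_ev_mul, one_mul, map_add, add_sub_cancel_left]
  refine tensDA_ext (fun c n => ?_) fun c n => ?_
  · induction n generalizing c with
    | zero => rw [DA.ev_zero, h1]
    | succ n ih => rw [add_comm, ← DA.ev_mul_ev, key f hf, key g hg, ih, ih]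
  · induction n generalizing c with
    | zero => exact h2 c
    | succ n ih => rw [add_comm, ← DA.ev_mul_od, key f hf, key g hg, ih, ih]

theorem asm_even (w : P) (u : C) (f g : C →ₗ[ℚ] P) (z : Tens C (DA true k)) :
    asm (fun n => (twist w u ^ n) f) (fun n => (twist w u ^ n) g) ((tm u 1 + tm 1 (DA.ev 1)) * z) =
      w * asm (fun n => (twist w u ^ n) f) (fun n => (twist w u ^ n) g) z := by
  have key : ∀ (f : C →ₗ[ℚ] P) c n, (twist w u ^ n) f (u * c) + (twist w u ^ (1 + n)) f c =
      w * (twist w u ^ n) f c := fun f c n => by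
    rw [pow_add, pow_one, Module.End.mul_apply, twist_apply]; abel
  refine LinearMap.congr_fun (tensDA_ext
    (f := asm (fun n => (twist w u ^ n) f) (fun n => (twist w u ^ n) g) ∘ₗ
      LinearMap.mulLeft ℚ (tm u 1 + tm 1 (DA.ev 1)))
    (g := LinearMap.mulLeft ℚ w ∘ₗ asm (fun n => (twist w u ^ n) f) (fun n => (twist w u ^ n) g))
    (fun c n => ?_) fun c n => ?_) z
  · simp only [LinearMap.comp_apply, LinearMap.mulLeft_apply, add_mul, tm_mul_one_left, tm_ev_mul,
      one_mul, DA.ev_mul_ev, map_add, asm_ev, key]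
  · simp only [LinearMap.comp_apply, LinearMap.mulLeft_apply, add_mul, tm_mul_one_left, tm_ev_mul,
      one_mul, DA.ev_mul_od, map_add, asm_od, key]

theorem π_twist {w : P} {u : C} {f : C →ₗ[ℚ] P} (hf : ∀ c, E.π (f c) = 0) (c : C) :
    E.π (twist w u f c) = 0 := by
  rw [twist_apply, map_sub, map_mul, hf, hf, mul_zero, sub_zero]

theorem π_twist_pow {w : P} {u : C} {f : C →ₗ[ℚ] P} (hf : ∀ c, E.π (f c) = 0) (n : ℕ) :
    ∀ c, E.π ((twist w u ^ n) f c) = 0 := by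
  induction n with
  | zero => exact hf
  | succ n ih => rw [pow_succ', Module.End.mul_apply]; exact π_twist ih

theorem SLin.twist_pow_even {j : T →ₐ[ℚ] C} {σ : ℚ} {f : C →ₗ[ℚ] P} (hf : E.SLin S j σ f) {i : ℕ}
    (hi : Even i) {v : T} (hv : v ∈ Gr T i) (n : ℕ) :
    E.SLin S j σ ((twist (E.β v) (j v) ^ n) f) := by
  induction n with
  | zero => exact hf
  | succ n ih => rw [pow_succ', Module.End.mul_apply]; exact ih.twist_even hi hv

theorem π_asm {t : Bool} {F G : ℕ → (C →ₗ[ℚ] P)} (hF : ∀ n c, E.π (F n c) = 0) (hG : ∀ n c, E.π (G n c) = 0)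
    (z : Tens C (DA t k)) : E.π (asm F G z) = 0 :=
  LinearMap.congr_fun (tensDA_ext (f := E.π.toLinearMap ∘ₗ asm F G) (g := 0)
    (fun c n => by simp [hF]) (fun c n => by simp [hG])) z

theorem SLin.asm {t : Bool} {j : T →ₐ[ℚ] C} {j' : T →ₐ[ℚ] Tens C (DA t k)} {σ : ℚ}
    (hS : ∀ s ∈ S, j' s = tm (j s) 1) {F G : ℕ → (C →ₗ[ℚ] P)} (hF : ∀ n, E.SLin S j σ (F n))
    (hG : ∀ n, E.SLin S j σ (G n)) : E.SLin S j' σ (asm F G) := fun s hs z => by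
  rw [hS s hs]
  exact LinearMap.congr_fun (tensDA_ext
    (f := LiftData.asm F G ∘ₗ LinearMap.mulLeft ℚ (tm (j s) 1))
    (g := LinearMap.mulLeft ℚ (E.β (sc T σ s)) ∘ₗ LiftData.asm F G)
    (fun c n => by simp [tm_mul_one_left, hF n s hs])
    (fun c n => by simp [tm_mul_one_left, hG n s hs])) z

/-- The restriction of a linear map on `C ⊗ D` to `C ⊗ b`. -/
def coeff {t : Bool} (f : Tens C (DA t k) →ₗ[ℚ] P) (b : DA t k) : C →ₗ[ℚ] P := f ∘ₗ tmL.flip b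

theorem coeff_apply {t : Bool} (f : Tens C (DA t k) →ₗ[ℚ] P) (b : DA t k) (c : C) :
    coeff f b c = f (tm c b) := rfl

theorem SLin.coeff {t : Bool} {j : T →ₐ[ℚ] C} {j' : T →ₐ[ℚ] Tens C (DA t k)} {σ : ℚ}
    (hS : ∀ s ∈ S, j' s = tm (j s) 1) {f : Tens C (DA t k) →ₗ[ℚ] P} (hf : E.SLin S j' σ f)
    (b : DA t k) : E.SLin S j σ (LiftData.coeff f b) := fun s hs c => by
  rw [coeff_apply, coeff_apply, ← hf s hs, hS s hs, tm_mul_one_left]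

theorem Stage.extend_even (st : E.Stage S C) (hSh : ∀ s ∈ S, ∃ i, s ∈ Gr T i) {i : ℕ} (hi : Even i)
    {v : T} (hv : v ∈ Gr T i) (hdv : Dd T v = 0) (j' : T →ₐ[ℚ] Tens C (DA true k))
    (hj' : IsDGAHom j') (haug : ∀ t, tAug C true k (j' t) = st.j t)
    (hS : ∀ s ∈ S, j' s = tm (st.j s) 1) (hjv : j' v = tm (st.j v) 1 + tm 1 (DA.ev 1)) :
    Nonempty (E.Stage (insert v S) (Tens C (DA true k))) := by
  let M := twist (E.β v) (st.j v)
  have hMφ : ∀ c, E.π (M st.φ c) = 0 := fun c => by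
    rw [twist_apply, map_sub, map_mul, st.φ_π, st.φ_π, map_mul, st.hqj, E.θ_mul, sub_self]
  have hsv : ∀ σ : ℚ, σ * σ = 1 → sc T σ v = v := fun σ hσ => sc_of_even hi hv hσ
  have hepsβ : eps P (E.β v) = E.β v := by rw [← map_sc E.β_dga.2, hsv _ (by norm_num)]
  have hdj : ∀ c, Dd C (st.j v * c) = st.j v * Dd C c := fun c => by
    rw [leibniz, ← map_sc st.j_dga.2, hsv _ (by norm_num), ← st.j_dga.1, hdv, map_zero, zero_mul,
      zero_add]
  have hdβ : ∀ c, Dd P (E.β v * c) = E.β v * Dd P c := fun c => by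
    rw [leibniz, hepsβ, ← E.β_dga.1, hdv, map_zero, zero_mul, zero_add]
  have hdj' : ∀ z, Dd _ (j' v * z) = j' v * Dd _ z := fun z => by
    rw [leibniz, ← map_sc hj'.2, hsv _ (by norm_num), ← hj'.1, hdv, map_zero, zero_mul, zero_add]
  refine ⟨{
    q := st.q.comp (tAug C true k)
    j := j'
    φ := asm (fun n => (M ^ n) st.φ) fun n => (M ^ n) 0
    q_dga := st.q_dga.comp tAug_dga
    j_dga := hj'
    q_surj := st.q_surj.comp tAug_surj
    q_quasi := st.q_quasi.comp tAug_quasi st.q_dga tAug_dga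
    hqj := fun t => by rw [AlgHom.comp_apply, haug, st.hqj]
    φ_lin := ?_
    φ_one := ?_
    φ_π := ?_
    solve := ?_ }⟩
  · rintro s (rfl | hs) z
    · rw [hjv, asm_even, hsv _ (by norm_num)]
    · exact SLin.asm hS (fun n => st.φ_lin.twist_pow_even hi hv n) (fun n s hs c => by simp) s hs z
  · rw [one_tens, ← DA.ev_zero, asm_ev, pow_zero]; exact st.φ_one
  · refine LinearMap.congr_fun (tensDA_ext (f := E.π.toLinearMap ∘ₗ asm (fun n => (M ^ n) st.φ) fun n => (M ^ n) 0)
      (g := E.θ ∘ₗ (st.q.comp (tAug C true k)).toLinearMap) (fun c n => ?_) fun c n => ?_)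
    · cases n with
      | zero => simp [tAug_tm, DA.aug_ev, st.φ_π]
      | succ n =>
        simp only [LinearMap.comp_apply, AlgHom.toLinearMap_apply, asm_ev, AlgHom.comp_apply, tAug_tm,
          DA.aug_ev, if_neg n.succ_ne_zero, zero_smul, map_zero]
        rw [pow_succ, Module.End.mul_apply]
        exact π_twist_pow hMφ n c
    · simp [tAug_tm, DA.aug_od]
  · intro σ hσ f hf hfS hfd
    have hfv : ∀ z, f ((tm (st.j v) 1 + tm 1 (DA.ev 1)) * z) = E.β v * f z := fun z => by
      rw [← hjv, hfS v (Set.mem_insert _ _), hsv σ hσ]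
    have hfS' : E.SLin S j' σ f := fun s hs => hfS s (Set.mem_insert_of_mem _ hs)
    obtain ⟨g₀, g₀π, g₀S, g₀d, g₀1⟩ := st.solve σ hσ (coeff f 1) (fun c => hf _) (hfS'.coeff hS _)
      fun c => by rw [coeff_apply, hfd, Dd_tm, Dd_one, tm_zero, add_zero, coeff_apply]
    have hMf : ∀ c, M (coeff f 1) c = f (tm c (DA.ev 1)) := fun c => by
      rw [twist_apply, coeff_apply, coeff_apply, ← hfv, add_mul, tm_mul_one_left, tm_ev_mul]
      simp
    have hMd : ∀ c, Dd P (M g₀ c) + σ • M g₀ (Dd C c) = M (coeff f 1) c := fun c => by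
      simp only [M, twist_apply, map_sub, hdβ, ← g₀d, mul_add, smul_sub, mul_smul_comm, hdj]
      abel
    have hMg : ∀ c, E.π (M g₀ c) = 0 := π_twist g₀π
    have hσ' : -σ * -σ = 1 := by rw [neg_mul_neg, hσ]
    obtain ⟨g₁, g₁π, g₁S, g₁d, -⟩ := st.solve σ hσ
      (coeff f (DA.od 0) - σ • (M g₀ ∘ₗ (eps C).toLinearMap))
      (fun c => by
        simp only [LinearMap.sub_apply, LinearMap.smul_apply, map_sub, map_smul, coeff_apply, hf,
          LinearMap.comp_apply, hMg, smul_zero, sub_zero])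
      ((hfS'.coeff hS _).sub (by
        have := ((g₀S.twist_even hi hv).comp_eps st.j_dga hSh).smul σ
        rwa [neg_neg] at this))
      fun c => by
        simp only [LinearMap.sub_apply, LinearMap.smul_apply, map_sub, map_smul, coeff_apply, hfd,
          LinearMap.comp_apply, AlgHom.toLinearMap_apply, Dd_tm, DA.Dd1_od, map_add, zero_add, ← hMf,
          smul_sub, smul_add, ← hMd, eps_Dd, map_neg, smul_neg, smul_smul, hσ, one_smul]
        abel
    refine ⟨asm (fun n => (M ^ n) g₀) fun n => (M ^ n) g₁, π_asm (fun n => π_twist_pow g₀π n)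
      (fun n => π_twist_pow g₁π n), ?_, fun z => ?_, fun h => ?_⟩
    · rintro s (rfl | hs) z
      · rw [hjv, asm_even, hsv _ hσ']
      · exact SLin.asm hS (fun n => g₀S.twist_pow_even hi hv n)
          (fun n => g₁S.twist_pow_even hi hv n) s hs z
    · refine LinearMap.congr_fun (eq_of_even (w := E.β v) (u := st.j v)
        (f := Dd P ∘ₗ asm (fun n => (M ^ n) g₀) (fun n => (M ^ n) g₁) +
          σ • (asm (fun n => (M ^ n) g₀) (fun n => (M ^ n) g₁) ∘ₗ Dd _)) (fun z => ?_) hfv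
        (fun c => ?_) fun c => ?_) z
      · simp only [LinearMap.add_apply, LinearMap.smul_apply, LinearMap.comp_apply]
        rw [asm_even, hdβ, ← hjv, hdj', hjv, asm_even, mul_add, mul_smul_comm]
      · rw [← DA.ev_zero]
        simp only [LinearMap.add_apply, LinearMap.smul_apply, LinearMap.comp_apply, Dd_tm, asm_ev,
          pow_zero, Module.End.one_apply, DA.Dd1_ev, tm_zero, add_zero, g₀d]
        rw [coeff_apply, DA.ev_zero]
      · simp only [LinearMap.add_apply, LinearMap.smul_apply, LinearMap.comp_apply, Dd_tm, map_add, asm_ev,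
          asm_od, pow_zero, Module.End.one_apply, DA.Dd1_od, zero_add, pow_one, smul_add, ← add_assoc,
          g₁d]
        simp [coeff_apply]
    · rw [one_tens, ← DA.ev_zero, asm_ev, pow_zero]
      exact g₀1 h

end LiftData

end StageEven

section StageOdd

theorem exists_seq {X : Type*} {p : ℕ → X → Prop} {q : X → Prop} {r : ℕ → X → X → Prop}
    (h0 : ∃ x, p 0 x ∧ q x) (hs : ∀ n x, p n x → ∃ y, p (n + 1) y ∧ r n x y) :
    ∃ f : ℕ → X, q (f 0) ∧ (∀ n, p n (f n)) ∧ ∀ n, r n (f n) (f (n + 1)) := by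
  obtain ⟨x, hx, hq⟩ := h0
  choose! F h1 h2 using hs
  let f : ℕ → X := fun n => Nat.rec x (fun n y => F n y) n
  have hf : ∀ n, p n (f n) := fun n => by
    induction n with
    | zero => exact hx
    | succ n ih => exact h1 n _ ih
  exact ⟨f, hq, hf, fun n => h2 n _ (hf n)⟩

namespace LiftData

variable {T Q P R C : Type} [GCDGA T] [GCDGA Q] [GCDGA P] [GCDGA R] [GCDGA C]
  {E : LiftData T Q P R} {S : Set T} {k : ℕ}

theorem SLin.twist_odd {j : T →ₐ[ℚ] C} {σ : ℚ} {f : C →ₗ[ℚ] P} (hf : E.SLin S j σ f)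
    (hS : ∀ s ∈ S, ∃ i, s ∈ Gr T i) {i : ℕ} (hi : Odd i) {v : T} (hv : v ∈ Gr T i) :
    E.SLin S j (-σ) (twist (σ • E.β v) (j v) f) := fun s hs c => by
  obtain ⟨l, hl⟩ := hS s hs
  have hvs : v * s = (-1 : ℚ) ^ l • (s * v) := by
    rw [mul_comm_hom hv, hi.neg_one_pow, sc_apply _ hl, smul_mul_assoc]
  have h1 : j v * (j s * c) = (-1 : ℚ) ^ l • (j s * (j v * c)) := by
    rw [← mul_assoc, ← map_mul, hvs, map_smul, map_mul, smul_mul_assoc, mul_assoc]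
  have h2 : ∀ p, E.β v * (E.β s * p) = (-1 : ℚ) ^ l • (E.β s * (E.β v * p)) := fun p => by
    rw [← mul_assoc, ← map_mul, hvs, map_smul, map_mul, smul_mul_assoc, mul_assoc]
  simp only [twist_apply, h1, map_smul, hf s hs, sc_apply _ hl, smul_mul_assoc, mul_smul_comm, h2,
    mul_sub, smul_smul, neg_pow σ]
  ring_nf

theorem twist_twist {w : P} {u : C} (hw : w * w = 0) (hu : u * u = 0) (f : C →ₗ[ℚ] P) :
    twist w u (twist (-w) u f) = 0 := by
  ext c
  simp only [twist_apply, mul_sub, neg_mul, mul_neg, ← mul_assoc, hw, hu, zero_mul, map_zero,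
    LinearMap.zero_apply]
  abel

theorem eq_of_odd {w : P} {u : C} {f g : Tens C (DA false k) →ₗ[ℚ] P}
    (hf : ∀ z, f ((tm u 1 + tm 1 (DA.od 0)) * z) = w * f z)
    (hg : ∀ z, g ((tm u 1 + tm 1 (DA.od 0)) * z) = w * g z)
    (h1 : ∀ c n, f (tm c (DA.ev n)) = g (tm c (DA.ev n))) : f = g := by
  have key : ∀ (f : Tens C (DA false k) →ₗ[ℚ] P),
      (∀ z, f ((tm u 1 + tm 1 (DA.od 0)) * z) = w * f z) → ∀ c n,
      f (tm c (DA.od n)) = w * f (tm (eps C c) (DA.ev n)) - f (tm (u * eps C c) (DA.ev n)) :=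
    fun f hf c n => by
      rw [← hf, add_mul, tm_mul_one_left, tm_od_mul, one_mul, map_add, add_sub_cancel_left, eps_eps,
        DA.od_mul_ev, zero_add]
  exact tensDA_ext h1 fun c n => by rw [key f hf, key g hg, h1, h1]

theorem asm_odd {w : P} {u : C} (hw : w * w = 0) (hu : u * u = 0) (heu : eps C u = -u)
    (F : ℕ → (C →ₗ[ℚ] P)) (z : Tens C (DA false k)) :
    asm F (fun n => twist w u (F n) ∘ₗ (eps C).toLinearMap) ((tm u 1 + tm 1 (DA.od 0)) * z) =
      w * asm F (fun n => twist w u (F n) ∘ₗ (eps C).toLinearMap) z := by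
  refine LinearMap.congr_fun (tensDA_ext
    (f := asm F (fun n => twist w u (F n) ∘ₗ (eps C).toLinearMap) ∘ₗ
      LinearMap.mulLeft ℚ (tm u 1 + tm 1 (DA.od 0)))
    (g := LinearMap.mulLeft ℚ w ∘ₗ asm F (fun n => twist w u (F n) ∘ₗ (eps C).toLinearMap))
    (fun c n => ?_) fun c n => ?_) z
  · simp only [LinearMap.comp_apply, LinearMap.mulLeft_apply, add_mul, tm_mul_one_left, tm_od_mul,
      one_mul, DA.od_mul_ev, map_add, asm_ev, asm_od, zero_add, AlgHom.toLinearMap_apply, eps_eps,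
      twist_apply]
    abel
  · simp only [LinearMap.comp_apply, LinearMap.mulLeft_apply, add_mul, tm_mul_one_left, tm_od_mul,
      one_mul, DA.od_mul_od, asm_od, tm_zero, map_zero, add_zero, AlgHom.toLinearMap_apply,
      twist_apply, map_mul, heu, neg_mul, map_neg, ← mul_assoc, hu, zero_mul, mul_sub, hw]
    abel

theorem Stage.extend_odd (st : E.Stage S C) (hSh : ∀ s ∈ S, ∃ i, s ∈ Gr T i) {i : ℕ} (hi : Odd i)
    {v : T} (hv : v ∈ Gr T i) (hdv : Dd T v ∈ Algebra.adjoin ℚ S) (j' : T →ₐ[ℚ] Tens C (DA false k))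
    (hj' : IsDGAHom j') (haug : ∀ t, tAug C false k (j' t) = st.j t)
    (hS : ∀ s ∈ S, j' s = tm (st.j s) 1) (hjv : j' v = tm (st.j v) 1 + tm 1 (DA.od 0)) :
    Nonempty (E.Stage (insert v S) (Tens C (DA false k))) := by
  have hdv' : Dd T v ∈ Gr T (i + 1) := Dd_mem hv
  have hsv : ∀ σ : ℚ, σ * σ = 1 → sc T σ v = σ • v := fun σ hσ => by
    obtain ⟨l, rfl⟩ := hi
    rw [sc_apply σ hv, pow_succ, pow_mul, pow_two, hσ, one_pow, one_mul]
  have hsdv : ∀ σ : ℚ, σ * σ = 1 → sc T σ (Dd T v) = Dd T v := fun σ hσ =>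
    sc_of_even hi.add_one hdv' hσ
  have hvv : v * v = 0 := by
    obtain ⟨l, rfl⟩ := hi
    exact odd_mul_self hv
  have hev : eps T v = -v := by rw [hsv _ (by norm_num), neg_one_smul]
  have hjj : st.j v * st.j v = 0 := by rw [← map_mul, hvv, map_zero]
  have hββ : ∀ σ : ℚ, (σ • E.β v) * (σ • E.β v) = 0 := fun σ => by
    rw [smul_mul_smul_comm, ← map_mul, hvv, map_zero, smul_zero]
  have hej : eps C (st.j v) = -st.j v := by rw [← map_sc st.j_dga.2, hev, map_neg]
  have hdj : ∀ c, Dd C (st.j v * c) = st.j (Dd T v) * c - st.j v * Dd C c := fun c => by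
    rw [leibniz, hej, ← st.j_dga.1, neg_mul, sub_eq_add_neg]
  have hdβ : ∀ c, Dd P (E.β v * c) = E.β (Dd T v) * c - E.β v * Dd P c := fun c => by
    rw [leibniz, ← map_sc E.β_dga.2, hev, ← E.β_dga.1, map_neg, neg_mul, sub_eq_add_neg]
  have hdj' : ∀ z, Dd _ (j' v * z) = j' (Dd T v) * z - j' v * Dd _ z := fun z => by
    rw [leibniz, ← map_sc hj'.2, hev, ← hj'.1, map_neg, neg_mul, sub_eq_add_neg]
  refine ⟨{
    q := st.q.comp (tAug C false k)
    j := j'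
    φ := asm (fun n => if n = 0 then st.φ else 0) fun n =>
      twist ((1 : ℚ) • E.β v) (st.j v) (if n = 0 then st.φ else 0) ∘ₗ (eps C).toLinearMap
    q_dga := st.q_dga.comp tAug_dga
    j_dga := hj'
    q_surj := st.q_surj.comp tAug_surj
    q_quasi := st.q_quasi.comp tAug_quasi st.q_dga tAug_dga
    hqj := fun t => by rw [AlgHom.comp_apply, haug, st.hqj]
    φ_lin := ?_
    φ_one := ?_
    φ_π := ?_
    solve := ?_ }⟩
  · have h0 : ∀ n, E.SLin S st.j 1 (if n = 0 then st.φ else 0) := fun n => by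
      split_ifs
      exacts [st.φ_lin, fun s _ c => by simp]
    rintro s (rfl | hs) z
    · rw [hjv, asm_odd (hββ 1) hjj hej, hsv _ (by norm_num), map_smul]
    · refine SLin.asm hS h0 (fun n => ?_) s hs z
      have := ((h0 n).twist_odd hSh hi hv).comp_eps st.j_dga hSh
      rwa [neg_neg] at this
  · rw [one_tens, ← DA.ev_zero, asm_ev, if_pos rfl]; exact st.φ_one
  · refine LinearMap.congr_fun (tensDA_ext (f := E.π.toLinearMap ∘ₗ asm (fun n => if n = 0 then st.φ else 0)
        fun n => twist ((1 : ℚ) • E.β v) (st.j v) (if n = 0 then st.φ else 0) ∘ₗ (eps C).toLinearMap)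
      (g := E.θ ∘ₗ (st.q.comp (tAug C false k)).toLinearMap) (fun c n => ?_) fun c n => ?_)
    · cases n with
      | zero => simp [tAug_tm, DA.aug_ev, st.φ_π]
      | succ n => simp [tAug_tm, DA.aug_ev]
    · cases n with
      | zero => simp [tAug_tm, DA.aug_od, twist_apply, st.φ_π, st.hqj, E.θ_mul]
      | succ n => simp [tAug_tm, DA.aug_od]
  · intro σ hσ f hf hfS hfd
    have hσ' : -σ * -σ = 1 := by rw [neg_mul_neg, hσ]
    have hfv : ∀ z, f ((tm (st.j v) 1 + tm 1 (DA.od 0)) * z) = (σ • E.β v) * f z := fun z => by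
      rw [← hjv, hfS v (Set.mem_insert _ _), hsv σ hσ, map_smul]
    have hfS' : E.SLin S j' σ f := fun s hs => hfS s (Set.mem_insert_of_mem _ hs)
    let φ : ℕ → (C →ₗ[ℚ] P) := fun b => coeff f (DA.ev b)
    have hNφ : ∀ b c, twist (σ • E.β v) (st.j v) (φ b) c = f (tm (eps C c) (DA.od b)) := fun b c => by
      rw [twist_apply, coeff_apply, coeff_apply, ← hfv, add_mul, tm_mul_one_left, tm_od_mul, one_mul,
        map_add, add_sub_cancel_left, DA.od_mul_ev, zero_add]
    have hdN : ∀ (g h : C →ₗ[ℚ] P), E.SLin S st.j (-σ) g → (∀ c, Dd P (g c) + σ • g (Dd C c) = h c) →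
        ∀ c, Dd P (twist (-(σ • E.β v)) (st.j v) g c) =
          twist (σ • E.β v) (st.j v) h c + σ • twist (-(σ • E.β v)) (st.j v) g (Dd C c) := by
      intro g h hg hd c
      have e1 : ∀ c, g (st.j (Dd T v) * c) = E.β (Dd T v) * g c := fun c => by
        rw [hg.adjoin _ hdv, hsdv _ hσ']
      simp only [twist_apply, ← hd, neg_mul, smul_mul_assoc, map_sub, map_neg, map_smul, hdβ, hdj, e1,
        mul_add, smul_sub, mul_smul_comm, smul_neg, smul_smul, hσ, one_smul]
      abel
    obtain ⟨ψ, ⟨hψ0, hψ1⟩, hψ, hψd⟩ := exists_seq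
      (p := fun b (g : C →ₗ[ℚ] P) => (∀ c, E.π (g c) = 0) ∧ E.SLin S st.j (-σ) g ∧
        ∃ h, twist (σ • E.β v) (st.j v) h = 0 ∧ ∀ c, Dd P (g c) + σ • g (Dd C c) = (φ b - h) c)
      (q := fun g => (∀ c, Dd P (g c) + σ • g (Dd C c) = φ 0 c) ∧ (φ 0 1 = 0 → g 1 = 0))
      (r := fun b g g' => ∀ c, Dd P (g' c) + σ • g' (Dd C c) =
        (φ (b + 1) - (σ * (b + 1 : ℕ)) • twist (-(σ • E.β v)) (st.j v) g) c)
      (by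
        obtain ⟨g, h1, h2, h3, h4⟩ := st.solve σ hσ (φ 0) (fun c => hf _) (hfS'.coeff hS _) fun c => by
          simp only [φ, coeff_apply, hfd, Dd_tm, DA.Dd2_ev, Nat.cast_zero, zero_smul, tm_zero, add_zero]
        exact ⟨g, ⟨h1, h2, 0, map_zero _, by simpa using h3⟩, h3, h4⟩)
      (by
        rintro b g ⟨h1, h2, h, hh, hgd⟩
        have hN : E.SLin S st.j σ (twist (-(σ • E.β v)) (st.j v) g) := by
          have := h2.twist_odd hSh hi hv
          rwa [neg_neg, neg_smul] at this
        obtain ⟨g', k1, k2, k3, -⟩ := st.solve σ hσ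
          (φ (b + 1) - (σ * (b + 1 : ℕ)) • twist (-(σ • E.β v)) (st.j v) g)
          (fun c => by
            rw [LinearMap.sub_apply, LinearMap.smul_apply, map_sub, map_smul, π_twist h1, smul_zero, sub_zero]
            exact hf _)
          ((hfS'.coeff hS _).sub (hN.smul _))
          (fun c => by
            have e := hdN g _ h2 hgd c
            rw [map_sub, hh, sub_zero, hNφ] at e
            rw [LinearMap.sub_apply, LinearMap.smul_apply, map_sub, map_smul, e]
            simp only [φ, coeff_apply, hfd, Dd_tm, DA.Dd2_ev, map_add, tm_smul, map_smul,
              Nat.add_sub_cancel, LinearMap.sub_apply, LinearMap.smul_apply, smul_sub, smul_add, smul_smul]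
            ring_nf
            abel)
        refine ⟨g', ⟨k1, k2, _, ?_, k3⟩, k3⟩
        rw [map_smul, twist_twist (hββ σ) hjj, smul_zero])
    have hneg : (-σ) • E.β v = -(σ • E.β v) := neg_smul _ _
    let Ψ : Tens C (DA false k) →ₗ[ℚ] P :=
      asm ψ fun n => twist (-(σ • E.β v)) (st.j v) (ψ n) ∘ₗ (eps C).toLinearMap
    have hΨv : ∀ z, Ψ (j' v * z) = -(σ • E.β v) * Ψ z := fun z => by
      rw [hjv]; exact asm_odd (by rw [neg_mul_neg, hββ]) hjj hej ψ z
    have hΨS : E.SLin S j' (-σ) Ψ := SLin.asm hS (fun n => (hψ n).2.1) fun n => by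
      have := ((hψ n).2.1.twist_odd hSh hi hv).comp_eps st.j_dga hSh
      rwa [neg_neg, hneg] at this
    refine ⟨Ψ, π_asm (fun n => (hψ n).1) (fun n c => π_twist (hψ n).1 _), ?_, fun z => ?_, fun h => ?_⟩
    · rintro s (rfl | hs) z
      · rw [hΨv, hsv _ hσ', map_smul, hneg]
      · exact hΨS s hs z
    · refine LinearMap.congr_fun (eq_of_odd (w := σ • E.β v) (u := st.j v)
        (f := Dd P ∘ₗ Ψ + σ • (Ψ ∘ₗ Dd _)) (fun z => ?_) hfv (fun c n => ?_)) z
      · have e1 : Ψ (j' (Dd T v) * z) = E.β (Dd T v) * Ψ z := by rw [hΨS.adjoin _ hdv, hsdv _ hσ']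
        simp only [LinearMap.add_apply, LinearMap.smul_apply, LinearMap.comp_apply]
        rw [← hjv, hdj', hΨv, map_sub, hΨv, e1]
        simp only [neg_mul, smul_mul_assoc, map_neg, map_smul, hdβ, mul_add, smul_sub,
          mul_smul_comm, smul_neg, smul_smul, hσ, one_smul]
        abel
      · simp only [LinearMap.add_apply, LinearMap.smul_apply, LinearMap.comp_apply, Dd_tm, map_add,
          DA.Dd2_ev, tm_smul, map_smul]
        cases n with
        | zero =>
          simp only [Ψ, asm_ev, Nat.cast_zero, zero_smul, add_zero, hψ0]; rfl
        | succ n =>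
          simp only [Ψ, asm_ev, asm_od, Nat.add_sub_cancel, LinearMap.comp_apply, smul_add,
            AlgHom.toLinearMap_apply, eps_eps, ← add_assoc, hψd, smul_smul, LinearMap.sub_apply,
            LinearMap.smul_apply, sub_add_cancel]
          rfl
    · rw [one_tens, ← DA.ev_zero]
      simp only [Ψ, asm_ev]
      refine hψ1 ?_
      rw [coeff_apply, DA.ev_zero]; exact h

end LiftData

end StageOdd

section Steps

theorem Gens.isDGAHom {A B : Type} [GCDGA A] [GCDGA B] {n m : ℕ} (G : Gens A n m) {f : A →ₐ[ℚ] B}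
    (hf : IsGrHom f) (hx : ∀ i, Dd B (f (G.x i)) = 0)
    (hy : ∀ j, Dd B (f (G.y j)) = ∑ i, ∑ k, G.B j i k • (f (G.x i) * f (G.x k))) : IsDGAHom f := by
  refine ⟨fun a => OddDer.dd.ext_hom OddDer.dd hf (G.forall_gens (P := fun v => f (Dd A v) = Dd B (f v))
    (fun i => ?_) fun j => ?_) (G.mem_adjoin a), hf⟩
  · rw [G.dx, map_zero, hx]
  · rw [G.dy, hy]; simp only [map_sum, map_smul, map_mul]

variable {A T C : Type} [GCDGA A] [GCDGA T] [GCDGA C] {n m r : ℕ}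

theorem sum_tm {A B ι : Type} [GCDGA A] [GCDGA B] (s : Finset ι) (f : ι → A) (b : B) :
    tm (∑ i ∈ s, f i) b = ∑ i ∈ s, tm (f i) b := by
  change (tmL (A := A) (B := B)).flip b (∑ i ∈ s, f i) = _
  rw [map_sum]; rfl

theorem TensorPower.exists_lift_update {TP : TensorPower A r T} {j : T →ₐ[ℚ] C} (hj : IsDGAHom j)
    {t : Bool} {k : ℕ} (c₀ : Fin r) {h : A →ₐ[ℚ] Tens C (DA t k)} (hh : IsDGAHom h)
    (haug : ∀ a, tAug C t k (h a) = j (TP.ι c₀ a)) :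
    ∃ j' : T →ₐ[ℚ] Tens C (DA t k), IsDGAHom j' ∧ (∀ a, tAug C t k (j' a) = j a) ∧
      (∀ c, c ≠ c₀ → ∀ a, j' (TP.ι c a) = tm (j (TP.ι c a)) 1) ∧ ∀ a, j' (TP.ι c₀ a) = h a := by
  let F : Fin r → (A →ₐ[ℚ] Tens C (DA t k)) := fun c =>
    if c = c₀ then h else (tInl C _).comp (j.comp (TP.ι c))
  obtain ⟨j', ⟨h1, h2⟩, -⟩ := TP.coprod _ F fun c => by
    simp only [F]
    split_ifs
    exacts [hh, (tInl_dga).comp (hj.comp (TP.ι_dga c))]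
  have h3 : ∀ c, c ≠ c₀ → ∀ a, j' (TP.ι c a) = tm (j (TP.ι c a)) 1 := fun c hc a => by
    refine (AlgHom.congr_fun (h2 c) a).trans ?_
    simp only [F, if_neg hc]
    rfl
  have h4 : ∀ a, j' (TP.ι c₀ a) = h a := fun a => by
    refine (AlgHom.congr_fun (h2 c₀) a).trans ?_
    simp only [F, if_pos]
  refine ⟨j', h1, fun a => ?_, h3, h4⟩
  refine AlgHom.congr_fun ((TP.coprod C (fun c => j.comp (TP.ι c)) fun c => hj.comp (TP.ι_dga c)).unique
    (y₁ := (tAug C t k).comp j') ⟨tAug_dga.comp h1, fun c => AlgHom.ext fun a => ?_⟩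
    ⟨hj, fun c => rfl⟩) a
  by_cases hc : c = c₀
  · subst hc
    exact (congrArg _ (h4 a)).trans (haug a)
  · exact (congrArg _ (h3 c hc a)).trans (tAug_inl _)

theorem Gens.exists_step_odd (G : Gens A n m) {TP : TensorPower A r T} {j : T →ₐ[ℚ] C} (hj : IsDGAHom j)
    (c₀ : Fin r) (l₀ : Fin m) : ∃ j' : T →ₐ[ℚ] Tens C (DA false (G.ky l₀)), IsDGAHom j' ∧
      (∀ a, tAug C false _ (j' a) = j a) ∧ (∀ c i, j' (TP.ι c (G.x i)) = tm (j (TP.ι c (G.x i))) 1) ∧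
      (∀ c l, (c, l) ≠ (c₀, l₀) → j' (TP.ι c (G.y l)) = tm (j (TP.ι c (G.y l))) 1) ∧
      j' (TP.ι c₀ (G.y l₀)) = tm (j (TP.ι c₀ (G.y l₀))) 1 + tm 1 (DA.od 0) := by
  let g := j.comp (TP.ι c₀)
  have hg : IsDGAHom g := hj.comp (TP.ι_dga c₀)
  have h1 : (1 : DA false (G.ky l₀)) ∈ Gr _ 0 := one_mem_Gr
  have hgx : ∀ i, tm (g (G.x i)) (1 : DA false (G.ky l₀)) ∈ Gr (Tens C (DA false (G.ky l₀))) (2 * G.kx i + 2) :=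
    fun i => by have := tm_mem (hg.2 _ _ (G.x_mem i)) h1; exact this
  have hgy : ∀ l, tm (g (G.y l)) (1 : DA false (G.ky l₀)) ∈ Gr (Tens C (DA false (G.ky l₀))) (2 * G.ky l + 3) :=
    fun l => by have := tm_mem (hg.2 _ _ (G.y_mem l)) h1; exact this
  obtain ⟨h, h2, hx, hy⟩ := G.lift (Tens C (DA false (G.ky l₀))) (fun i => tm (g (G.x i)) 1)
    (fun l => tm (g (G.y l)) 1 + if l = l₀ then tm 1 (DA.od 0) else 0)
    hgx (fun l => by
      refine add_mem (hgy l) ?_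
      split_ifs with hl
      · subst hl
        have := tm_mem (one_mem_Gr (A := C)) (DA.od_mem (t := false) (k := G.ky l) 0)
        simpa [dO] using this
      · exact zero_mem _)
  have hd : IsDGAHom h := by
    refine G.isDGAHom h2 (fun i => ?_) fun l => ?_
    · rw [hx, Dd_tm, ← hg.1, G.dx, map_zero, Dd_one, zero_tm, tm_zero, add_zero]
    · have : Dd (Tens C (DA false (G.ky l₀))) (if l = l₀ then tm 1 (DA.od 0) else 0) = 0 := by
        split_ifs
        · rw [Dd_tm, Dd_one, DA.Dd2_od, zero_tm, tm_zero, add_zero]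
        · exact map_zero _
      rw [hy, map_add, this, Dd_tm, ← hg.1, G.dy, Dd_one, tm_zero, add_zero, add_zero]
      simp only [hx, map_sum, map_smul, map_mul, ← tInl_apply]
  have haug : ∀ a, tAug C false _ (h a) = j (TP.ι c₀ a) := fun a => by
    refine AlgHom.congr_fun (G.hom_ext (f := (tAug C false _).comp h) (g := g) (fun i => ?_) fun l => ?_) a
    · rw [AlgHom.comp_apply, hx]; exact tAug_inl _
    · rw [AlgHom.comp_apply, hy, map_add]
      refine (congrArg₂ (· + ·) (tAug_inl _) ?_).trans (add_zero _)
      split_ifs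
      · rw [tAug_tm, DA.aug_od, zero_smul]
      · exact map_zero _
  obtain ⟨j', k1, k2, k3, k4⟩ := TensorPower.exists_lift_update hj c₀ hd haug
  refine ⟨j', k1, k2, fun c i => ?_, fun c l hcl => ?_, ?_⟩
  · by_cases hc : c = c₀
    · subst hc; rw [k4, hx]; rfl
    · exact k3 c hc _
  · by_cases hc : c = c₀
    · subst hc
      rw [k4, hy, if_neg (fun h => hcl (by rw [h])), add_zero]; rfl
    · exact k3 c hc _
  · rw [k4, hy, if_pos rfl]; rfl

theorem Gens.exists_step_even (G : Gens A n m) {TP : TensorPower A r T} {j : T →ₐ[ℚ] C} (hj : IsDGAHom j)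
    (c₀ : Fin r) (i₀ : Fin n) : ∃ j' : T →ₐ[ℚ] Tens C (DA true (G.kx i₀)), IsDGAHom j' ∧
      (∀ a, tAug C true _ (j' a) = j a) ∧
      (∀ c i, (c, i) ≠ (c₀, i₀) → j' (TP.ι c (G.x i)) = tm (j (TP.ι c (G.x i))) 1) ∧
      j' (TP.ι c₀ (G.x i₀)) = tm (j (TP.ι c₀ (G.x i₀))) 1 + tm 1 (DA.ev 1) := by
  let g := j.comp (TP.ι c₀)
  have hg : IsDGAHom g := hj.comp (TP.ι_dga c₀)
  have h1 : (1 : DA true (G.kx i₀)) ∈ Gr _ 0 := one_mem_Gr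
  have hgx : ∀ i, tm (g (G.x i)) (1 : DA true (G.kx i₀)) ∈ Gr (Tens C (DA true (G.kx i₀))) (2 * G.kx i + 2) :=
    fun i => by have := tm_mem (hg.2 _ _ (G.x_mem i)) h1; exact this
  have hgy : ∀ l, tm (g (G.y l)) (1 : DA true (G.kx i₀)) ∈ Gr (Tens C (DA true (G.kx i₀))) (2 * G.ky l + 3) :=
    fun l => by have := tm_mem (hg.2 _ _ (G.y_mem l)) h1; exact this
  let e : Fin n → DA true (G.kx i₀) := fun i => if i = i₀ then DA.ev 1 else 0
  have he : ∀ i, e i ∈ Gr (DA true (G.kx i₀)) (2 * G.kx i + 2) := fun i => by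
    simp only [e]
    split_ifs with hi
    · subst hi
      simpa using DA.ev_mem (t := true) (k := G.kx i) 1
    · exact zero_mem _
  obtain ⟨h, h2, hx, hy⟩ := G.lift (Tens C (DA true (G.kx i₀))) (fun i => tm (g (G.x i)) 1 + tm 1 (e i))
    (fun l => tm (g (G.y l)) 1 + (tm (∑ k, (2 * G.B l i₀ k) • g (G.x k)) (DA.od 0) +
      G.B l i₀ i₀ • tm 1 (DA.od 1)))
    (fun i => add_mem (hgx i) (by
      have := tm_mem (one_mem_Gr (A := C)) (he i)
      rwa [zero_add] at this)) (fun l => by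
      refine add_mem (hgy l) (add_mem ?_ ?_)
      · rw [sum_tm]
        refine sum_mem fun k _ => ?_
        rw [smul_tm]
        by_cases hB : G.B l i₀ k = 0
        · rw [hB, mul_zero, zero_smul]; exact zero_mem _
        · have := tm_mem (hg.2 _ _ (G.x_mem k)) (DA.od_mem (t := true) (k := G.kx i₀) 0)
          rw [← G.B_deg _ _ _ hB]
          refine Submodule.smul_mem _ _ ?_
          convert this using 2
          simp [dO]; ring
      · by_cases hB : G.B l i₀ i₀ = 0
        · rw [hB, zero_smul]; exact zero_mem _
        · have := tm_mem (one_mem_Gr (A := C)) (DA.od_mem (t := true) (k := G.kx i₀) 1)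
          rw [← G.B_deg _ _ _ hB]
          refine Submodule.smul_mem _ _ ?_
          convert this using 2
          simp [dO]; ring)
  have hde : ∀ i, Dd _ (e i) = 0 := fun i => by
    simp only [e]
    split_ifs
    exacts [DA.Dd1_ev _, map_zero _]
  have hdg : ∀ i, Dd C (g (G.x i)) = 0 := fun i => by rw [← hg.1, G.dx, map_zero]
  have hd : IsDGAHom h := by
    refine G.isDGAHom h2 (fun i => ?_) fun l => ?_
    · rw [hx, map_add, Dd_tm, Dd_tm, hdg, hde, Dd_one, Dd_one]
      simp only [zero_tm, tm_zero, add_zero]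
    · have hX : ∀ i, Dd _ (tm (g (G.x i)) (DA.od 0 : DA true (G.kx i₀))) =
          tm (g (G.x i)) 1 * tm 1 (DA.ev 1) := fun i => by
        rw [Dd_tm, hdg, zero_tm, zero_add, ← map_sc hg.2, G.eps_x, DA.Dd1_od, tm_mul_one_left, mul_one]
      have hW : Dd _ (tm (1 : C) (DA.od 1 : DA true (G.kx i₀))) = tm 1 (DA.ev 1) * tm 1 (DA.ev 1) := by
        rw [Dd_tm, Dd_one, zero_tm, zero_add, map_one, DA.Dd1_od, ← tInr_apply, ← tInr_apply, ← map_mul,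
          DA.ev_mul_ev]
      have hc : ∀ i, tm (1 : C) (DA.ev 1 : DA true (G.kx i₀)) * tm (g (G.x i)) 1 =
          tm (g (G.x i)) 1 * tm 1 (DA.ev 1) := fun i =>
        mul_comm_even (i := 0 + 1 * (2 * G.kx i₀ + 2)) ⟨G.kx i₀ + 1, by ring⟩
          (tm_mem one_mem_Gr (DA.ev_mem 1)) _
      have hE : ∀ i, tm (1 : C) (e i) = if i = i₀ then tm 1 (DA.ev 1) else 0 := fun i => by
        simp only [e]
        split_ifs
        exacts [rfl, tm_zero _]
      have h0 : Dd _ (tm (g (G.y l)) (1 : DA true (G.kx i₀))) =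
          ∑ i, ∑ k, G.B l i k • (tm (g (G.x i)) 1 * tm (g (G.x k)) 1) := by
        rw [Dd_tm, ← hg.1, G.dy, Dd_one, tm_zero, add_zero]
        simp only [map_sum, map_smul, map_mul, ← tInl_apply]
      have h3 : Dd _ (tm (∑ k, (2 * G.B l i₀ k) • g (G.x k)) (DA.od 0 : DA true (G.kx i₀))) =
          ∑ k, (2 * G.B l i₀ k) • (tm (g (G.x k)) 1 * tm 1 (DA.ev 1)) := by
        rw [sum_tm, map_sum]
        refine Finset.sum_congr rfl fun k _ => ?_
        rw [smul_tm, map_smul, hX]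
      rw [hy, map_add, map_add, map_smul, h0, h3, hW]
      simp only [hx, hE, mul_add, add_mul, smul_add, Finset.sum_add_distrib, mul_ite, ite_mul, mul_zero,
        zero_mul, smul_ite, smul_zero, Finset.sum_ite_eq', Finset.mem_univ, if_true, hc]
      have h5 : ∑ i, ∑ k, (if i = i₀ then G.B l i k • (tm (g (G.x k)) (1 : DA true (G.kx i₀)) *
          tm 1 (DA.ev 1)) else 0) = ∑ k, G.B l i₀ k • (tm (g (G.x k)) 1 * tm 1 (DA.ev 1)) := by
        rw [Finset.sum_comm]
        simp only [Finset.sum_ite_eq', Finset.mem_univ, if_true]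
      have h6 : ∀ i, G.B l i i₀ = G.B l i₀ i := fun i => G.B_symm _ _ _
      rw [h5]
      simp only [h6, two_mul, add_smul, Finset.sum_add_distrib, add_assoc]
  have haug : ∀ a, tAug C true _ (h a) = j (TP.ι c₀ a) := fun a => by
    refine AlgHom.congr_fun (G.hom_ext (f := (tAug C true _).comp h) (g := g) (fun i => ?_) fun l => ?_) a
    · rw [AlgHom.comp_apply, hx, map_add]
      refine (congrArg₂ (· + ·) (tAug_inl _) ?_).trans (add_zero _)
      rw [tAug_tm]
      simp only [e]
      split_ifs
      · rw [DA.aug_ev, if_neg one_ne_zero, zero_smul]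
      · rw [map_zero, zero_smul]
    · rw [AlgHom.comp_apply, hy, map_add]
      refine (congrArg₂ (· + ·) (tAug_inl _) ?_).trans (add_zero _)
      rw [map_add, map_smul, tAug_tm, tAug_tm, DA.aug_od, DA.aug_od, zero_smul, zero_smul, smul_zero,
        add_zero]
  obtain ⟨j', k1, k2, k3, k4⟩ := TensorPower.exists_lift_update hj c₀ hd haug
  refine ⟨j', k1, k2, fun c i hci => ?_, ?_⟩
  · by_cases hc : c = c₀
    · subst hc
      rw [k4, hx]
      simp only [e, if_neg (fun h : i = i₀ => hci (by rw [h])), tm_zero, add_zero]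
      rfl
    · exact k3 c hc _
  · rw [k4, hx]
    simp only [e, if_pos]
    rfl

end Steps

section Lift

variable {A T Q P R : Type} [GCDGA A] [GCDGA T] [GCDGA Q] [GCDGA P] [GCDGA R] {n m r : ℕ}

namespace Gens

variable (G : Gens A n m) (TP : TensorPower A r T)

/-- The even generators of a tensor power. -/
def tx (p : Fin r × Fin n) : T := TP.ι p.1 (G.x p.2)

/-- The odd generators of a tensor power. -/
def ty (p : Fin r × Fin m) : T := TP.ι p.1 (G.y p.2)

theorem tx_mem (p : Fin r × Fin n) : G.tx TP p ∈ Gr T (2 * G.kx p.2 + 2) :=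
  (TP.ι_dga _).2 _ _ (G.x_mem _)

theorem ty_mem (p : Fin r × Fin m) : G.ty TP p ∈ Gr T (2 * G.ky p.2 + 3) :=
  (TP.ι_dga _).2 _ _ (G.y_mem _)

theorem exists_stage_even (E : LiftData T Q P R) (X : Finset (Fin r × Fin n)) :
    ∃ (C : Type) (_ : GCDGA C), Nonempty (E.Stage (G.tx TP '' X) C) := by
  induction X using Finset.induction_on with
  | empty =>
    rw [Finset.coe_empty, Set.image_empty]
    exact ⟨Q, inferInstance, E.stage_empty⟩
  | insert p X hp ih =>
    obtain ⟨C, _, ⟨st⟩⟩ := ih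
    obtain ⟨j', h1, h2, h3, h4⟩ := G.exists_step_even (TP := TP) st.j_dga p.1 p.2
    rw [Finset.coe_insert, Set.image_insert_eq]
    refine ⟨_, inferInstance, st.extend_even ?_ (i := 2 * G.kx p.2 + 2) ⟨G.kx p.2 + 1, by ring⟩
      (G.tx_mem TP p) ?_ j' h1 h2 ?_ h4⟩
    · rintro _ ⟨q, -, rfl⟩
      exact ⟨_, G.tx_mem TP q⟩
    · rw [tx, ← (TP.ι_dga _).1, G.dx, map_zero]
    · rintro _ ⟨q, hq, rfl⟩
      exact h3 _ _ fun h => hp ((show q = p from h) ▸ hq)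

theorem exists_stage_odd (E : LiftData T Q P R) (Y : Finset (Fin r × Fin m)) :
    ∃ (C : Type) (_ : GCDGA C), Nonempty (E.Stage (G.ty TP '' Y ∪ Set.range (G.tx TP)) C) := by
  induction Y using Finset.induction_on with
  | empty =>
    obtain ⟨C, _, h⟩ := G.exists_stage_even TP E Finset.univ
    rw [Finset.coe_univ, Set.image_univ] at h
    rw [Finset.coe_empty, Set.image_empty, Set.empty_union]
    exact ⟨C, _, h⟩
  | insert p Y hp ih =>
    obtain ⟨C, _, ⟨st⟩⟩ := ih
    obtain ⟨j', h1, h2, h3, h4, h5⟩ := G.exists_step_odd (TP := TP) st.j_dga p.1 p.2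
    rw [Finset.coe_insert, Set.image_insert_eq, Set.insert_union]
    refine ⟨_, inferInstance, st.extend_odd ?_ (i := 2 * G.ky p.2 + 3) ⟨G.ky p.2 + 1, by ring⟩
      (G.ty_mem TP p) ?_ j' h1 h2 ?_ h5⟩
    · rintro _ (⟨q, -, rfl⟩ | ⟨q, rfl⟩)
      exacts [⟨_, G.ty_mem TP q⟩, ⟨_, G.tx_mem TP q⟩]
    · rw [ty, ← (TP.ι_dga _).1, G.dy]
      simp only [map_sum, map_smul, map_mul]
      refine sum_mem fun i _ => sum_mem fun k _ => Subalgebra.smul_mem _ (mul_mem ?_ ?_) _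
      exacts [Algebra.subset_adjoin (Or.inr ⟨(p.1, i), rfl⟩), Algebra.subset_adjoin (Or.inr ⟨(p.1, k), rfl⟩)]
    · rintro _ (⟨q, hq, rfl⟩ | ⟨q, rfl⟩)
      exacts [h4 _ _ fun h => hp ((show q = p from h) ▸ hq), h3 _ _]

theorem adjoin_tensorPower (hadj : Algebra.adjoin ℚ (⋃ c, Set.range (TP.ι c)) = ⊤) :
    Algebra.adjoin ℚ (Set.range (G.ty TP) ∪ Set.range (G.tx TP)) = ⊤ := by
  rw [eq_top_iff, ← hadj]
  refine Algebra.adjoin_le (Set.iUnion_subset fun c => ?_)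
  rintro _ ⟨a, rfl⟩
  have : Algebra.adjoin ℚ (Set.range G.x ∪ Set.range G.y) ≤
      (Algebra.adjoin ℚ (Set.range (G.ty TP) ∪ Set.range (G.tx TP))).comap (TP.ι c) := by
    refine Algebra.adjoin_le ?_
    rintro _ (⟨i, rfl⟩ | ⟨i, rfl⟩)
    exacts [Algebra.subset_adjoin (Or.inr ⟨(c, i), rfl⟩), Algebra.subset_adjoin (Or.inl ⟨(c, i), rfl⟩)]
  exact this (G.mem_adjoin a)

/-- Morphisms of differential modules lift through surjective quasi-isomorphisms, after replacing
the source by a resolution. -/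
theorem exists_lift {TP : TensorPower A r T} (G : Gens A n m)
    (hadj : Algebra.adjoin ℚ (⋃ c, Set.range (TP.ι c)) = ⊤) (E : LiftData T Q P R) :
    ∃ (C : Type) (_ : GCDGA C) (q : C →ₐ[ℚ] Q) (j : T →ₐ[ℚ] C) (f : C →ₗ[ℚ] P),
      IsDGAHom q ∧ IsDGAHom j ∧ Function.Surjective q ∧ QuasiIso q ∧ (∀ t, q (j t) = E.ρ t) ∧
      (∀ c, f (Dd C c) = Dd P (f c)) ∧ (∀ t c, f (j t * c) = E.β t * f c) ∧ f 1 = E.Ω := by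
  obtain ⟨C, _, ⟨st⟩⟩ := G.exists_stage_odd TP E Finset.univ
  rw [Finset.coe_univ, Set.image_univ] at st
  have hlin : ∀ {σ : ℚ} {f : C →ₗ[ℚ] P}, E.SLin (Set.range (G.ty TP) ∪ Set.range (G.tx TP)) st.j σ f →
      ∀ t c, f (st.j t * c) = E.β (sc T σ t) * f c := fun h t c =>
    h.adjoin t (by rw [G.adjoin_tensorPower TP hadj]; trivial) c
  have hφ := hlin st.φ_lin
  let f₁ : C →ₗ[ℚ] P := Dd P ∘ₗ st.φ - st.φ ∘ₗ Dd C
  have hf₁ : ∀ c, f₁ c = Dd P (st.φ c) - st.φ (Dd C c) := fun c => rfl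
  obtain ⟨g, h1, h2, h3, h4⟩ := st.solve (-1) (by norm_num) f₁
    (fun c => by rw [hf₁, map_sub, E.π_dga.1, st.φ_π, st.φ_π, st.q_dga.1, E.θ_Dd, sub_self])
    (fun s _ c => by
      rw [hf₁, hf₁, hφ, sc_one, leibniz, leibniz, map_add, ← st.j_dga.1, hφ, sc_one, ← map_sc st.j_dga.2,
        hφ, sc_one, ← E.β_dga.1, ← map_sc E.β_dga.2, mul_sub]
      abel)
    (fun c => by
      rw [hf₁, hf₁, map_sub, Dd_Dd, Dd_Dd, map_zero, sub_zero, zero_sub, neg_one_smul])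
  have h5 : g 1 = 0 := h4 (by rw [hf₁, st.φ_one, E.Dd_Ω, Dd_one, map_zero, sub_zero])
  refine ⟨C, _, st.q, st.j, st.φ - g, st.q_dga, st.j_dga, st.q_surj, st.q_quasi, st.hqj, fun c => ?_,
    fun t c => ?_, ?_⟩
  · have := h3 c
    rw [hf₁, neg_one_smul] at this
    have e : st.φ (Dd C c) = Dd P (st.φ c) - (Dd P (g c) + -g (Dd C c)) := by rw [this]; abel
    rw [LinearMap.sub_apply, LinearMap.sub_apply, map_sub, e]
    abel
  · rw [LinearMap.sub_apply, hφ, sc_one, hlin h2, neg_neg, sc_one, LinearMap.sub_apply, mul_sub]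
  · rw [LinearMap.sub_apply, st.φ_one, h5, sub_zero]

end Gens

end Lift

section Powers

variable {A T : Type} [GCDGA A] [GCDGA T]

theorem IsDId.mul {I J : Submodule ℚ T} (hI : IsDId I) (hJ : IsDId J) : IsDId (I * J) where
  homog := hI.homog.mul hJ.homog
  left b a ha := by
    refine Submodule.mul_induction_on ha (fun u hu v hv => ?_) fun x y hx hy => ?_
    · rw [← mul_assoc]; exact Submodule.mul_mem_mul (hI.left b u hu) hv
    · rw [mul_add]; exact add_mem hx hy
  dd a ha := by
    refine Submodule.mul_induction_on ha (fun u hu v hv => ?_) fun x y hx hy => ?_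
    · rw [leibniz]
      exact add_mem (Submodule.mul_mem_mul (hI.dd u hu) hv)
        (Submodule.mul_mem_mul (hI.homog.sc _ hu) (hJ.dd v hv))
    · rw [map_add]; exact add_mem hx hy

theorem IsDId.pow {I : Submodule ℚ T} (hI : IsDId I) (k : ℕ) : IsDId (I ^ (k + 1)) := by
  induction k with
  | zero => rwa [zero_add, pow_one]
  | succ k ih => rw [pow_succ]; exact ih.mul hI

theorem IsDId.pow_le {I : Submodule ℚ T} (hI : IsDId I) (k l : ℕ) : I ^ (k + 1 + l) ≤ I ^ (k + 1) := by
  induction l with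
  | zero => exact le_rfl
  | succ l ih =>
    rw [← add_assoc, pow_succ']
    exact Submodule.mul_le.2 fun a _ b hb => (hI.pow k).left a b (ih hb)

theorem TensorPower.mu_spec {r : ℕ} (TP : TensorPower A r T) :
    IsDGAHom TP.mu ∧ ∀ j, TP.mu.comp (TP.ι j) = AlgHom.id ℚ A :=
  (TP.coprod A (fun _ => AlgHom.id ℚ A) (fun _ => isDGAHom_id A)).choose_spec.1

theorem TensorPower.isDId_kerMu {r : ℕ} (TP : TensorPower A r T) : IsDId TP.kerMu :=
  isDId_ker TP.mu_spec.1

variable (T) in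
/-- The span of the components of degree at least `k`. -/
def grGe (k : ℕ) : Submodule ℚ T := ⨆ i, ⨆ (_ : k ≤ i), Gr T i

theorem gr_le_grGe {k i : ℕ} (h : k ≤ i) : Gr T i ≤ grGe T k := le_iSup₂_of_le i h le_rfl

theorem grGe_mul (k l : ℕ) : grGe T k * grGe T l ≤ grGe T (k + l) := by
  simp only [grGe, Submodule.iSup_mul, Submodule.mul_iSup]
  refine iSup_le fun j => iSup_le fun hj => iSup_le fun i => iSup_le fun hi => ?_
  exact (Submodule.mul_le.2 fun a ha b hb => mul_mem_Gr ha hb).trans (gr_le_grGe (add_le_add hi hj))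

theorem TensorPower.kerMu_pow_le [Nontrivial A] {r : ℕ} (TP : TensorPower A r T) (hT : Conn T) (k : ℕ) :
    TP.kerMu ^ (k + 1) ≤ grGe T (k + 1) := by
  have h1 : TP.kerMu ≤ grGe T 1 := fun a ha => by
    refine mem_of_pr fun i => ?_
    rcases Nat.eq_zero_or_pos i with rfl | hi
    · obtain ⟨c, hc⟩ := hT _ (pr_mem 0 a)
      have h1 : TP.mu (pr T 0 a) = 0 := TP.isDId_kerMu.homog 0 a ha
      rw [hc, map_smul, map_one, smul_eq_zero_iff_left one_ne_zero] at h1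
      rw [hc, h1, zero_smul]
      exact zero_mem _
    · exact gr_le_grGe hi (pr_mem i a)
  induction k with
  | zero => rwa [zero_add, pow_one]
  | succ k ih =>
    rw [pow_succ]
    exact (mul_le_mul' ih h1).trans (grGe_mul _ _)

theorem one_notMem_kerMu_pow [Nontrivial A] {r : ℕ} (TP : TensorPower A r T) (k : ℕ) :
    (1 : T) ∉ TP.kerMu ^ (k + 1) := fun h => by
  have h1 : (1 : T) ∈ TP.kerMu := by
    have := TP.isDId_kerMu.pow_le 0 k
    rw [zero_add, pow_one, add_comm] at this
    exact this h
  have h2 : TP.mu 1 = 0 := h1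
  rw [map_one] at h2
  exact one_ne_zero h2

/-- Some projection admits a homotopy retraction, so that `MTC` is well defined. -/
theorem exists_mtcWitness [Nontrivial A] (hc : Conn A) (hs : Small A) (r : ℕ) :
    ∃ n, Nonempty (MTCWitness A (r + 1) n) := by
  obtain ⟨T, _, TP, -, hT, R, _, π, h1, h2, h3, N, h4⟩ := exists_tensorPower hc hs r
  obtain ⟨Q, _, ρ, k1, k2, k3⟩ := exists_quotient (TP.isDId_kerMu.pow N)
  have hle : LinearMap.ker ρ.toLinearMap ≤ LinearMap.ker π.toLinearMap := by
    rw [k3]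
    refine (TP.kerMu_pow_le hT N).trans (iSup₂_le fun i hi a ha => ?_)
    exact h4 i (by omega) _ (h1.2 i a ha)
  obtain ⟨R⟩ := htpyRetraction_of_acyc k1 k2 (isDId_ker h1) h3 hle
  exact ⟨N, ⟨⟨T, TP, Q, ρ, k1, k2, k3, R.toMod⟩⟩⟩

end Powers

section Main

variable {A : Type} [GCDGA A]

/-- Integration of the last factor against a linear form. -/
def integ {T : Type} [GCDGA T] (φ : A →ₗ[ℚ] ℚ) : Tens T A →ₗ[ℚ] T :=
  tLift ((LinearMap.lsmul ℚ T ∘ₗ φ).flip)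

theorem integ_tm {T : Type} [GCDGA T] (φ : A →ₗ[ℚ] ℚ) (t : T) (a : A) : integ φ (tm t a) = φ a • t :=
  tLift_tm _ _ _

theorem integ_mul {T : Type} [GCDGA T] (φ : A →ₗ[ℚ] ℚ) (t : T) (z : Tens T A) :
    integ φ (tInl T A t * z) = t * integ φ z := by
  induction z using tens_induction with
  | h0 => rw [mul_zero, map_zero, mul_zero]
  | hadd x y hx hy => rw [mul_add, map_add, map_add, mul_add, hx, hy]
  | htm i j a b ha hb =>
    rw [tInl_apply, tm_mul_one_left, integ_tm, integ_tm, mul_smul_comm]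

theorem integ_Dd {T : Type} [GCDGA T] {φ : A →ₗ[ℚ] ℚ} (hφ : ∀ a, φ (Dd A a) = 0) (z : Tens T A) :
    integ φ (Dd _ z) = Dd T (integ φ z) := by
  induction z using tens_induction with
  | h0 => simp only [map_zero]
  | hadd x y hx hy => simp only [map_add, hx, hy]
  | htm i j a b ha hb =>
    rw [Dd_tm, map_add, integ_tm, integ_tm, integ_tm, hφ, zero_smul, add_zero, map_smul]

theorem integ_tRight {T : Type} [GCDGA T] (hA : Conn A) {φ : A →ₗ[ℚ] ℚ} {N : ℕ}
    (hN : ∀ i, ∀ a ∈ Gr A i, i ≠ N → φ a = 0) {η : A →ₐ[ℚ] A} (hη : IsGrHom η)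
    (hc : ∀ a, ∃ c : ℚ, η a = algebraMap ℚ A c)
    {ι : A →ₐ[ℚ] T} (hι : IsDGAHom ι) {z : Tens A A} (hz : z ∈ Gr (Tens A A) N) :
    integ φ (tRight A hι z) = φ (tHom η (AlgHom.id ℚ A) hη (isDGAHom_id A).gr z) • 1 := by
  induction hz using tGr_induction with
  | h0 => simp only [map_zero, zero_smul]
  | hadd a b _ _ ha hb => simp only [map_add, add_smul, ha, hb]
  | htm i j a b hij ha hb =>
    rw [tRight_tm, integ_tm, tHom_tm, AlgHom.id_apply]
    by_cases hj : j = N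
    · obtain rfl : i = 0 := by omega
      obtain ⟨c, rfl⟩ := hA a ha
      rw [map_smul, map_smul, map_one, map_one, smul_mul_assoc, one_mul, map_smul, smul_smul,
        smul_eq_mul, mul_comm]
    · obtain ⟨c, h⟩ := hc a
      rw [h, ← Algebra.smul_def, map_smul, hN j b hb hj, smul_zero, zero_smul, zero_smul]

theorem Gens.exists_mtcWitness_sub {n m : ℕ} (G : Gens A n m) (hfin : FiniteDimensional ℚ (CohClasses A))
    {s k : ℕ} {T' Q' : Type} [GCDGA T'] [GCDGA Q'] (TP' : TensorPower A (s + 2) T') {ρ' : T' →ₐ[ℚ] Q'}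
    (hρ' : IsDGAHom ρ')
    (hker' : LinearMap.ker ρ'.toLinearMap = TP'.kerMu ^ (k + 1)) (R : ModHtpyRetraction ρ') :
    m ≤ k ∧ Nonempty (MTCWitness A (s + 1) (k - m)) := by
  have := G.nt
  obtain ⟨η, hη, N, φ, Ω, hηc, hφd, hφN, hΩm, hdΩ, hΩN, hφΩ⟩ := G.exists_omega hfin
  obtain ⟨T, _, TP, hadj, -, -⟩ := exists_tensorPower G.conn (G.small hfin) s
  obtain ⟨κ, ⟨hκ, hκι⟩, -⟩ := TP'.coprod (Tens T A)
    (Fin.lastCases (tInr T A) fun c => (tInl T A).comp (TP.ι c)) fun c => by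
      induction c using Fin.lastCases with
      | last => rw [Fin.lastCases_last]; exact tInr_dga
      | cast c => rw [Fin.lastCases_castSucc]; exact tInl_dga.comp (TP.ι_dga c)
  have hκl : κ.comp (TP'.ι (Fin.last _)) = tInr T A := by rw [hκι, Fin.lastCases_last]
  have hκc : ∀ c : Fin (s + 1), κ.comp (TP'.ι c.castSucc) = (tInl T A).comp (TP.ι c) := fun c => by
    rw [hκι, Fin.lastCases_castSucc]
  obtain ⟨β, ⟨hβ, hβι⟩, -⟩ := TP.coprod T' (fun c => TP'.ι c.castSucc) fun c => TP'.ι_dga _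
  have hκβ : ∀ t, κ (β t) = tInl T A t := fun t => by
    refine AlgHom.congr_fun (AlgHom.ext_of_adjoin_eq_top (φ₁ := κ.comp β) (φ₂ := tInl T A) hadj ?_) t
    intro x hx
    obtain ⟨c, a, rfl⟩ := Set.mem_iUnion.1 hx
    refine (congrArg κ (AlgHom.congr_fun (hβι c) a)).trans (AlgHom.congr_fun (hκc c) a)
  have hμβ : ∀ t, TP'.mu (β t) = TP.mu t := fun t => by
    refine AlgHom.congr_fun (AlgHom.ext_of_adjoin_eq_top (φ₁ := TP'.mu.comp β) (φ₂ := TP.mu) hadj ?_) t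
    intro x hx
    obtain ⟨c, a, rfl⟩ := Set.mem_iUnion.1 hx
    exact (congrArg TP'.mu (AlgHom.congr_fun (hβι c) a)).trans
      ((AlgHom.congr_fun (TP'.mu_spec.2 _) a).trans (AlgHom.congr_fun (TP.mu_spec.2 c) a).symm)
  let ν : Tens A A →ₐ[ℚ] T' := tHom (TP'.ι (Fin.castSucc 0)) (TP'.ι (Fin.last _)) (TP'.ι_dga _).gr (TP'.ι_dga _).gr
  have hν : IsDGAHom ν := tHom_dga _ _ (TP'.ι_dga _) (TP'.ι_dga _)
  have hμν : TP'.mu.comp ν = mul₂ A := tens_algHom_ext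
    (fun a => (congrArg TP'.mu (tHom_inl _ _ (TP'.ι_dga _).gr (TP'.ι_dga _).gr a)).trans
      ((AlgHom.congr_fun (TP'.mu_spec.2 _) a).trans (mul₂_inl a).symm))
    (fun a => (congrArg TP'.mu (tHom_inr _ _ (TP'.ι_dga _).gr (TP'.ι_dga _).gr a)).trans
      ((AlgHom.congr_fun (TP'.mu_spec.2 _) a).trans (mul₂_inr a).symm))
  have hκν : κ.comp ν = tRight A (TP.ι_dga 0) := tens_algHom_ext
    (fun a => (congrArg κ (tHom_inl _ _ (TP'.ι_dga _).gr (TP'.ι_dga _).gr a)).trans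
      ((AlgHom.congr_fun (hκc 0) a).trans (tHom_inl _ _ (tInl_dga.comp (TP.ι_dga 0)).gr tInr_dga.gr a).symm))
    (fun a => (congrArg κ (tHom_inr _ _ (TP'.ι_dga _).gr (TP'.ι_dga _).gr a)).trans
      ((AlgHom.congr_fun hκl a).trans (tHom_inr _ _ (tInl_dga.comp (TP.ι_dga 0)).gr tInr_dga.gr a).symm))
  have hint : integ φ (κ (ν Ω)) = 1 := by
    rw [show κ (ν Ω) = tRight A (TP.ι_dga 0) Ω from AlgHom.congr_fun hκν Ω,
      integ_tRight G.conn hφN hη hηc (TP.ι_dga 0) hΩN, hφΩ, one_smul]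
  have hνΩ : ν Ω ∈ TP'.kerMu ^ m := by
    have h1 : (LinearMap.ker (mul₂ A).toLinearMap).map ν.toLinearMap ≤ TP'.kerMu := by
      rintro _ ⟨z, hz, rfl⟩
      exact (AlgHom.congr_fun hμν z).trans hz
    have h2 := Submodule.mem_map_of_mem (f := ν.toLinearMap) hΩm
    rw [Submodule.map_pow] at h2
    exact pow_le_pow_left' h1 m h2
  have hdν : Dd T' (ν Ω) = 0 := by rw [← hν.1, hdΩ, map_zero]
  have hle : m ≤ k := by
    by_contra! hlt
    obtain ⟨l, rfl⟩ := Nat.exists_eq_add_of_lt hlt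
    have h1 : ν Ω ∈ LinearMap.ker ρ'.toLinearMap := by
      rw [hker']
      refine TP'.isDId_kerMu.pow_le k l ?_
      rwa [add_right_comm]
    have h2 : R.q (R.j (ν Ω)) = 0 := (AlgHom.congr_fun R.hqj _).trans h1
    obtain ⟨b, hb⟩ := R.q_quasi.2 (R.j (ν Ω)) (by rw [← R.j_dga.1, hdν, map_zero]) ⟨0, by rw [h2, map_zero]⟩
    have h3 : (1 : T) = Dd T (integ φ (κ (R.τ b))) := by
      rw [← integ_Dd hφd, ← hκ.1, ← R.τ_chain, ← hb, R.hτj, hint]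
    have h4 := congrArg (pr T 0) h3
    rw [pr_zero_Dd, pr_same one_mem_Gr] at h4
    exact one_notMem_kerMu_pow TP 0 (h4 ▸ zero_mem _)
  refine ⟨hle, ?_⟩
  obtain ⟨l, rfl⟩ := Nat.exists_eq_add_of_le' hle
  rw [Nat.add_sub_cancel]
  obtain ⟨Q, _, ρ, hρ, hρs, hker⟩ := exists_quotient (TP.isDId_kerMu.pow l)
  have hβI : ∀ t ∈ TP.kerMu ^ (l + 1), ρ' (β t * ν Ω) = 0 := fun t ht => by
    have h1 : TP.kerMu.map β.toLinearMap ≤ TP'.kerMu := by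
      rintro _ ⟨z, hz, rfl⟩
      exact (hμβ z).trans hz
    have h2 := Submodule.mem_map_of_mem (f := β.toLinearMap) ht
    rw [Submodule.map_pow] at h2
    have h3 := Submodule.mul_mem_mul (pow_le_pow_left' h1 _ h2) hνΩ
    rw [← pow_add, add_right_comm, ← hker'] at h3
    exact h3
  let θ : Q →ₗ[ℚ] Q' := ρ'.toLinearMap ∘ₗ LinearMap.mulRight ℚ (ν Ω) ∘ₗ β.toLinearMap ∘ₗ linSection hρs
  have hθ : ∀ t, θ (ρ t) = ρ' (β t * ν Ω) := fun t => by
    have h1 : linSection hρs (ρ t) - t ∈ TP.kerMu ^ (l + 1) := by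
      rw [← hker]
      change ρ _ = 0
      rw [map_sub, linSection_spec, sub_self]
    have h2 := hβI _ h1
    rw [map_sub, sub_mul, map_sub, sub_eq_zero] at h2
    exact h2
  have hqj : ∀ t, R.q (R.j t) = ρ' t := AlgHom.congr_fun R.hqj
  let E : LiftData T Q R.C Q' :=
    { ρ := ρ
      β := R.j.comp β
      π := R.q
      θ := θ
      Ω := R.j (ν Ω)
      ρ_dga := hρ
      β_dga := R.j_dga.comp hβ
      π_dga := R.q_dga
      π_surj := R.q_surj
      acyc := acyc_ker R.q_dga R.q_surj R.q_quasi
      Dd_Ω := by rw [← R.j_dga.1, hdν, map_zero]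
      θ_mul := fun t c => by
        obtain ⟨c, rfl⟩ := hρs c
        rw [← map_mul ρ, hθ, hθ, map_mul β, AlgHom.comp_apply, hqj, mul_assoc, map_mul ρ']
      θ_one := by rw [← map_one ρ, hθ, map_one, one_mul, hqj]
      θ_Dd := fun c => by
        obtain ⟨c, rfl⟩ := hρs c
        rw [← hρ.1, hθ, hθ, ← hρ'.1, leibniz, hdν, mul_zero, add_zero, hβ.1]
      nt := fun h => one_notMem_kerMu_pow TP l (by
        rw [← hker]
        exact (map_one ρ).trans h) }
  obtain ⟨C, _, q, j, f, h1, h2, h3, h4, h5, h6, h7, h8⟩ := G.exists_lift hadj E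
  have hτ : ∀ t c, integ φ (κ (R.τ (f (j t * c)))) = t * integ φ (κ (R.τ (f c))) := fun t c => by
    rw [h7, show E.β t = R.j (β t) from rfl, R.τ_mod, map_mul, hκβ, integ_mul]
  refine ⟨⟨T, TP, Q, ρ, hρ, hρs, hker, ⟨⟨C, j, q, integ φ ∘ₗ κ.toLinearMap ∘ₗ R.τ ∘ₗ f, h2, h1, h3, h4,
    AlgHom.ext h5, fun c => ?_, hτ, fun t => ?_⟩⟩⟩⟩
  · change integ φ (κ (R.τ (f (Dd C c)))) = Dd T (integ φ (κ (R.τ (f c))))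
    rw [h6, R.τ_chain, hκ.1, integ_Dd hφd]
  · change integ φ (κ (R.τ (f (j t)))) = t
    have := hτ t 1
    rwa [mul_one, h8, show E.Ω = R.j (ν Ω) from rfl, R.hτj, hint, mul_one] at this

end Main

/-- For a pure coformal elliptic minimal Sullivan model and
any `r ≥ 2`, `cat(ΛV) + MTC_r(ΛV) ≤ MTC_{r+1}(ΛV)`. -/
theorem cat_add_MTC_le_MTC_succ (A : Type) [GCDGA A] (S : MinimalSullivan A)
    (hpure : S.Pure) (hcof : S.Coformal) (hell : Elliptic A S)
    (r : ℕ) (hr : 2 ≤ r) :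
    cat A S + MTC A r ≤ MTC A (r + 1) := by
  obtain ⟨s, rfl⟩ := Nat.exists_eq_add_of_le' (one_le_two.trans hr)
  obtain ⟨n, m, G, hS⟩ := S.exists_gens hpure hcof hell
  have hfin := hell.2
  have hcat := G.cat_le S hS hfin
  have := G.nt
  obtain ⟨⟨T', TP', Q', ρ', hρ, -, hker, ⟨R⟩⟩⟩ : Nonempty (MTCWitness A (s + 2) (MTC A (s + 2))) :=
    Nat.sInf_mem (exists_mtcWitness G.conn (G.small hfin) (s + 1))
  obtain ⟨hle, hw⟩ := G.exists_mtcWitness_sub hfin TP' hρ hker R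
  have h : MTC A (s + 1) ≤ MTC A (s + 2) - m := Nat.sInf_le hw
  change cat A S + MTC A (s + 1) ≤ MTC A (s + 2)
  omega

end RHT
end
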